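/- (Kerov's conjecture, proved by Féray) For every integer k ≥ 1, all coefficients of the Kerov polynomial K_k — the unique polynomial with integer coefficients in the variables R_2, R_3, … such that Σ_k^λ = K_k(R_2^λ, R_3^λ, …) holds for every Young diagram λ — are nonnegative integers. -/

import Mathlib

open scoped BigOperators

namespace AsympRep

/-- A fixed filling: the canonical bijection between `Fin μ.card` and the cells of `μ`. -/
noncomputable def fill (μ : YoungDiagram) : Fin μ.card ≃ {c // c ∈ μ.cells} :=
  (Fintype.equivFinOfCardEq (Fintype.card_coe _)).symm

/-- Row coordinate of the box occupied by `x` in the canonical filling. -/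
noncomputable def rowOf (μ : YoungDiagram) (x : Fin μ.card) : ℕ := (fill μ x).1.1

/-- Column coordinate of the box occupied by `x` in the canonical filling. -/
noncomputable def colOf (μ : YoungDiagram) (x : Fin μ.card) : ℕ := (fill μ x).1.2

/-- The Young symmetrizer `c_μ = a_μ * b_μ` in the group algebra `ℚ[S_n]`, `n = |μ|`,
where `a_μ` is the sum of the row-preserving permutations and `b_μ` is the signed sum
of the column-preserving permutations (for the canonical filling of `μ`). -/
noncomputable def youngSymmetrizer (μ : YoungDiagram) :
    MonoidAlgebra ℚ (Equiv.Perm (Fin μ.card)) :=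
  (∑ g : Equiv.Perm (Fin μ.card),
      if ∀ x, rowOf μ (g x) = rowOf μ x then MonoidAlgebra.single g (1 : ℚ) else 0) *
  (∑ g : Equiv.Perm (Fin μ.card),
      if ∀ x, colOf μ (g x) = colOf μ x
      then MonoidAlgebra.single g ((Equiv.Perm.sign g : ℤ) : ℚ) else 0)

/-- The Specht module: the left ideal `ℚ[S_n]·c_μ`, realizing the irreducible
representation `ρ^μ` of `S_n` (by left multiplication). -/
noncomputable def spechtModule (μ : YoungDiagram) :
    Submodule ℚ (MonoidAlgebra ℚ (Equiv.Perm (Fin μ.card))) :=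
  LinearMap.range (LinearMap.mulRight ℚ (youngSymmetrizer μ))

theorem spechtModule_invariant (μ : YoungDiagram) (π : Equiv.Perm (Fin μ.card)) :
    ∀ x ∈ spechtModule μ,
      (LinearMap.mulLeft ℚ (MonoidAlgebra.single π (1 : ℚ))) x ∈ spechtModule μ := by
  rintro x ⟨y, rfl⟩
  exact ⟨MonoidAlgebra.single π (1 : ℚ) * y, by
    simp only [LinearMap.mulRight_apply, LinearMap.mulLeft_apply, mul_assoc]⟩

/-- The irreducible character `χ^μ(π) = Tr ρ^μ(π)` of the symmetric group `S_n`,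
`n = |μ|`, computed as the trace of left multiplication by `π` on the Specht module. -/
noncomputable def irrChar (μ : YoungDiagram) (π : Equiv.Perm (Fin μ.card)) : ℚ :=
  LinearMap.trace ℚ (spechtModule μ)
    ((LinearMap.mulLeft ℚ (MonoidAlgebra.single π (1 : ℚ))).restrict
      (spechtModule_invariant μ π))

/-- The normalized character
`Σ_π^μ = n(n-1)⋯(n-k+1) · Tr ρ^μ(π) / Tr ρ^μ(e)` for `π ∈ S_k`, where `π` is regarded
as a permutation of `{1,…,n}` acting as the identity on `{k+1,…,n}`; it is `0` if `k > n`. -/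
noncomputable def normChar {k : ℕ} (μ : YoungDiagram) (π : Equiv.Perm (Fin k)) : ℚ :=
  if h : k ≤ μ.card then
    (μ.card.descFactorial k : ℚ)
      * irrChar μ (π.viaEmbedding (Fin.castLEEmb h)) / irrChar μ 1
  else 0

/-- `Σ_m^μ`: the normalized character on the `m`-cycle `(1,2,…,m) ∈ S_m`. -/
noncomputable def SigmaCycle (μ : YoungDiagram) (m : ℕ) : ℚ := normChar μ (finRotate m)

/-- The dilation `sμ` of a Young diagram: every box is replaced by an `s × s` grid
of boxes. -/
def dilate (μ : YoungDiagram) (s : ℕ) : YoungDiagram where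
  cells := (Finset.range (s * μ.colLen 0) ×ˢ Finset.range (s * μ.rowLen 0)).filter
      (fun c => (c.1 / s, c.2 / s) ∈ μ.cells)
  isLowerSet := by
    intro a b hba h
    simp only [Finset.coe_filter, Set.mem_setOf_eq, Finset.mem_product,
      Finset.mem_range] at h ⊢
    exact ⟨⟨lt_of_le_of_lt hba.1 h.1.1, lt_of_le_of_lt hba.2 h.1.2⟩,
      μ.isLowerSet (Prod.mk_le_mk.mpr
        ⟨Nat.div_le_div_right hba.1, Nat.div_le_div_right hba.2⟩) h.2⟩

open scoped Classical in
/-- The `k`-th free cumulant `R_k^μ`: the coefficient of `s^k` in the polynomial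
`s ↦ Σ_{k-1}^{sμ}`. -/
noncomputable def freeCumulant (μ : YoungDiagram) (k : ℕ) : ℚ :=
  if h : ∃ p : Polynomial ℚ, ∀ s : ℕ, 0 < s →
      SigmaCycle (dilate μ s) (k - 1) = Polynomial.eval (s : ℚ) p
  then h.choose.coeff k else 0

/-- `N^μ(σ₁,σ₂)`: the number of colorings of the cycles of `σ₁` (by column numbers)
and of the cycles of `σ₂` (by row numbers) compatible with `μ`.  A coloring of the
cycles is encoded as a pair of functions on points constant on the respective cycles;
compatibility means that for every point `a` the box in column `h₁(a)` and row `h₂(a)`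
belongs to `μ` (two cycles intersect precisely when they share a point). -/
noncomputable def Ncolorings {k : ℕ} (μ : YoungDiagram) (σ₁ σ₂ : Equiv.Perm (Fin k)) : ℕ :=
  Set.ncard {h : (Fin k → ℕ) × (Fin k → ℕ) |
    (∀ a, h.1 (σ₁ a) = h.1 a) ∧ (∀ a, h.2 (σ₂ a) = h.2 a) ∧
    ∀ a, (h.2 a, h.1 a) ∈ μ.cells }

/-- `|C(σ)|`: the number of cycles of a permutation (fixed points count as cycles),
i.e. the number of orbits. -/
noncomputable def numCycles {k : ℕ} (σ : Equiv.Perm (Fin k)) : ℕ :=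
  Set.ncard {s : Set (Fin k) | ∃ a, s = {b | σ.SameCycle a b}}

/-- The region of the plane occupied by the Young diagram `μ` drawn in the French
convention (row `i` of the diagram, `0`-indexed, occupies `[0, μ_i] × [i, i+1]`). -/
def frenchRegion (μ : YoungDiagram) : Set (ℝ × ℝ) :=
  {p | 0 ≤ p.1 ∧ 0 ≤ p.2 ∧ p.1 ≤ (μ.rowLen ⌊p.2⌋.toNat : ℝ)}

/-- The parameter `S_i^μ = (i-1) ∬_{(x,y)∈μ} (x-y)^{i-2} dx dy` (French convention). -/
noncomputable def Sparam (μ : YoungDiagram) (i : ℕ) : ℝ :=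
  ((i : ℝ) - 1) * ∫ p in frenchRegion μ, (p.1 - p.2) ^ (i - 2)

/-- The profile `ω : ℝ → ℝ` of a Young diagram: the boundary of the diagram drawn in
the Russian convention, i.e. the image of the French region under the rotation by `π/4`
composed with the dilation by `√2`, `(x, y) ↦ (x - y, x + y)`.  `ω(u)` is the largest
`v` with `(u,v)` in the rotated region, and `ω(u) = |u|` away from the diagram. -/
noncomputable def profile (μ : YoungDiagram) (u : ℝ) : ℝ :=
  max |u| (sSup {v : ℝ | ((u + v) / 2, (v - u) / 2) ∈ frenchRegion μ})

section KerovPositivity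
open Equiv Finset

set_option linter.unusedSectionVars false

section Shape
variable {α : Type*} [Fintype α] [DecidableEq α]

/-- `r` and `c` are the row and column coordinates of a bijective labelling by `α` of the boxes
of a Young diagram. -/
structure IsShape {α : Type*} (r c : α → ℕ) : Prop where
  inj : ∀ x y, r x = r y → c x = c y → x = y
  lower : ∀ x i j, i ≤ r x → j ≤ c x → ∃ y, r y = i ∧ c y = j

variable {r c : α → ℕ}

theorem IsShape.card_row_lt_le (h : IsShape r c) (g : Perm α)
    (hg : ∀ x y, r x = r y → c (g x) = c (g y) → x = y) (i j : ℕ) :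
    #{x | r x = i ∧ c (g x) < j} ≤ #{x | r x = i ∧ c x < j} := by
  by_cases hall : ∀ x, r x = i → c x < j
  · refine card_le_card fun x hx => ?_
    simp only [mem_filter, mem_univ, true_and] at hx ⊢
    exact ⟨hx.1, hall x hx.1⟩
  · push Not at hall
    obtain ⟨z, hz, hzj⟩ := hall
    calc #{x | r x = i ∧ c (g x) < j} ≤ #(range j) := by
          refine card_le_card_of_injOn (fun x => c (g x)) (fun x hx => ?_) fun x hx y hy hxy => ?_
          · simp only [coe_filter, mem_univ, true_and, Set.mem_ofPred_eq] at hx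
            simpa using hx.2
          · simp only [coe_filter, mem_univ, true_and, Set.mem_ofPred_eq] at hx hy
            exact hg x y (hx.1.trans hy.1.symm) hxy
      _ ≤ #(image c {x | r x = i ∧ c x < j}) := by
          refine card_le_card fun k hk => ?_
          obtain ⟨y, hy1, hy2⟩ := h.lower z i k hz.ge ((mem_range.1 hk).le.trans hzj)
          exact mem_image.2 ⟨y, by simpa [hy1, hy2] using hk, hy2⟩
      _ ≤ _ := card_image_le

theorem IsShape.exists_same_row (h : IsShape r c) (g : Perm α)
    (hg : ∀ x y, r x = r y → c (g x) = c (g y) → x = y) (x : α) :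
    ∃ y, r y = r x ∧ c y = c (g x) := by
  by_contra! hne
  have hlt : ∀ y, r y = r x → c y < c (g x) := by
    intro y hy
    by_contra! hle
    obtain ⟨z, hz1, hz2⟩ := h.lower y (r x) (c (g x)) hy.ge hle
    exact hne z hz1 hz2
  set j := c (g x)
  have hsum : ∀ f : α → ℕ, ∑ i ∈ univ.image r, #{y | r y = i ∧ f y < j} = #{y | f y < j} := by
    intro f
    rw [card_eq_sum_card_fiberwise (f := r) (t := univ.image r) (fun y _ => by simp)]
    refine sum_congr rfl fun i _ => ?_
    rw [filter_filter]
    exact congrArg card (filter_congr fun y _ => and_comm)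
  have htot : #{y | c (g y) < j} = #{y | c y < j} :=
    card_bij (fun y _ => g y) (by simp) (by simp) fun y hy => ⟨g.symm y, by simpa using hy, by simp⟩
  have heq := (sum_eq_sum_iff_of_le (s := univ.image r) fun i _ => h.card_row_lt_le g hg i j).1
    (by rw [hsum, hsum]; exact htot) (r x) (mem_image_of_mem _ (mem_univ x))
  have hrow : #{y | r y = r x ∧ c y < j} = #{y | r y = r x} :=
    congrArg card (filter_congr fun y _ => ⟨fun a => a.1, fun a => ⟨a, hlt y a⟩⟩)
  have hsub : ({y | r y = r x ∧ c (g y) < j} : Finset α) = ({y | r y = r x} : Finset α) :=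
    eq_of_subset_of_card_le (fun y hy => by
      simp only [mem_filter, mem_univ, true_and] at hy ⊢; exact hy.1) (by rw [heq, hrow])
  have hx : x ∈ ({y | r y = r x ∧ c (g y) < j} : Finset α) := by rw [hsub]; simp
  simp [j] at hx

/-- Von Neumann's lemma. -/
theorem IsShape.exists_factor (h : IsShape r c) (g : Perm α)
    (hg : ∀ x y, r x = r y → c (g x) = c (g y) → x = y) :
    ∃ p q : Perm α, (∀ x, r (p x) = r x) ∧ (∀ x, c (q x) = c x) ∧ q * p = g := by
  choose f hf1 hf2 using h.exists_same_row g hg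
  have hinj : Function.Injective f := fun x y hxy =>
    hg x y (by rw [← hf1 x, hxy, hf1]) (by rw [← hf2 x, hxy, hf2])
  let p := Equiv.ofBijective f (Finite.injective_iff_bijective.1 hinj)
  refine ⟨p, g * p⁻¹, hf1, fun x => ?_, by group⟩
  have := hf2 (p⁻¹ x)
  rw [show f (p⁻¹ x) = x from p.apply_symm_apply x] at this
  exact this.symm

/-- The function `g ↦ ∑ sgn q` over factorisations `g = q p` with `p` preserving rows and `q`
preserving columns; up to inversion, the coefficients of the Young symmetrizer. -/
def youngCoeff (r c : α → ℕ) (g : Perm α) : ℚ :=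
  ∑ q : Perm α, ∑ p : Perm α,
    if (∀ x, c (q x) = c x) ∧ (∀ x, r (p x) = r x) ∧ q * p = g then
      ((Perm.sign q : ℤ) : ℚ) else 0

theorem youngCoeff_one (h : IsShape r c) : youngCoeff r c 1 = 1 := by
  unfold youngCoeff
  rw [sum_eq_single 1, sum_eq_single 1]
  · simp
  · intro p _ hp
    rw [if_neg]
    rintro ⟨-, -, h3⟩
    exact hp (by simpa using h3)
  · simp
  · intro q _ hq
    refine sum_eq_zero fun p _ => if_neg ?_
    rintro ⟨h1, h2, h3⟩
    apply hq
    ext x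
    have hqp : q = p⁻¹ := eq_inv_of_mul_eq_one_left h3
    refine h.inj _ _ ?_ (h1 x)
    have := h2 (p⁻¹ x)
    rw [show p (p⁻¹ x) = x from p.apply_symm_apply x] at this
    rw [hqp]; exact this.symm
  · simp

theorem youngCoeff_mul_left (q₀ g : Perm α) (hq : ∀ x, c (q₀ x) = c x) :
    youngCoeff r c (q₀ * g) = ((Perm.sign q₀ : ℤ) : ℚ) * youngCoeff r c g := by
  unfold youngCoeff
  rw [mul_sum, ← Equiv.sum_comp (Equiv.mulLeft q₀)]
  refine sum_congr rfl fun q _ => ?_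
  rw [mul_sum]
  refine sum_congr rfl fun p _ => ?_
  simp only [coe_mulLeft, Perm.mul_apply, hq, mul_assoc, mul_right_inj, Perm.sign_mul]
  split_ifs <;> simp

theorem youngCoeff_mul_right (p₀ g : Perm α) (hp : ∀ x, r (p₀ x) = r x) :
    youngCoeff r c (g * p₀) = youngCoeff r c g := by
  unfold youngCoeff
  refine sum_congr rfl fun q _ => ?_
  rw [← Equiv.sum_comp (Equiv.mulRight p₀)]
  refine sum_congr rfl fun p _ => ?_
  have : (∀ x, r ((p * p₀) x) = r x) ↔ ∀ x, r (p x) = r x := by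
    refine ⟨fun h x => ?_, fun h x => by rw [Perm.mul_apply, h, hp]⟩
    have h1 := h (p₀⁻¹ x)
    have h2 := hp (p₀⁻¹ x)
    rw [Perm.mul_apply] at h1
    rw [show p₀ (p₀⁻¹ x) = x from p₀.apply_symm_apply x] at h1 h2
    rw [h1, h2]
  simp only [coe_mulRight, this, ← mul_assoc, mul_left_inj]

theorem comp_swap_eq {β : Type*} {f : α → β} {x y : α} (h : f x = f y) (z : α) :
    f (swap x y z) = f z := by
  rw [swap_apply_def]
  split_ifs with h1 h2
  · rw [h1, h]
  · rw [h2, h]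
  · rfl

/-- Uniqueness of functions which are biequivariant for the column and row stabilisers. -/
theorem IsShape.eq_mul_youngCoeff (h : IsShape r c) (ψ : Perm α → ℚ)
    (h1 : ∀ q g, (∀ x, c (q x) = c x) → ψ (q * g) = ((Perm.sign q : ℤ) : ℚ) * ψ g)
    (h2 : ∀ p g, (∀ x, r (p x) = r x) → ψ (g * p) = ψ g) (g : Perm α) :
    ψ g = ψ 1 * youngCoeff r c g := by
  by_cases hg : ∀ x y, r x = r y → c (g x) = c (g y) → x = y
  · obtain ⟨p, q, hp, hq, rfl⟩ := h.exists_factor g hg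
    rw [h2 _ _ hp, youngCoeff_mul_right _ _ hp, ← mul_one q, h1 _ _ hq,
      youngCoeff_mul_left _ _ hq, youngCoeff_one h]
    ring
  · push Not at hg
    obtain ⟨x, y, hr, hc, hxy⟩ := hg
    have key : ∀ φ : Perm α → ℚ,
        (∀ q g, (∀ x, c (q x) = c x) → φ (q * g) = ((Perm.sign q : ℤ) : ℚ) * φ g) →
        (∀ p g, (∀ x, r (p x) = r x) → φ (g * p) = φ g) → φ g = 0 := by
      intro φ h1 h2
      have e1 := h2 (swap x y) g (comp_swap_eq hr)
      rw [mul_swap_eq_swap_mul, h1 _ _ (comp_swap_eq hc),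
        Perm.sign_swap (g.injective.ne hxy)] at e1
      push_cast at e1
      linarith
    rw [key ψ h1 h2, key (youngCoeff r c) youngCoeff_mul_left youngCoeff_mul_right, mul_zero]

end Shape

theorem isShape_rowOf_colOf (μ : YoungDiagram) : IsShape (rowOf μ) (colOf μ) where
  inj x y hr hc := (fill μ).injective (Subtype.ext (Prod.ext hr hc))
  lower x i j hi hj := by
    have hmem : (i, j) ∈ μ.cells :=
      μ.isLowerSet (Prod.mk_le_mk.2 ⟨hi, hj⟩ : (i, j) ≤ (rowOf μ x, colOf μ x)) (fill μ x).2
    exact ⟨(fill μ).symm ⟨(i, j), hmem⟩, by simp [rowOf], by simp [colOf]⟩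

section Trace
variable (μ : YoungDiagram)

theorem perm_comp_iff_inv {α β : Type*} (f : α → β) (p : Perm α) :
    (∀ x, f (p⁻¹ x) = f x) ↔ ∀ x, f (p x) = f x := by
  refine ⟨fun h x => ?_, fun h x => ?_⟩
  · have := h (p x)
    rw [show p⁻¹ (p x) = x from p.symm_apply_apply x] at this
    exact this.symm
  · have := h (p⁻¹ x)
    rw [show p (p⁻¹ x) = x from p.apply_symm_apply x] at this
    exact this.symm

theorem coeff_youngSymmetrizer (g : Perm (Fin μ.card)) :
    (youngSymmetrizer μ).coeff g = youngCoeff (rowOf μ) (colOf μ) g⁻¹ := by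
  unfold youngSymmetrizer youngCoeff
  rw [sum_mul_sum, MonoidAlgebra.coeff_sum, Finsupp.finsetSum_apply]
  refine Eq.trans ?_ sum_comm
  refine Fintype.sum_equiv (Equiv.inv _) _ _ fun p => ?_
  rw [MonoidAlgebra.coeff_sum, Finsupp.finsetSum_apply]
  refine Fintype.sum_equiv (Equiv.inv _) _ _ fun q => ?_
  simp only [Equiv.inv_apply, perm_comp_iff_inv, Perm.sign_inv]
  by_cases hq : ∀ x, colOf μ (q x) = colOf μ x
  · by_cases hp : ∀ x, rowOf μ (p x) = rowOf μ x
    · rw [if_pos hp, if_pos hq, MonoidAlgebra.single_mul_single, MonoidAlgebra.coeff_single,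
        Finsupp.single_apply]
      have : q⁻¹ * p⁻¹ = g⁻¹ ↔ p * q = g := by
        rw [← mul_inv_rev, inv_inj]
      simp [hp, hq, this]
    · simp [hp]
  · simp [hq]

theorem single_mul_youngSymmetrizer (p : Perm (Fin μ.card)) (hp : ∀ x, rowOf μ (p x) = rowOf μ x) :
    MonoidAlgebra.single p (1 : ℚ) * youngSymmetrizer μ = youngSymmetrizer μ := by
  ext g
  rw [MonoidAlgebra.coeff_single_mul_apply, coeff_youngSymmetrizer, coeff_youngSymmetrizer,
    mul_inv_rev, inv_inv, youngCoeff_mul_right _ _ hp, one_mul]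

theorem youngSymmetrizer_mul_single (q : Perm (Fin μ.card)) (hq : ∀ x, colOf μ (q x) = colOf μ x) :
    youngSymmetrizer μ * MonoidAlgebra.single q (1 : ℚ) =
      ((Perm.sign q : ℤ) : ℚ) • youngSymmetrizer μ := by
  ext g
  rw [MonoidAlgebra.coeff_mul_single_apply, coeff_youngSymmetrizer, MonoidAlgebra.coeff_smul,
    Finsupp.smul_apply, coeff_youngSymmetrizer, mul_inv_rev, inv_inv, youngCoeff_mul_left _ _ hq,
    mul_one, smul_eq_mul]

theorem exists_youngSymmetrizer_mul_self :
    ∃ κ : ℚ, youngSymmetrizer μ * youngSymmetrizer μ = κ • youngSymmetrizer μ := by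
  set y := youngSymmetrizer μ with hy
  refine ⟨(y * y).coeff 1, ?_⟩
  ext g
  have key := (isShape_rowOf_colOf μ).eq_mul_youngCoeff (fun g => (y * y).coeff g⁻¹) ?_ ?_ g⁻¹
  · simpa [hy, coeff_youngSymmetrizer] using key
  · intro q g hq
    have := congrArg (fun z => (y * z).coeff g⁻¹) (youngSymmetrizer_mul_single μ q hq)
    simp only [← mul_assoc, MonoidAlgebra.coeff_mul_single_apply, mul_smul_comm,
      MonoidAlgebra.coeff_smul, Finsupp.smul_apply, smul_eq_mul, mul_one] at this
    simpa using this
  · intro p g hp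
    have := congrArg (fun z => (z * y).coeff g⁻¹) (single_mul_youngSymmetrizer μ p hp)
    simp only [mul_assoc, MonoidAlgebra.coeff_single_mul_apply, one_mul] at this
    simpa using this

theorem trace_mulLeft_comp_mulRight (π : Perm (Fin μ.card)) :
    LinearMap.trace ℚ _ (LinearMap.mulLeft ℚ (MonoidAlgebra.single π (1 : ℚ)) ∘ₗ
      LinearMap.mulRight ℚ (youngSymmetrizer μ)) =
    ∑ g, youngCoeff (rowOf μ) (colOf μ) (g⁻¹ * π * g) := by
  rw [LinearMap.trace_eq_matrix_trace ℚ (MonoidAlgebra.basis (Perm (Fin μ.card)) ℚ), Matrix.trace]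
  refine sum_congr rfl fun g _ => ?_
  rw [Matrix.diag_apply, LinearMap.toMatrix_apply, MonoidAlgebra.basis_apply]
  change (MonoidAlgebra.single π (1 : ℚ) * (MonoidAlgebra.single g (1 : ℚ) *
    youngSymmetrizer μ)).coeff g = _
  rw [MonoidAlgebra.coeff_single_mul_apply, MonoidAlgebra.coeff_single_mul_apply,
    coeff_youngSymmetrizer]
  simp [mul_assoc]

theorem exists_mul_irrChar :
    ∃ κ : ℚ, ∀ π, κ * irrChar μ π = ∑ g, youngCoeff (rowOf μ) (colOf μ) (g⁻¹ * π * g) := by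
  obtain ⟨κ, hκ⟩ := exists_youngSymmetrizer_mul_self μ
  refine ⟨κ, fun π => ?_⟩
  rw [← trace_mulLeft_comp_mulRight]
  set L := LinearMap.mulLeft ℚ (MonoidAlgebra.single π (1 : ℚ)) with hL
  set T := LinearMap.mulRight ℚ (youngSymmetrizer μ) with hT
  have hf : ∀ x, (L ∘ₗ T) x ∈ spechtModule μ := fun x =>
    spechtModule_invariant μ π _ ⟨x, rfl⟩
  rw [← LinearMap.trace_restrict_eq_of_forall_mem (spechtModule μ) (L ∘ₗ T) hf, irrChar,
    ← smul_eq_mul, ← map_smul]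
  congr 1
  ext1 ⟨_, x, rfl⟩
  apply Subtype.ext
  simp [L, T, mul_assoc, hκ]

end Trace

section Ch
variable {A B α β : Type*} [Fintype A] [DecidableEq A] [Fintype α] [DecidableEq α]

/-- The normalized character as a sum over embeddings of the coefficients of the Young symmetrizer. -/
noncomputable def embChar (r c : α → ℕ) (π : Perm A) : ℚ :=
  ∑ ι : A ↪ α, youngCoeff r c (π.viaEmbedding ι)

theorem viaEmbedding_trans_equiv (π : Perm A) (ι : A ↪ α) (g : α ≃ β) :
    π.viaEmbedding (ι.trans g.toEmbedding) = g.permCongr (π.viaEmbedding ι) := by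
  ext y
  obtain ⟨x, rfl⟩ := g.surjective y
  rw [Equiv.permCongr_apply, symm_apply_apply]
  by_cases hx : x ∈ Set.range ι
  · obtain ⟨a, rfl⟩ := hx
    have := Perm.viaEmbedding_apply π (ι.trans g.toEmbedding) a
    rw [Perm.viaEmbedding_apply]
    exact this
  · rw [Perm.viaEmbedding_apply_of_notMem π ι _ hx, Perm.viaEmbedding_apply_of_notMem]
    rintro ⟨a, ha⟩
    exact hx ⟨a, g.injective ha⟩

theorem exists_trans_eq (ι₁ ι₂ : A ↪ α) : ∃ g : Perm α, ι₁.trans g.toEmbedding = ι₂ := by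
  obtain ⟨g, hg⟩ := Perm.exists_extending_pair ι₁ ι₂ ι₁.injective ι₂.injective
  exact ⟨g, Function.Embedding.ext hg⟩

theorem sum_embedding_trans (F : (A ↪ α) → ℚ) (ι₀ : A ↪ α) :
    (Fintype.card (A ↪ α) : ℚ) * ∑ g : Perm α, F (ι₀.trans g.toEmbedding) =
      (Fintype.card (Perm α) : ℚ) * ∑ ι, F ι := by
  have h1 : ∀ ι : A ↪ α, ∑ g : Perm α, F (ι.trans g.toEmbedding) =
      ∑ g : Perm α, F (ι₀.trans g.toEmbedding) := by
    intro ι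
    obtain ⟨h, rfl⟩ := exists_trans_eq ι₀ ι
    exact Fintype.sum_equiv (Equiv.mulRight h) _ _ fun g => rfl
  have h2 : ∀ g : Perm α, ∑ ι : A ↪ α, F (ι.trans g.toEmbedding) = ∑ ι, F ι := fun g =>
    Fintype.sum_bijective (fun ι : A ↪ α => ι.trans g.toEmbedding)
      ⟨fun ι₁ ι₂ h => by
        ext a; exact g.injective (DFunLike.congr_fun h a),
       fun ι => ⟨ι.trans g.symm.toEmbedding, by ext a; simp⟩⟩ _ _ fun _ => rfl
  calc _ = ∑ ι : A ↪ α, ∑ g : Perm α, F (ι.trans g.toEmbedding) := by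
        rw [sum_congr rfl fun ι _ => h1 ι, sum_const, card_univ, nsmul_eq_mul]
    _ = _ := by
        rw [sum_comm, sum_congr rfl fun g _ => h2 g, sum_const, card_univ, nsmul_eq_mul]

theorem normChar_eq_embChar {k : ℕ} (μ : YoungDiagram) (π : Perm (Fin k)) :
    normChar μ π = embChar (rowOf μ) (colOf μ) π := by
  unfold normChar
  split_ifs with h
  · obtain ⟨κ, hκ⟩ := exists_mul_irrChar μ
    have h1 := hκ 1
    simp only [mul_one, inv_mul_cancel, youngCoeff_one (isShape_rowOf_colOf μ), sum_const,
      card_univ, nsmul_eq_mul] at h1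
    have hn : (Fintype.card (Perm (Fin μ.card)) : ℚ) ≠ 0 := by
      exact_mod_cast Fintype.card_ne_zero
    have hκ0 : κ ≠ 0 := by rintro rfl; rw [zero_mul] at h1; exact hn h1.symm
    have hi0 : irrChar μ 1 ≠ 0 := by intro h0; rw [h0, mul_zero] at h1; exact hn h1.symm
    have h2 := sum_embedding_trans
      (fun ι => youngCoeff (rowOf μ) (colOf μ) (π.viaEmbedding ι)) (Fin.castLEEmb h)
    rw [Fintype.card_embedding_eq, Fintype.card_fin, Fintype.card_fin] at h2
    have h3 : ∑ g : Perm (Fin μ.card), youngCoeff (rowOf μ) (colOf μ)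
          (π.viaEmbedding ((Fin.castLEEmb h).trans g.toEmbedding)) =
        κ * irrChar μ (π.viaEmbedding (Fin.castLEEmb h)) := by
      rw [hκ]
      refine Fintype.sum_equiv (Equiv.inv _) _ _ fun g => ?_
      rw [viaEmbedding_trans_equiv]
      congr 1
    rw [h3, ← h1] at h2
    rw [div_eq_iff hi0]
    apply mul_left_cancel₀ hκ0
    unfold embChar
    linear_combination h2
  · have : IsEmpty (Fin k ↪ Fin μ.card) :=
      ⟨fun ι => h (by simpa using Fintype.card_le_of_embedding ι)⟩
    simp [embChar]

theorem youngCoeff_permCongr [Fintype β] [DecidableEq β] (r c : β → ℕ) (e : α ≃ β) (g : Perm α) :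
    youngCoeff r c (e.permCongr g) = youngCoeff (r ∘ e) (c ∘ e) g := by
  unfold youngCoeff
  refine (Fintype.sum_equiv e.permCongr _ _ fun q => Fintype.sum_equiv e.permCongr _ _ fun p =>
    ?_).symm
  have h1 : ∀ (f : β → ℕ) (q : Perm α), (∀ x, f (e.permCongr q x) = f x) ↔
      ∀ x, (f ∘ e) (q x) = (f ∘ e) x := by
    intro f q
    rw [← e.forall_congr_right]
    simp [Equiv.permCongr_apply]
  have h2 : e.permCongr q * e.permCongr p = e.permCongr g ↔ q * p = g := by
    rw [← Equiv.permCongr_mul, e.permCongr.injective.eq_iff]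
  simp only [h1, h2, Perm.sign_permCongr]

theorem embChar_comp_equiv [Fintype β] [DecidableEq β] (r c : β → ℕ) (e : α ≃ β) (π : Perm A) :
    embChar (r ∘ e) (c ∘ e) π = embChar r c π := by
  unfold embChar
  refine Fintype.sum_equiv (Equiv.embeddingCongr (Equiv.refl A) e) _ _ fun ι => ?_
  rw [← youngCoeff_permCongr, ← viaEmbedding_trans_equiv]
  rfl

theorem embChar_permCongr [Fintype B] [DecidableEq B] (r c : α → ℕ) (e : A ≃ B) (π : Perm A) :
    embChar r c (e.permCongr π) = embChar r c π := by
  unfold embChar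
  refine (Fintype.sum_equiv (Equiv.embeddingCongr e (Equiv.refl α)) _ _ fun ι => ?_).symm
  congr 1
  ext x
  by_cases hx : x ∈ Set.range ι
  · obtain ⟨a, rfl⟩ := hx
    have hι : ∀ b, Equiv.embeddingCongr e (Equiv.refl α) ι (e b) = ι b := by simp
    have := Perm.viaEmbedding_apply (e.permCongr π) (Equiv.embeddingCongr e (Equiv.refl α) ι) (e a)
    rw [Equiv.permCongr_apply, symm_apply_apply, hι, hι] at this
    rw [Perm.viaEmbedding_apply, this]
  · rw [Perm.viaEmbedding_apply_of_notMem π ι _ hx, Perm.viaEmbedding_apply_of_notMem]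
    rintro ⟨a, ha⟩
    exact hx ⟨e.symm a, by simpa using ha⟩

end Ch

section NFormula
variable {A α : Type*} [Fintype A] [DecidableEq A] [Fintype α] [DecidableEq α]

theorem youngCoeff_eq_sum (r c : α → ℕ) (g : Perm α) :
    youngCoeff r c g = ∑ q : Perm α,
      if (∀ x, c (q x) = c x) ∧ ∀ x, r ((q⁻¹ * g) x) = r x then ((Perm.sign q : ℤ) : ℚ) else 0 := by
  unfold youngCoeff
  refine sum_congr rfl fun q _ => ?_
  rw [sum_eq_single (q⁻¹ * g)]
  · simp only [mul_inv_cancel_left, and_true]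
  · intro p _ hp
    rw [if_neg]
    rintro ⟨-, -, h⟩
    exact hp (by rw [← h]; group)
  · simp

theorem exists_viaEmbedding_eq (ι : A ↪ α) (q : Perm α) (hq : ∀ x, x ∉ Set.range ι → q x = x) :
    ∃ q₀ : Perm A, q₀.viaEmbedding ι = q := by
  have hmem : ∀ x, q x ∈ Set.range ι ↔ x ∈ Set.range ι := by
    intro x
    by_cases hx : x ∈ Set.range ι
    · simp only [hx, iff_true]
      by_contra hqx
      have := q.injective (hq _ hqx)
      rw [this] at hqx
      exact hqx hx
    · rw [hq x hx]
  choose f hf using fun a => (hmem (ι a)).2 ⟨a, rfl⟩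
  have hinj : Function.Injective f := fun a b hab => by
    have := congrArg ι hab
    rw [hf, hf] at this
    exact ι.injective (q.injective this)
  refine ⟨Equiv.ofBijective f (Finite.injective_iff_bijective.1 hinj), ?_⟩
  ext x
  by_cases hx : x ∈ Set.range ι
  · obtain ⟨a, rfl⟩ := hx
    rw [Perm.viaEmbedding_apply]
    exact hf a
  · rw [Perm.viaEmbedding_apply_of_notMem _ _ _ hx, hq x hx]

theorem sign_viaEmbedding (π : Perm A) (ι : A ↪ α) :
    Perm.sign (π.viaEmbedding ι) = Perm.sign π := by
  classical
  unfold Perm.viaEmbedding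
  convert Perm.sign_extendDomain π (ofInjective ι.1 ι.2)

theorem viaEmbedding_comp_iff {γ : Type*} (f : α → γ) (π : Perm A) (ι : A ↪ α) :
    (∀ x, f (π.viaEmbedding ι x) = f x) ↔ ∀ a, f (ι (π a)) = f (ι a) := by
  refine ⟨fun h a => by rw [← Perm.viaEmbedding_apply, h], fun h x => ?_⟩
  by_cases hx : x ∈ Set.range ι
  · obtain ⟨a, rfl⟩ := hx
    rw [Perm.viaEmbedding_apply, h]
  · rw [Perm.viaEmbedding_apply_of_notMem _ _ _ hx]

theorem IsShape.youngCoeff_viaEmbedding {r c : α → ℕ} (h : IsShape r c) (π : Perm A) (ι : A ↪ α) :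
    youngCoeff r c (π.viaEmbedding ι) = youngCoeff (r ∘ ι) (c ∘ ι) π := by
  rw [youngCoeff_eq_sum, youngCoeff_eq_sum]
  symm
  refine Fintype.sum_of_injective (Perm.viaEmbeddingHom ι) (Perm.viaEmbeddingHom_injective ι) _ _
    (fun q hq => if_neg ?_) fun q => ?_
  · rintro ⟨h1, h2⟩
    apply hq
    refine exists_viaEmbedding_eq ι q fun x hx => ?_
    have h3 := h2 x
    rw [Perm.mul_apply, Perm.viaEmbedding_apply_of_notMem _ _ _ hx] at h3
    have h4 := (perm_comp_iff_inv c q).2 h1 x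
    have h5 := h.inj _ _ h3 h4
    rw [Perm.inv_eq_iff_eq] at h5
    exact h5.symm
  · rw [← Perm.viaEmbeddingHom_apply π, ← map_inv, ← map_mul]
    simp only [Perm.viaEmbeddingHom_apply, viaEmbedding_comp_iff, sign_viaEmbedding,
      Function.comp_apply]

theorem youngCoeff_eq_zero_of_eq {r c : α → ℕ} {x y : α} (hxy : x ≠ y) (hr : r x = r y)
    (hc : c x = c y) (g : Perm α) : youngCoeff r c g = 0 := by
  have key : youngCoeff r c g = - youngCoeff r c g := by
    conv_lhs => rw [youngCoeff_eq_sum]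
    rw [youngCoeff_eq_sum, ← sum_neg_distrib]
    refine Fintype.sum_equiv (Equiv.mulRight (swap x y)) _ _ fun q => ?_
    have h1 : (∀ z, c ((q * swap x y) z) = c z) ↔ ∀ z, c (q z) = c z := by
      rw [← (swap x y).forall_congr_right]
      simp [comp_swap_eq hc]
    have h2 : ∀ z, r (((q * swap x y)⁻¹ * g) z) = r ((q⁻¹ * g) z) := by
      intro z
      rw [mul_inv_rev, swap_inv, mul_assoc, Perm.mul_apply, comp_swap_eq hr]
    simp only [Equiv.coe_mulRight, h1, h2, Perm.sign_mul, Perm.sign_swap hxy]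
    split_ifs <;> simp
  linarith

theorem IsShape.embChar_eq_sum {r c : α → ℕ} (h : IsShape r c) (π : Perm A) :
    embChar r c π = ∑ f : A → α, youngCoeff (r ∘ f) (c ∘ f) π := by
  refine Fintype.sum_of_injective (fun ι : A ↪ α => (ι : A → α)) DFunLike.coe_injective _ _
    (fun f hf => ?_) fun ι => h.youngCoeff_viaEmbedding π ι
  have hf' : ¬ Function.Injective f := fun hi => hf ⟨⟨f, hi⟩, rfl⟩
  simp only [Function.Injective, not_forall] at hf'
  obtain ⟨a, b, hab, hne⟩ := hf'
  exact youngCoeff_eq_zero_of_eq hne (congrArg r hab) (congrArg c hab) π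

theorem IsShape.embChar_eq_sum_card {r c : α → ℕ} (h : IsShape r c) (π : Perm A) :
    embChar r c π = ∑ q : Perm A, ((Perm.sign q : ℤ) : ℚ) *
      (#{f : A → α | (∀ a, c (f (q a)) = c (f a)) ∧ ∀ a, r (f ((q⁻¹ * π) a)) = r (f a)} : ℚ) := by
  rw [h.embChar_eq_sum, sum_congr rfl fun f _ => youngCoeff_eq_sum _ _ _, sum_comm]
  refine sum_congr rfl fun q _ => ?_
  rw [← sum_filter, sum_const, nsmul_eq_mul, mul_comm]
  rfl

end NFormula

section Colorings
variable {E V W : Type*} [Fintype E] [DecidableEq E] [Fintype V] [DecidableEq V] [Fintype W]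
  [DecidableEq W]

/-- The number of colorings, by row and column numbers, of the vertices of the bipartite graph with
edge set `E` and endpoint maps `u`, `w` that are compatible with `μ`. -/
noncomputable def colorings (μ : YoungDiagram) (u : E → V) (w : E → W) : ℕ :=
  Nat.card {z : Σ _ : V → ℕ, W → ℕ // ∀ e, (z.1 (u e), z.2 (w e)) ∈ μ}

/-- The largest level among the neighbours of `b`. -/
def levelMax (u : E → V) (w : E → W) (h : V → ℕ) (b : W) : ℕ :=
  ({e | w e = b} : Finset E).sup fun e => h (u e)

/-- The number of colorings compatible with a diagram made of `L` blocks of rows, of heights `p i`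
and widths `q i`. -/
def blockSum {R : Type*} [CommSemiring R] (u : E → V) (w : E → W) (L : ℕ) (p q : ℕ → R) : R :=
  ∑ h ∈ Fintype.piFinset fun _ : V => range L, (∏ v, p (h v)) * ∏ b, q (levelMax u w h b)

theorem blockSum_smul {R : Type*} [CommSemiring R] (u : E → V) (w : E → W) (L : ℕ) (p q : ℕ → R)
    (s : R) : blockSum u w L (fun i => s * p i) (fun i => s * q i) =
      s ^ (Fintype.card V + Fintype.card W) * blockSum u w L p q := by
  unfold blockSum
  rw [mul_sum]
  refine sum_congr rfl fun h _ => ?_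
  rw [prod_mul_distrib, prod_mul_distrib, prod_const, prod_const, card_univ, card_univ, pow_add]
  ring

theorem map_blockSum {R S : Type*} [CommSemiring R] [CommSemiring S] (φ : R →+* S) (u : E → V)
    (w : E → W) (L : ℕ) (p q : ℕ → R) :
    φ (blockSum u w L p q) = blockSum u w L (φ ∘ p) (φ ∘ q) := by
  simp [blockSum]

/-- The Young diagram whose rows are grouped in `L` blocks, the `i`-th of which has `p i` rows of
length `q i` (when `q` is antitone). -/
def blockDiagram (p q : ℕ → ℕ) (L : ℕ) : YoungDiagram where
  cells := (range L).biUnion fun i => range (∑ j ∈ range (i + 1), p j) ×ˢ range (q i)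
  isLowerSet := by
    intro a b hba h
    simp only [coe_biUnion, Set.mem_iUnion, coe_product, Set.mem_prod, mem_coe, mem_range] at h ⊢
    obtain ⟨i, hi, h1, h2⟩ := h
    exact ⟨i, hi, hba.1.trans_lt h1, hba.2.trans_lt h2⟩

theorem mem_blockDiagram {p q : ℕ → ℕ} {L r c : ℕ} :
    (r, c) ∈ blockDiagram p q L ↔ ∃ i < L, r < ∑ j ∈ range (i + 1), p j ∧ c < q i := by
  rw [← YoungDiagram.mem_cells]
  simp [blockDiagram]

theorem exists_block (p : ℕ → ℕ) (L : ℕ) : ∃ b : ℕ → ℕ, ∀ r < ∑ j ∈ range L, p j,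
    b r < L ∧ ∀ i, r < ∑ j ∈ range (i + 1), p j ↔ b r ≤ i := by
  classical
  have key : ∀ r, ∃ b, r < ∑ j ∈ range L, p j →
      b < L ∧ ∀ i, r < ∑ j ∈ range (i + 1), p j ↔ b ≤ i := by
    intro r
    by_cases hr : r < ∑ j ∈ range L, p j
    · obtain ⟨l, rfl⟩ : ∃ l, L = l + 1 := by
        cases L with
        | zero => simp at hr
        | succ l => exact ⟨l, rfl⟩
      have hex : ∃ i, r < ∑ j ∈ range (i + 1), p j := ⟨l, hr⟩
      refine ⟨Nat.find hex, fun _ => ⟨Nat.lt_succ_of_le (Nat.find_min' hex hr), fun i =>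
        ⟨fun h => Nat.find_min' hex h, fun h => (Nat.find_spec hex).trans_le ?_⟩⟩⟩
      exact sum_le_sum_of_subset (range_subset_range.2 (by omega))
    · exact ⟨0, fun h => absurd h hr⟩
  exact ⟨fun r => (key r).choose, fun r => (key r).choose_spec⟩

theorem levelMax_le_iff (u : E → V) (w : E → W) (h : V → ℕ) (b : W) (i : ℕ) :
    levelMax u w h b ≤ i ↔ ∀ e, w e = b → h (u e) ≤ i := by
  simp [levelMax, Finset.sup_le_iff]

theorem exists_levelMax_eq (u : E → V) {w : E → W} (hw : Function.Surjective w) (h : V → ℕ)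
    (b : W) : ∃ e, w e = b ∧ levelMax u w h b = h (u e) := by
  obtain ⟨e₀, he₀⟩ := hw b
  obtain ⟨e, he, h'⟩ := exists_mem_eq_sup ({e | w e = b} : Finset E) ⟨e₀, by simpa⟩
    fun e => h (u e)
  exact ⟨e, by simpa using he, h'⟩

theorem colorings_blockDiagram {u : E → V} {w : E → W} (hu : Function.Surjective u)
    (hw : Function.Surjective w) (p q : ℕ → ℕ) (L : ℕ)
    (hq : ∀ i j, i ≤ j → j < L → q j ≤ q i) :
    colorings (blockDiagram p q L) u w = blockSum u w L p q := by
  obtain ⟨blk, hblk⟩ := exists_block p L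
  set P := ∑ j ∈ range L, p j with hP
  have hmem : ∀ r c, (r, c) ∈ blockDiagram p q L ↔ r < P ∧ c < q (blk r) := by
    intro r c
    rw [mem_blockDiagram]
    constructor
    · rintro ⟨i, hi, h1, h2⟩
      have hr : r < P := h1.trans_le (sum_le_sum_of_subset (range_subset_range.2 hi))
      exact ⟨hr, h2.trans_le (hq _ _ (((hblk r hr).2 i).1 h1) hi)⟩
    · rintro ⟨hr, hc⟩
      exact ⟨blk r, (hblk r hr).1, ((hblk r hr).2 _).2 le_rfl, hc⟩
  have hlev : ∀ x : V → ℕ, (∀ v, x v < P) → ∀ (b : W) (c : ℕ),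
      c < q (levelMax u w (blk ∘ x) b) ↔ ∀ e, w e = b → c < q (blk (x (u e))) := by
    intro x hx b c
    obtain ⟨e, he, hmax⟩ := exists_levelMax_eq u hw (blk ∘ x) b
    refine ⟨fun h e' he' => h.trans_le (hq _ _ ?_ ?_), fun h => ?_⟩
    · exact (levelMax_le_iff u w (blk ∘ x) b _).1 le_rfl e' he'
    · rw [hmax]; exact (hblk _ (hx _)).1
    · rw [hmax]; exact h e he
  have h1 : colorings (blockDiagram p q L) u w =
      #((Fintype.piFinset fun _ : V => range P).sigma fun x =>
        Fintype.piFinset fun b : W => range (q (levelMax u w (blk ∘ x) b))) := by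
    unfold colorings
    refine Nat.subtype_card _ fun z => ?_
    simp only [mem_sigma, Fintype.mem_piFinset, mem_range, hmem]
    constructor
    · rintro ⟨hx, hy⟩ e
      exact ⟨hx _, (hlev _ hx _ _).1 (hy (w e)) e rfl⟩
    · intro h
      have hx : ∀ v, z.1 v < P := fun v => by obtain ⟨e, rfl⟩ := hu v; exact (h e).1
      exact ⟨hx, fun b => (hlev _ hx _ _).2 fun e he => by rw [← he]; exact (h e).2⟩
  rw [h1, card_sigma]
  simp only [Fintype.card_piFinset, card_range]
  unfold blockSum
  rw [← sum_fiberwise_of_maps_to (g := fun x => blk ∘ x)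
    (t := Fintype.piFinset fun _ : V => range L)]
  · refine sum_congr rfl fun h hh => ?_
    rw [sum_congr rfl fun x hx => by rw [(mem_filter.1 hx).2], sum_const, smul_eq_mul]
    congr 1
    have hfib : ({x ∈ Fintype.piFinset fun _ : V => range P | blk ∘ x = h}) =
        Fintype.piFinset fun v : V => Ico (∑ j ∈ range (h v), p j) (∑ j ∈ range (h v + 1), p j) := by
      ext x
      simp only [mem_filter, Fintype.mem_piFinset, mem_range, mem_Ico] at hh ⊢
      rw [funext_iff, ← forall_and]
      refine forall_congr' fun v => ?_
      have hle : ∑ j ∈ range (h v + 1), p j ≤ P :=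
        sum_le_sum_of_subset (range_subset_range.2 (hh v))
      constructor
      · rintro ⟨hx, hv⟩
        rw [← hv]
        refine ⟨?_, ((hblk _ hx).2 _).2 le_rfl⟩
        by_contra! hlt
        simp only [Function.comp_apply] at hlt
        cases hb : blk (x v) with
        | zero => simp [hb] at hlt
        | succ i =>
          rw [hb, (hblk _ hx).2] at hlt
          omega
      · rintro ⟨h2, h3⟩
        have hx := h3.trans_le hle
        refine ⟨hx, le_antisymm (((hblk _ hx).2 _).1 h3) ?_⟩
        by_contra! hlt
        simp only [Function.comp_apply] at hlt
        cases hb : h v with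
        | zero => omega
        | succ i =>
          rw [hb] at h2 hlt
          have := ((hblk _ hx).2 i).2 (by omega)
          omega
    rw [hfib, Fintype.card_piFinset]
    refine prod_congr rfl fun v _ => ?_
    rw [Nat.card_Ico, sum_range_succ]
    omega
  · intro x hx
    simp only [Fintype.mem_piFinset, mem_range] at hx ⊢
    exact fun v => (hblk _ (hx v)).1

theorem eq_blockDiagram (μ : YoungDiagram) : μ = blockDiagram (fun _ => 1) μ.rowLen (μ.colLen 0) := by
  ext ⟨r, c⟩
  rw [YoungDiagram.mem_cells, YoungDiagram.mem_cells, mem_blockDiagram]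
  simp only [sum_const, card_range, smul_eq_mul, mul_one]
  constructor
  · intro h
    exact ⟨r, YoungDiagram.mem_iff_lt_colLen.1 (μ.up_left_mem le_rfl (Nat.zero_le _) h), by omega,
      YoungDiagram.mem_iff_lt_rowLen.1 h⟩
  · rintro ⟨i, hi, h1, h2⟩
    exact μ.up_left_mem (by omega) le_rfl (YoungDiagram.mem_iff_lt_rowLen.2 h2)

theorem mem_dilate {μ : YoungDiagram} {s : ℕ} (hs : 0 < s) {r c : ℕ} :
    (r, c) ∈ dilate μ s ↔ (r / s, c / s) ∈ μ := by
  rw [← YoungDiagram.mem_cells]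
  simp only [dilate, mem_filter, mem_product, mem_range, YoungDiagram.mem_cells, and_iff_right_iff_imp]
  intro h
  have h1 := YoungDiagram.mem_iff_lt_colLen.1 (μ.up_left_mem le_rfl (Nat.zero_le _) h)
  have h2 := YoungDiagram.mem_iff_lt_rowLen.1 (μ.up_left_mem (Nat.zero_le _) le_rfl h)
  rw [Nat.div_lt_iff_lt_mul hs] at h1 h2
  constructor <;> nlinarith

theorem dilate_eq_blockDiagram (μ : YoungDiagram) {s : ℕ} (hs : 0 < s) :
    dilate μ s = blockDiagram (fun _ => s * 1) (fun i => s * μ.rowLen i) (μ.colLen 0) := by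
  ext ⟨r, c⟩
  rw [YoungDiagram.mem_cells, YoungDiagram.mem_cells, mem_blockDiagram, mem_dilate hs]
  conv_lhs => rw [eq_blockDiagram μ]
  rw [mem_blockDiagram]
  simp only [sum_const, card_range, smul_eq_mul, mul_one, Nat.div_lt_iff_lt_mul hs, mul_comm s,
    one_mul]

theorem colorings_dilate {u : E → V} {w : E → W} (hu : Function.Surjective u)
    (hw : Function.Surjective w) (μ : YoungDiagram) {s : ℕ} (hs : 0 < s) :
    colorings (dilate μ s) u w =
      s ^ (Fintype.card V + Fintype.card W) * colorings μ u w := by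
  rw [dilate_eq_blockDiagram μ hs, colorings_blockDiagram hu hw, blockSum_smul,
    ← colorings_blockDiagram hu hw, ← eq_blockDiagram]
  · exact fun i j h _ => μ.rowLen_anti i j h
  · exact fun i j h _ => Nat.mul_le_mul_left s (μ.rowLen_anti i j h)

end Colorings

section Cycles
variable {A : Type*} [Fintype A] [DecidableEq A]

/-- The set of cycles of a permutation, fixed points included. -/
abbrev Cyc {A : Type*} (σ : Perm A) : Type _ := Quotient (Perm.SameCycle.setoid σ)

noncomputable instance (σ : Perm A) : Fintype (Cyc σ) := Fintype.ofFinite _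

noncomputable instance (σ : Perm A) : DecidableEq (Cyc σ) := Classical.decEq _

/-- The cycle through a point. -/
def cyc (σ : Perm A) (a : A) : Cyc σ := Quotient.mk (Perm.SameCycle.setoid σ) a

theorem cyc_surjective (σ : Perm A) : Function.Surjective (cyc σ) := Quotient.mk_surjective

theorem cyc_eq_iff {σ : Perm A} {a b : A} : cyc σ a = cyc σ b ↔ σ.SameCycle a b :=
  Quotient.eq (r := Perm.SameCycle.setoid σ)

theorem cyc_apply (σ : Perm A) (a : A) : cyc σ (σ a) = cyc σ a :=
  cyc_eq_iff.2 (Perm.sameCycle_apply_left.2 (Perm.SameCycle.refl _ _))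

theorem apply_eq_of_sameCycle {β : Type*} {σ : Perm A} {f : A → β} (h : ∀ a, f (σ a) = f a)
    {a b : A} (hab : σ.SameCycle a b) : f a = f b := by
  obtain ⟨n, rfl⟩ := hab.exists_nat_pow_eq
  induction n with
  | zero => rfl
  | succ n ih => rw [pow_succ', Perm.mul_apply, h]; exact ih ⟨n, by simp⟩

/-- The map induced on cycles by a function constant on cycles. -/
def cycLift {β : Type*} (σ : Perm A) (f : A → β) (h : ∀ a, f (σ a) = f a) : Cyc σ → β :=
  Quotient.lift (s := Perm.SameCycle.setoid σ) f fun _ _ hab => apply_eq_of_sameCycle h hab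

/-- The normalized character of `μ` at `π`, for permutations of an arbitrary finite set. -/
noncomputable def diagChar (μ : YoungDiagram) (π : Perm A) : ℚ :=
  embChar (fun x : {c // c ∈ μ.cells} => x.1.1) (fun x => x.1.2) π

theorem isShape_cells (μ : YoungDiagram) :
    IsShape (fun x : {c // c ∈ μ.cells} => x.1.1) (fun x => x.1.2) where
  inj _ _ hr hc := Subtype.ext (Prod.ext hr hc)
  lower x i j hi hj := ⟨⟨(i, j), μ.isLowerSet (Prod.mk_le_mk.2 ⟨hi, hj⟩ : (i, j) ≤ x.1) x.2⟩,
    rfl, rfl⟩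

theorem normChar_eq_diagChar {k : ℕ} (μ : YoungDiagram) (π : Perm (Fin k)) :
    normChar μ π = diagChar μ π := by
  rw [normChar_eq_embChar, diagChar, ← embChar_comp_equiv _ _ (fill μ)]
  rfl

theorem card_eq_colorings (μ : YoungDiagram) (q ρ : Perm A) :
    #{f : A → {c // c ∈ μ.cells} | (∀ a, (f (q a)).1.2 = (f a).1.2) ∧
      ∀ a, (f (ρ a)).1.1 = (f a).1.1} = colorings μ (cyc ρ) (cyc q) := by
  unfold colorings
  rw [← Fintype.card_subtype, ← Nat.card_eq_fintype_card]
  refine Nat.card_congr ⟨fun f => ⟨⟨cycLift ρ (fun a => (f.1 a).1.1) f.2.2,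
      cycLift q (fun a => (f.1 a).1.2) f.2.1⟩, fun a => (f.1 a).2⟩,
    fun z => ⟨fun a => ⟨(z.1.1 (cyc ρ a), z.1.2 (cyc q a)), z.2 a⟩,
      fun a => by simp only [cyc_apply], fun a => by simp only [cyc_apply]⟩,
    fun f => rfl, fun z => ?_⟩
  apply Subtype.ext
  obtain ⟨⟨x, y⟩, hz⟩ := z
  refine Sigma.ext ?_ (heq_of_eq ?_)
  · funext v
    obtain ⟨a, rfl⟩ := cyc_surjective ρ v
    rfl
  · funext v
    obtain ⟨a, rfl⟩ := cyc_surjective q v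
    rfl

theorem diagChar_eq_sum_colorings (μ : YoungDiagram) (π : Perm A) :
    diagChar μ π = ∑ q : Perm A,
      ((Perm.sign q : ℤ) : ℚ) * (colorings μ (cyc (q⁻¹ * π)) (cyc q) : ℚ) := by
  rw [diagChar, (isShape_cells μ).embChar_eq_sum_card]
  simp only [card_eq_colorings]

theorem diagChar_dilate (μ : YoungDiagram) (π : Perm A) {s : ℕ} (hs : 0 < s) :
    diagChar (dilate μ s) π = ∑ q : Perm A, ((Perm.sign q : ℤ) : ℚ) *
      ((s : ℚ) ^ (Fintype.card (Cyc (q⁻¹ * π)) + Fintype.card (Cyc q)) *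
        (colorings μ (cyc (q⁻¹ * π)) (cyc q) : ℚ)) := by
  rw [diagChar_eq_sum_colorings]
  refine sum_congr rfl fun q _ => ?_
  rw [colorings_dilate (cyc_surjective _) (cyc_surjective _) μ hs]
  push_cast
  rfl

theorem freeCumulant_eq_coeff (μ : YoungDiagram) (k : ℕ) (p : Polynomial ℚ)
    (hp : ∀ s : ℕ, 0 < s → SigmaCycle (dilate μ s) (k - 1) = p.eval (s : ℚ)) :
    freeCumulant μ k = p.coeff k := by
  have hex : ∃ p : Polynomial ℚ, ∀ s : ℕ, 0 < s →
      SigmaCycle (dilate μ s) (k - 1) = p.eval (s : ℚ) := ⟨p, hp⟩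
  unfold freeCumulant
  rw [dif_pos hex]
  congr 1
  refine Polynomial.eq_of_infinite_eval_eq _ _ ?_
  refine Set.Infinite.mono (s := (fun n : ℕ => (n : ℚ)) '' Set.Ioi 0) ?_
    ((Set.Ioi_infinite 0).image Nat.cast_injective.injOn)
  rintro _ ⟨s, hs, rfl⟩
  exact (hex.choose_spec s hs).symm.trans (hp s hs)

theorem freeCumulant_eq_sum_colorings (μ : YoungDiagram) (k : ℕ) :
    freeCumulant μ (k + 1) = ∑ q : Perm (Fin k),
      if Fintype.card (Cyc (q⁻¹ * finRotate k)) + Fintype.card (Cyc q) = k + 1 then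
        ((Perm.sign q : ℤ) : ℚ) * (colorings μ (cyc (q⁻¹ * finRotate k)) (cyc q) : ℚ) else 0 := by
  rw [freeCumulant_eq_coeff μ (k + 1) (∑ q : Perm (Fin k),
    Polynomial.monomial (Fintype.card (Cyc (q⁻¹ * finRotate k)) + Fintype.card (Cyc q))
      (((Perm.sign q : ℤ) : ℚ) * (colorings μ (cyc (q⁻¹ * finRotate k)) (cyc q) : ℚ)))]
  · simp [Polynomial.finsetSum_coeff, Polynomial.coeff_monomial]
  · intro s hs
    rw [Nat.add_sub_cancel, SigmaCycle, normChar_eq_diagChar, diagChar_dilate _ _ hs,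
      Polynomial.eval_finsetSum]
    refine sum_congr rfl fun q _ => ?_
    rw [Polynomial.eval_monomial]
    ring

end Cycles

section SetoidSum
variable {A B C α : Type*} [Fintype A] [DecidableEq A] [Fintype α] [DecidableEq α]

noncomputable instance (s : Setoid A) : Fintype (Quotient s) := Fintype.ofFinite _

noncomputable instance (s : Setoid A) : DecidableEq (Quotient s) := Classical.decEq _

noncomputable instance : Fintype (Setoid A) :=
  Fintype.ofInjective (fun s : Setoid A => s.r) fun s t h => Setoid.ext fun a b => by
    exact iff_of_eq (congrFun (congrFun h a) b)

/-- Sorting functions by their kernels. -/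
theorem sum_eq_sum_setoid {M : Type*} [AddCommMonoid M] (F : (A → α) → M) :
    ∑ f, F f = ∑ s : Setoid A, ∑ ι : Quotient s ↪ α, F (fun a => ι (Quotient.mk s a)) := by
  classical
  rw [← sum_fiberwise_of_maps_to (s := univ) (t := univ) (g := fun f : A → α => Setoid.ker f)
    (fun _ _ => mem_univ _)]
  refine sum_congr rfl fun s _ => ?_
  symm
  refine sum_bij (fun ι _ a => ι (Quotient.mk s a)) (fun ι _ => ?_) (fun ι₁ _ ι₂ _ h => ?_)
    (fun f hf => ?_) fun _ _ => rfl
  · simp only [mem_filter, mem_univ, true_and]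
    ext a b
    rw [Setoid.ker_def, ι.injective.eq_iff]
    exact Quotient.eq
  · ext x
    obtain ⟨a, rfl⟩ := Quotient.exists_rep x
    exact congrFun h a
  · simp only [mem_filter, mem_univ, true_and] at hf
    subst hf
    exact ⟨⟨Setoid.kerLift f, Setoid.kerLift_injective f⟩, mem_univ _, rfl⟩

theorem card_quotient_lt {s : Setoid A} (hs : s ≠ ⊥) :
    Fintype.card (Quotient s) < Fintype.card A := by
  refine lt_of_le_of_ne (Fintype.card_le_of_surjective _ Quotient.mk_surjective) fun h => hs ?_
  have hb := (Fintype.bijective_iff_surjective_and_card (Quotient.mk s)).2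
    ⟨Quotient.mk_surjective, h.symm⟩
  ext a b
  exact ⟨fun hab => hb.1 (Quotient.sound hab), fun hab => by
    have : a = b := hab
    rw [this]⟩

/-- The quotient by the trivial relation. -/
noncomputable def quotientBotEquiv (A : Type*) : A ≃ Quotient (⊥ : Setoid A) :=
  Equiv.ofBijective (Quotient.mk ⊥) ⟨fun _ _ h => Quotient.exact h, Quotient.mk_surjective⟩

theorem viaEmbedding_trans (π : Perm A) (κ : A ↪ B) (ι : B ↪ α) :
    π.viaEmbedding (κ.trans ι) = (π.viaEmbedding κ).viaEmbedding ι := by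
  ext x
  by_cases hx : x ∈ Set.range ι
  · obtain ⟨b, rfl⟩ := hx
    rw [Perm.viaEmbedding_apply]
    by_cases hb : b ∈ Set.range κ
    · obtain ⟨a, rfl⟩ := hb
      rw [Perm.viaEmbedding_apply]
      exact Perm.viaEmbedding_apply π (κ.trans ι) a
    · rw [Perm.viaEmbedding_apply_of_notMem _ _ _ hb, Perm.viaEmbedding_apply_of_notMem]
      rintro ⟨a, ha⟩
      exact hb ⟨a, ι.injective ha⟩
  · rw [Perm.viaEmbedding_apply_of_notMem _ _ _ hx, Perm.viaEmbedding_apply_of_notMem]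
    rintro ⟨a, rfl⟩
    exact hx ⟨κ a, rfl⟩

theorem viaEmbedding_mul (π₁ π₂ : Perm A) (ι : A ↪ α) :
    (π₁ * π₂).viaEmbedding ι = π₁.viaEmbedding ι * π₂.viaEmbedding ι :=
  map_mul (Perm.viaEmbeddingHom ι) π₁ π₂

theorem viaEmbedding_equiv (π : Perm A) (e : A ≃ α) : π.viaEmbedding e.toEmbedding = e.permCongr π := by
  ext x
  obtain ⟨a, rfl⟩ := e.surjective x
  rw [Equiv.permCongr_apply, symm_apply_apply]
  exact Perm.viaEmbedding_apply π e.toEmbedding a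

theorem viaEmbedding_swap (a b : A) (ι : A ↪ α) :
    (swap a b).viaEmbedding ι = swap (ι a) (ι b) := by
  ext x
  by_cases hx : x ∈ Set.range ι
  · obtain ⟨y, rfl⟩ := hx
    rw [Perm.viaEmbedding_apply, ι.injective.swap_apply]
  · rw [Perm.viaEmbedding_apply_of_notMem _ _ _ hx, swap_apply_of_ne_of_ne]
    · rintro rfl; exact hx ⟨a, rfl⟩
    · rintro rfl; exact hx ⟨b, rfl⟩

end SetoidSum

section Functional
variable {α : Type*} [Fintype α] [DecidableEq α]

/-- The linear extension of `youngCoeff` to the group algebra. -/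
noncomputable def youngFunctional (r c : α → ℕ) : MonoidAlgebra ℚ (Perm α) →ₗ[ℚ] ℚ :=
  (MonoidAlgebra.basis (Perm α) ℚ).constr ℚ (youngCoeff r c)

theorem youngFunctional_single (r c : α → ℕ) (g : Perm α) :
    youngFunctional r c (MonoidAlgebra.single g 1) = youngCoeff r c g := by
  rw [← MonoidAlgebra.basis_apply]
  exact Module.Basis.constr_basis _ _ _ _

theorem monoidAlgebra_induction {G : Type*} [Group G] {P : MonoidAlgebra ℚ G → Prop}
    (x : MonoidAlgebra ℚ G) (h0 : P 0) (hadd : ∀ x y, P x → P y → P (x + y))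
    (hsmul : ∀ (a : ℚ) (g : G), P (a • MonoidAlgebra.single g (1 : ℚ))) : P x := by
  refine MonoidAlgebra.induction_linear x h0 hadd fun g a => ?_
  have := hsmul a g
  rwa [MonoidAlgebra.smul_single, smul_eq_mul, mul_one] at this

theorem youngFunctional_single_mul {r c : α → ℕ} (q : Perm α) (hq : ∀ x, c (q x) = c x)
    (x : MonoidAlgebra ℚ (Perm α)) : youngFunctional r c (MonoidAlgebra.single q 1 * x) =
      ((Perm.sign q : ℤ) : ℚ) * youngFunctional r c x := by
  induction x using monoidAlgebra_induction with
  | h0 => simp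
  | hadd x y hx hy => rw [mul_add, map_add, map_add, hx, hy, mul_add]
  | hsmul a g =>
    rw [mul_smul_comm, map_smul, map_smul, MonoidAlgebra.single_mul_single, one_mul,
      youngFunctional_single, youngFunctional_single, youngCoeff_mul_left _ _ hq, smul_eq_mul,
      smul_eq_mul]
    ring

theorem youngFunctional_mul_single {r c : α → ℕ} (p : Perm α) (hp : ∀ x, r (p x) = r x)
    (x : MonoidAlgebra ℚ (Perm α)) : youngFunctional r c (x * MonoidAlgebra.single p 1) =
      youngFunctional r c x := by
  induction x using monoidAlgebra_induction with
  | h0 => simp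
  | hadd x y hx hy => rw [add_mul, map_add, map_add, hx, hy]
  | hsmul a g =>
    rw [smul_mul_assoc, map_smul, map_smul, MonoidAlgebra.single_mul_single, one_mul,
      youngFunctional_single, youngFunctional_single, youngCoeff_mul_right _ _ hp]

/-- Central elements act by scalars. -/
theorem IsShape.youngFunctional_central_mul {r c : α → ℕ} (h : IsShape r c)
    {z : MonoidAlgebra ℚ (Perm α)} (hz : ∀ g : Perm α, MonoidAlgebra.single g 1 * z =
      z * MonoidAlgebra.single g 1) (x : MonoidAlgebra ℚ (Perm α)) :
    youngFunctional r c (z * x) = youngFunctional r c z * youngFunctional r c x := by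
  induction x using monoidAlgebra_induction with
  | h0 => simp
  | hadd x y hx hy => rw [mul_add, map_add, map_add, hx, hy, mul_add]
  | hsmul a g =>
    have key := h.eq_mul_youngCoeff (fun g => youngFunctional r c (z * MonoidAlgebra.single g 1))
      (fun q g hq => ?_) (fun p g hp => ?_) g
    · rw [mul_smul_comm, map_smul, map_smul, key, youngFunctional_single, smul_eq_mul, smul_eq_mul,
        show MonoidAlgebra.single (1 : Perm α) (1 : ℚ) = 1 from rfl, mul_one]
      ring
    · rw [← youngFunctional_single_mul q hq, ← mul_assoc, hz, mul_assoc,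
        MonoidAlgebra.single_mul_single, one_mul]
    · rw [← youngFunctional_mul_single p hp (z * MonoidAlgebra.single g 1), mul_assoc,
        MonoidAlgebra.single_mul_single, one_mul]

end Functional

section Product
variable {B C : Type*} [Fintype B] [DecidableEq B] [Fintype C] [DecidableEq C]
  {α : Type*} [Fintype α] [DecidableEq α]

/-- The embeddings of the two summands in a quotient of their sum that identifies no two points
of the same summand. -/
def inlEmb (s : Setoid (B ⊕ C)) (hs : Function.Injective fun b => Quotient.mk s (Sum.inl b)) :
    B ↪ Quotient s := ⟨_, hs⟩

/-- See `inlEmb`. -/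
def inrEmb (s : Setoid (B ⊕ C)) (hs : Function.Injective fun b => Quotient.mk s (Sum.inr b)) :
    C ↪ Quotient s := ⟨_, hs⟩

open scoped Classical in
/-- The product of two permutations of the summands, glued along a quotient. -/
noncomputable def gluedPerm (π₁ : Perm B) (π₂ : Perm C) (s : Setoid (B ⊕ C)) : Perm (Quotient s) :=
  if h : (Function.Injective fun b => Quotient.mk s (Sum.inl b)) ∧
      Function.Injective fun b => Quotient.mk s (Sum.inr b) then
    π₁.viaEmbedding (inlEmb s h.1) * π₂.viaEmbedding (inrEmb s h.2) else 1

open scoped Classical in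
theorem IsShape.embChar_mul_embChar {r c : α → ℕ} (h : IsShape r c) (π₁ : Perm B) (π₂ : Perm C) :
    embChar r c π₁ * embChar r c π₂ = ∑ s : Setoid (B ⊕ C),
      if (Function.Injective fun b => Quotient.mk s (Sum.inl b)) ∧
        (Function.Injective fun b => Quotient.mk s (Sum.inr b)) then
      embChar r c (gluedPerm π₁ π₂ s) else 0 := by
  set z : MonoidAlgebra ℚ (Perm α) :=
    ∑ ι : B ↪ α, MonoidAlgebra.single (π₁.viaEmbedding ι) 1 with hz
  have hzv : youngFunctional r c z = embChar r c π₁ := by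
    simp [hz, embChar, map_sum, youngFunctional_single]
  have hcent : ∀ g : Perm α, MonoidAlgebra.single g 1 * z = z * MonoidAlgebra.single g 1 := by
    intro g
    rw [hz, mul_sum, sum_mul]
    refine Fintype.sum_bijective (fun ι : B ↪ α => ι.trans g.toEmbedding)
      ⟨fun ι₁ ι₂ h => by ext a; exact g.injective (DFunLike.congr_fun h a),
       fun ι => ⟨ι.trans g.symm.toEmbedding, by ext a; simp⟩⟩ _ _ fun ι => ?_
    rw [viaEmbedding_trans_equiv, MonoidAlgebra.single_mul_single, MonoidAlgebra.single_mul_single]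
    congr 1
    ext x
    simp
  calc embChar r c π₁ * embChar r c π₂
      = ∑ ι₁ : B ↪ α, ∑ ι₂ : C ↪ α,
          youngCoeff r c (π₁.viaEmbedding ι₁ * π₂.viaEmbedding ι₂) := by
        rw [← hzv, sum_comm, embChar, mul_sum]
        refine sum_congr rfl fun ι₂ _ => ?_
        rw [← youngFunctional_single, ← h.youngFunctional_central_mul hcent, hz, sum_mul, map_sum]
        simp [MonoidAlgebra.single_mul_single, youngFunctional_single]
    _ = ∑ f : B ⊕ C → α, if hf : Function.Injective (fun b => f (Sum.inl b)) ∧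
          Function.Injective (fun b => f (Sum.inr b)) then
          youngCoeff r c (π₁.viaEmbedding ⟨_, hf.1⟩ * π₂.viaEmbedding ⟨_, hf.2⟩) else 0 := by
        rw [← Fintype.sum_prod_type']
        refine Fintype.sum_of_injective (fun ι : (B ↪ α) × (C ↪ α) => Sum.elim ι.1 ι.2)
          (fun ι₁ ι₂ h => ?_) _ _ (fun f hf => dif_neg fun hf' => hf ?_) fun ι => ?_
        · refine Prod.ext (DFunLike.ext _ _ fun b => congrFun h (Sum.inl b))
            (DFunLike.ext _ _ fun b => congrFun h (Sum.inr b))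
        · exact ⟨(⟨_, hf'.1⟩, ⟨_, hf'.2⟩), by ext (b | b) <;> rfl⟩
        · rw [dif_pos ⟨ι.1.injective, ι.2.injective⟩]
          rfl
    _ = _ := by
        rw [sum_eq_sum_setoid]
        refine sum_congr rfl fun s _ => ?_
        split_ifs with hs
        · rw [embChar]
          refine sum_congr rfl fun ι _ => ?_
          rw [dif_pos ⟨fun a b hab => hs.1 (ι.injective hab), fun a b hab => hs.2 (ι.injective hab)⟩,
            gluedPerm, dif_pos hs, viaEmbedding_mul, ← viaEmbedding_trans, ← viaEmbedding_trans]
          rfl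
        · refine sum_eq_zero fun ι _ => dif_neg fun hs' => hs ⟨fun a b hab => hs'.1 ?_,
            fun a b hab => hs'.2 ?_⟩
          · exact congrArg ι hab
          · exact congrArg ι hab

theorem gluedPerm_bot (π₁ : Perm B) (π₂ : Perm C) :
    gluedPerm π₁ π₂ ⊥ = (quotientBotEquiv (B ⊕ C)).permCongr (Equiv.sumCongr π₁ π₂) := by
  have h1 : Function.Injective fun b : B => Quotient.mk (⊥ : Setoid (B ⊕ C)) (Sum.inl b) :=
    (quotientBotEquiv _).injective.comp Sum.inl_injective
  have h2 : Function.Injective fun b : C => Quotient.mk (⊥ : Setoid (B ⊕ C)) (Sum.inr b) :=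
    (quotientBotEquiv _).injective.comp Sum.inr_injective
  rw [gluedPerm, dif_pos ⟨h1, h2⟩]
  ext x
  obtain ⟨a, rfl⟩ := (quotientBotEquiv _).surjective x
  rw [Equiv.permCongr_apply, symm_apply_apply, Perm.mul_apply]
  cases a with
  | inl b =>
    rw [Perm.viaEmbedding_apply_of_notMem π₂]
    · exact Perm.viaEmbedding_apply π₁ (inlEmb ⊥ h1) b
    · rintro ⟨a, ha⟩
      exact absurd ((quotientBotEquiv (B ⊕ C)).injective ha) (by simp)
  | inr b =>
    rw [show quotientBotEquiv (B ⊕ C) (Sum.inr b) = inrEmb ⊥ h2 b from rfl, Perm.viaEmbedding_apply,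
      Perm.viaEmbedding_apply_of_notMem π₁]
    · rfl
    · rintro ⟨a, ha⟩
      exact absurd ((quotientBotEquiv (B ⊕ C)).injective ha) (by simp)

end Product

section Star
variable {α : Type*} [Fintype α] [DecidableEq α]

/-- The sum of the transpositions exchanging `x` with the elements of `s`. -/
noncomputable def starSum (s : Finset α) (x : α) : MonoidAlgebra ℚ (Perm α) :=
  ∑ y ∈ s, MonoidAlgebra.single (swap y x) 1

/-- The product of the transpositions exchanging `x` with the `f i`. -/
def starProd {m : ℕ} (f : Fin m → α) (x : α) : Perm α :=
  (List.ofFn fun i => swap (f i) x).prod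

theorem starSum_pow (s : Finset α) (x : α) (m : ℕ) : starSum s x ^ m =
    ∑ f : Fin m → α, if ∀ i, f i ∈ s then MonoidAlgebra.single (starProd f x) (1 : ℚ) else 0 := by
  induction m with
  | zero =>
    rw [Fintype.sum_unique]
    simp [starProd, MonoidAlgebra.one_def]
  | succ m ih =>
    rw [pow_succ', ih, ← (Fin.consEquiv fun _ : Fin (m + 1) => α).sum_comp, Fintype.sum_prod_type,
      starSum, sum_mul, ← sum_filter_add_sum_filter_not univ (· ∈ s), add_comm]
    rw [sum_eq_zero (s := ({y | y ∉ s} : Finset α)), zero_add]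
    · refine sum_congr (by ext; simp) fun y hy => ?_
      rw [mul_sum]
      refine sum_congr rfl fun f _ => ?_
      have hy' : y ∈ s := by simpa using hy
      simp only [Fin.consEquiv_apply, Fin.forall_fin_succ, Fin.cons_zero, Fin.cons_succ, hy',
        true_and]
      split_ifs
      · rw [MonoidAlgebra.single_mul_single, one_mul]
        simp [starProd, List.ofFn_succ]
      · rw [mul_zero]
    · intro y hy
      have hy' : y ∉ s := by simpa using hy
      refine sum_eq_zero fun f _ => if_neg fun h => hy' ?_
      simpa using h 0

theorem viaEmbedding_starProd {A : Type*} [Fintype A] [DecidableEq A] {m : ℕ} (f : Fin m → A) (x : A)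
    (ι : A ↪ α) : (starProd f x).viaEmbedding ι = starProd (fun i => ι (f i)) (ι x) := by
  unfold starProd
  change Perm.viaEmbeddingHom ι _ = _
  rw [map_list_prod, List.map_ofFn]
  congr 2
  ext1 i
  exact viaEmbedding_swap _ _ ι

theorem conj_starProd {m : ℕ} (f : Fin m → α) (x : α) (g : Perm α) :
    g * starProd f x * g⁻¹ = starProd (fun i => g (f i)) (g x) := by
  have := viaEmbedding_starProd f x g.toEmbedding
  rw [viaEmbedding_equiv] at this
  rw [← Equiv.coe_toEmbedding, ← this]
  ext y
  simp

theorem single_mul_starSum (s : Finset α) {x : α} (g : Perm α) (hx : g x = x)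
    (hs : ∀ y, g y ∈ s ↔ y ∈ s) :
    MonoidAlgebra.single g 1 * starSum s x = starSum s x * MonoidAlgebra.single g (1 : ℚ) := by
  rw [starSum, mul_sum, sum_mul]
  refine sum_bij (fun y _ => g y) (fun y hy => (hs y).2 hy) (fun _ _ _ _ h => g.injective h)
    (fun y hy => ⟨g.symm y, by rw [← hs]; simpa using hy, by simp⟩) fun y _ => ?_
  rw [MonoidAlgebra.single_mul_single, MonoidAlgebra.single_mul_single, mul_swap_eq_swap_mul, hx]

theorem youngCoeff_eq_zero_of_common {r c : α → ℕ} {g : Perm α} {x y : α} (hxy : x ≠ y)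
    (hr : r x = r y) (hc : c (g x) = c (g y)) : youngCoeff r c g = 0 := by
  have e1 := youngCoeff_mul_right (c := c) (swap x y) g (comp_swap_eq hr)
  rw [mul_swap_eq_swap_mul, youngCoeff_mul_left _ _ (comp_swap_eq hc),
    Perm.sign_swap (g.injective.ne hxy)] at e1
  push_cast at e1
  linarith

variable {r c : α → ℕ}

theorem IsShape.youngCoeff_swap_corner (h : IsShape r c) {x : α}
    (hx : ∀ y, r x ≤ r y → c x ≤ c y → y = x) {y : α} (hy : y ≠ x) :
    youngCoeff r c (swap y x) = (if r y = r x then 1 else 0) - if c y = c x then 1 else 0 := by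
  split_ifs with h1 h2 h2
  · exact absurd (h.inj _ _ h1 h2) hy
  · rw [← one_mul (swap y x), youngCoeff_mul_right _ _ (comp_swap_eq h1), youngCoeff_one h]
    simp
  · rw [← mul_one (swap y x), youngCoeff_mul_left _ _ (comp_swap_eq h2), youngCoeff_one h,
      Perm.sign_swap hy]
    simp
  · rw [sub_zero]
    rcases le_or_gt (c y) (c x) with hle | hlt
    · obtain ⟨z, hz1, hz2⟩ := h.lower x _ _ le_rfl hle
      have hzx : z ≠ x := by rintro rfl; exact h2 hz2.symm
      have hzy : z ≠ y := by rintro rfl; exact h1 hz1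
      refine youngCoeff_eq_zero_of_common hzx hz1 ?_
      rw [swap_apply_of_ne_of_ne hzy hzx, swap_apply_right, hz2]
    · have hr : r y ≤ r x := by
        by_contra! hr
        exact hy (hx y hr.le hlt.le)
      obtain ⟨z, hz1, hz2⟩ := h.lower x _ _ hr le_rfl
      have hzx : z ≠ x := by rintro rfl; exact h1 hz1.symm
      have hzy : z ≠ y := by rintro rfl; exact h2 hz2
      refine youngCoeff_eq_zero_of_common hzy hz1 ?_
      rw [swap_apply_of_ne_of_ne hzy hzx, swap_apply_left, hz2]

theorem IsShape.card_row_corner (h : IsShape r c) {x : α}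
    (hx : ∀ y, r x ≤ r y → c x ≤ c y → y = x) : #{y ∈ univ.erase x | r y = r x} = c x := by
  rw [← card_range (c x)]
  refine card_bij (fun y _ => c y) (fun y hy => ?_) (fun y hy z hz hyz => ?_) fun j hj => ?_
  · simp only [mem_filter, mem_erase, mem_univ, and_true] at hy
    rw [mem_range]
    by_contra! hle
    exact hy.1 (hx y hy.2.ge hle)
  · simp only [mem_filter, mem_erase, mem_univ, and_true] at hy hz
    exact h.inj _ _ (hy.2.trans hz.2.symm) hyz
  · obtain ⟨y, hy1, hy2⟩ := h.lower x (r x) j le_rfl (mem_range.1 hj).le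
    refine ⟨y, ?_, hy2⟩
    simp only [mem_filter, mem_erase, mem_univ, and_true]
    refine ⟨?_, hy1⟩
    rintro rfl
    exact (mem_range.1 hj).ne hy2.symm

theorem IsShape.transpose (h : IsShape r c) : IsShape c r where
  inj x y h1 h2 := h.inj x y h2 h1
  lower x i j hi hj := by
    obtain ⟨y, h1, h2⟩ := h.lower x j i hj hi
    exact ⟨y, h2, h1⟩

theorem IsShape.youngFunctional_starSum (h : IsShape r c) {x : α}
    (hx : ∀ y, r x ≤ r y → c x ≤ c y → y = x) :
    youngFunctional r c (starSum (univ.erase x) x) = (c x : ℚ) - r x := by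
  rw [starSum, map_sum]
  calc _ = ∑ y ∈ univ.erase x, ((if r y = r x then (1 : ℚ) else 0) - if c y = c x then 1 else 0) :=
        sum_congr rfl fun y hy => by
          rw [youngFunctional_single, h.youngCoeff_swap_corner hx (ne_of_mem_erase hy)]
    _ = _ := by
        rw [sum_sub_distrib, sum_boole, sum_boole, h.card_row_corner hx,
          h.transpose.card_row_corner fun y h1 h2 => hx y h2 h1]

theorem IsShape.restrict_corner (h : IsShape r c) {x : α}
    (hx : ∀ y, r x ≤ r y → c x ≤ c y → y = x) :
    IsShape (fun y : {y // y ≠ x} => r y) fun y => c y where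
  inj y z h1 h2 := Subtype.ext (h.inj _ _ h1 h2)
  lower y i j hi hj := by
    obtain ⟨z, hz1, hz2⟩ := h.lower y i j hi hj
    refine ⟨⟨z, ?_⟩, hz1, hz2⟩
    rintro rfl
    exact y.2 (hx y (hz1.trans_le hi) (hz2.trans_le hj))

/-- Elements commuting with the stabiliser of a corner box `x` are scaled by the sum of the
transpositions moving `x`. -/
theorem IsShape.youngFunctional_starSum_mul (h : IsShape r c) {x : α}
    (hx : ∀ y, r x ≤ r y → c x ≤ c y → y = x) (u : MonoidAlgebra ℚ (Perm α))
    (hu : ∀ g : Perm α, g x = x → MonoidAlgebra.single g 1 * u = u * MonoidAlgebra.single g 1) :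
    youngFunctional r c (starSum (univ.erase x) x * u) = ((c x : ℚ) - r x) * youngFunctional r c u := by
  set J := starSum (univ.erase x) x with hJ
  set ι : {y // y ≠ x} ↪ α := Function.Embedding.subtype _
  set D : MonoidAlgebra ℚ (Perm α) := ∑ p : {y // y ≠ x} × {y // y ≠ x},
    MonoidAlgebra.single (swap (p.1 : α) p.2) 1 with hD
  set Z : MonoidAlgebra ℚ (Perm α) := ∑ p : α × α, MonoidAlgebra.single (swap p.1 p.2) 1 with hZ
  have hZD : Z = D + J + J + 1 := by
    have e : ∀ F : α → MonoidAlgebra ℚ (Perm α),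
        ∑ y, F y = ∑ y : {y // y ≠ x}, F y + F x := by
      intro F
      rw [← sum_erase_add _ _ (mem_univ x)]
      congr 1
      exact (sum_subtype _ (by simp) F)
    have hJ' : J = ∑ y : {y // y ≠ x}, MonoidAlgebra.single (swap (y : α) x) 1 := by
      rw [hJ, starSum]
      exact (sum_subtype _ (by simp) fun y => MonoidAlgebra.single (swap y x) (1 : ℚ))
    rw [hZ, hD, Fintype.sum_prod_type, Fintype.sum_prod_type, e]
    simp only [e, sum_add_distrib]
    rw [← hJ', swap_self, show (Equiv.refl α : Perm α) = 1 from rfl, ← MonoidAlgebra.one_def,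
      show ∑ y : {y // y ≠ x}, MonoidAlgebra.single (swap x (y : α)) (1 : ℚ) = J by
        rw [hJ']; exact sum_congr rfl fun y _ => by rw [swap_comm]]
    abel
  have hZc : ∀ g : Perm α, MonoidAlgebra.single g 1 * Z = Z * MonoidAlgebra.single g 1 := by
    intro g
    rw [hZ, mul_sum, sum_mul]
    refine Fintype.sum_equiv (Equiv.prodCongr g g) _ _ fun p => ?_
    rw [MonoidAlgebra.single_mul_single, MonoidAlgebra.single_mul_single, mul_swap_eq_swap_mul]
    rfl
  have hψ : ∀ g : Perm {y // y ≠ x}, youngFunctional r c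
      (MonoidAlgebra.single (g.viaEmbedding ι) 1 * u) =
      youngCoeff r c (g.viaEmbedding ι) * youngFunctional r c u := by
    intro g
    rw [h.youngCoeff_viaEmbedding]
    have hfix : ∀ p : Perm {y // y ≠ x}, p.viaEmbedding ι x = x := fun p =>
      Perm.viaEmbedding_apply_of_notMem _ _ _ (by simp [ι])
    rw [(h.restrict_corner hx).eq_mul_youngCoeff (fun g => youngFunctional r c
      (MonoidAlgebra.single (g.viaEmbedding ι) 1 * u)) (fun q g hq => ?_) (fun p g hp => ?_) g]
    · rw [show (1 : Perm {y // y ≠ x}).viaEmbedding ι = 1 from map_one (Perm.viaEmbeddingHom ι),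
        ← MonoidAlgebra.one_def, one_mul, mul_comm]
      rfl
    · have hq' : ∀ y, c (q.viaEmbedding ι y) = c y := (viaEmbedding_comp_iff c q ι).2 hq
      rw [viaEmbedding_mul, ← sign_viaEmbedding q ι, ← youngFunctional_single_mul _ hq', ← mul_assoc,
        MonoidAlgebra.single_mul_single, one_mul]
    · have hp' : ∀ y, r (p.viaEmbedding ι y) = r y := (viaEmbedding_comp_iff r p ι).2 hp
      rw [viaEmbedding_mul, ← one_mul (1 : ℚ), ← MonoidAlgebra.single_mul_single, mul_assoc,
        hu _ (hfix p), ← mul_assoc, youngFunctional_mul_single _ hp',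
        mul_one]
  have hDu : youngFunctional r c (D * u) = youngFunctional r c D * youngFunctional r c u := by
    rw [hD, sum_mul, map_sum, map_sum, sum_mul]
    refine sum_congr rfl fun p _ => ?_
    have := hψ (swap p.1 p.2)
    rw [viaEmbedding_swap] at this
    rw [youngFunctional_single]
    exact this
  have hZu := h.youngFunctional_central_mul hZc u
  have h1 : youngFunctional r c 1 = 1 := by
    rw [MonoidAlgebra.one_def, youngFunctional_single, youngCoeff_one h]
  rw [hZD] at hZu
  simp only [add_mul, one_mul, map_add, hDu, h1, h.youngFunctional_starSum hx, hJ] at hZu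
  linarith

theorem IsShape.youngFunctional_starSum_pow (h : IsShape r c) {x : α}
    (hx : ∀ y, r x ≤ r y → c x ≤ c y → y = x) (m : ℕ) :
    youngFunctional r c (starSum (univ.erase x) x ^ m) = ((c x : ℚ) - r x) ^ m := by
  induction m with
  | zero => rw [pow_zero, pow_zero, MonoidAlgebra.one_def, youngFunctional_single, youngCoeff_one h]
  | succ m ih =>
    rw [pow_succ', h.youngFunctional_starSum_mul hx _ fun g hg => ?_, ih, pow_succ']
    refine (Commute.pow_right (a := MonoidAlgebra.single g (1 : ℚ)) ?_ m :)
    refine single_mul_starSum _ g hg fun y => ?_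
    simp only [mem_erase, mem_univ, and_true]
    rw [not_iff_not]
    exact ⟨fun h => g.injective (h.trans hg.symm), fun h => h ▸ hg⟩

end Star

section Content
variable {n : ℕ} {r c : Fin n → ℕ}

theorem IsShape.youngFunctional_starSum_Iio_pow (h : IsShape r c)
    (hmono : ∀ x y, r y ≤ r x → c y ≤ c x → y ≤ x) (x : Fin n) (m : ℕ) :
    youngFunctional r c (starSum (Iio x) x ^ m) = ((c x : ℚ) - r x) ^ m := by
  let ι : {y // y ≤ x} ↪ Fin n := Function.Embedding.subtype _
  have h' : IsShape (fun y : {y // y ≤ x} => r y) fun y => c y :=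
    { inj := fun y z h1 h2 => Subtype.ext (h.inj _ _ h1 h2)
      lower := fun y i j hi hj => by
        obtain ⟨z, hz1, hz2⟩ := h.lower y i j hi hj
        exact ⟨⟨z, (hmono y z (hz1.trans_le hi) (hz2.trans_le hj)).trans y.2⟩, hz1, hz2⟩ }
  have key := h'.youngFunctional_starSum_pow (x := ⟨x, le_rfl⟩)
    (fun y h1 h2 => Subtype.ext (le_antisymm y.2 (hmono y x h1 h2))) m
  rw [← key, starSum_pow, starSum_pow, map_sum, map_sum]
  symm
  refine Fintype.sum_of_injective (fun f i => ι (f i))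
    (fun f g hfg => funext fun i => ι.injective (congrFun hfg i)) _ _ (fun f hf => ?_) fun f => ?_
  · rw [if_neg, map_zero]
    intro hlt
    exact hf ⟨fun i => ⟨f i, (mem_Iio.1 (hlt i)).le⟩, rfl⟩
  · have hiff : (∀ i, f i ∈ univ.erase (⟨x, le_rfl⟩ : {y // y ≤ x})) ↔ ∀ i, ι (f i) ∈ Iio x := by
      refine forall_congr' fun i => ?_
      simp only [mem_erase, mem_univ, and_true, mem_Iio, ne_eq]
      rw [lt_iff_le_and_ne]
      exact ⟨fun h => ⟨(f i).2, fun h' => h (Subtype.ext h')⟩, fun h h' => h.2 (congrArg _ h')⟩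
    by_cases hf : ∀ i, f i ∈ univ.erase (⟨x, le_rfl⟩ : {y // y ≤ x})
    · rw [if_pos hf, if_pos (hiff.1 hf), youngFunctional_single, youngFunctional_single]
      change _ = youngCoeff r c (starProd (fun i => ι (f i)) (ι ⟨x, le_rfl⟩))
      rw [← viaEmbedding_starProd, h.youngCoeff_viaEmbedding]
      rfl
    · rw [if_neg hf, if_neg (hiff.not.1 hf), map_zero, map_zero]

theorem exists_pow_relation {R : Type*} [Ring R] {s a b : R} (hs : s * a + 1 = b * s)
    (hs' : s * b = a * s + 1) (hab : a * b = b * a) (m : ℕ) :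
    ∃ h : R, s * a ^ m = b ^ m * s - h ∧ s * b ^ m = a ^ m * s + h := by
  suffices H : ∃ h : R, s * a ^ m = b ^ m * s - h ∧ s * b ^ m = a ^ m * s + h ∧
      h * (b - a) = b ^ m - a ^ m ∧ Commute h a by
    obtain ⟨h, h1, h2, -⟩ := H
    exact ⟨h, h1, h2⟩
  have hs1 : s * a = b * s - 1 := by rw [← hs]; abel
  have cab : Commute a b := hab
  induction m with
  | zero => exact ⟨0, by simp, by simp, by simp, Commute.zero_left a⟩
  | succ m ih =>
    obtain ⟨h, h1, h2, h3, h4⟩ := ih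
    refine ⟨b ^ m + h * a, ?_, ?_, ?_, ?_⟩
    · rw [pow_succ a, ← mul_assoc, h1, sub_mul, mul_assoc, hs1, pow_succ]
      noncomm_ring
    · have h5 : h * b = h * a + b ^ m - a ^ m := by
        rw [mul_sub] at h3
        rw [add_sub_assoc, ← h3]
        abel
      rw [pow_succ b, ← mul_assoc, h2, add_mul, mul_assoc, hs', h5, pow_succ]
      noncomm_ring
    · have : h * a * (b - a) = (h * (b - a)) * a := by
        rw [mul_assoc, mul_assoc]
        congr 1
        rw [mul_sub, sub_mul, hab]
      rw [add_mul, this, h3, pow_succ, pow_succ]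
      noncomm_ring
    · exact (cab.symm.pow_left m).add_left (h4.mul_left (Commute.refl a))

end Content

section Central

theorem commute_starSum_Iio {n : ℕ} {j k : Fin n} (hjk : j < k) :
    Commute (starSum (Iio j) j) (starSum (Iio k) k) := by
  refine Commute.sum_left _ _ _ fun y hy => ?_
  have hy' := mem_Iio.1 hy
  have hyk := hy'.trans hjk
  refine single_mul_starSum _ _ (swap_apply_of_ne_of_ne hyk.ne' hjk.ne') fun z => ?_
  rw [mem_Iio, mem_Iio, swap_apply_def]
  split_ifs with h1 h2
  · subst h1; exact ⟨fun _ => hyk, fun _ => hjk⟩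
  · subst h2; exact ⟨fun _ => hjk, fun _ => hyk⟩
  · rfl

theorem swap_mul_starSum_castSucc {n : ℕ} (i : Fin n) :
    MonoidAlgebra.single (swap i.castSucc i.succ) 1 * starSum (Iio i.castSucc) i.castSucc + 1 =
      starSum (Iio i.succ) i.succ * MonoidAlgebra.single (swap i.castSucc i.succ) (1 : ℚ) := by
  have hI : (Iio i.succ : Finset (Fin (n + 1))) = insert i.castSucc (Iio i.castSucc) := by
    ext j
    simp only [mem_Iio, mem_insert, Fin.lt_def, Fin.ext_iff, Fin.val_succ, Fin.val_castSucc]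
    omega
  rw [starSum, starSum, hI, sum_insert (by simp), add_mul, mul_sum, sum_mul,
    add_comm _ (1 : MonoidAlgebra ℚ (Perm (Fin (n + 1)))),
    MonoidAlgebra.single_mul_single, swap_mul_self, one_mul, MonoidAlgebra.one_def]
  congr 1
  refine sum_congr rfl fun y hy => ?_
  have hy' := mem_Iio.1 hy
  rw [MonoidAlgebra.single_mul_single, MonoidAlgebra.single_mul_single, mul_swap_eq_swap_mul,
    swap_apply_left, swap_apply_of_ne_of_ne hy'.ne (hy'.trans i.castSucc_lt_succ).ne]

theorem commute_sum_starSum_Iio_pow {n : ℕ} (m : ℕ) (g : Perm (Fin n)) :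
    Commute (MonoidAlgebra.single g 1) (∑ k, starSum (Iio k) k ^ m : MonoidAlgebra ℚ (Perm (Fin n))) := by
  cases n with
  | zero => rw [Subsingleton.elim g 1, ← MonoidAlgebra.one_def]; exact Commute.one_left _
  | succ n =>
    have hg : g ∈ Submonoid.closure (Set.range fun i : Fin n => swap i.castSucc i.succ) := by
      rw [Perm.mclosure_swap_castSucc_succ]; trivial
    induction hg using Submonoid.closure_induction with
    | one => rw [← MonoidAlgebra.one_def]; exact Commute.one_left _
    | mul g₁ g₂ _ _ h₁ h₂ =>
      rw [← one_mul (1 : ℚ), ← MonoidAlgebra.single_mul_single]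
      exact h₁.mul_left h₂
    | mem g hg =>
      obtain ⟨i, rfl⟩ := hg
      have hlt : i.castSucc < i.succ := i.castSucc_lt_succ
      have hs := swap_mul_starSum_castSucc i
      set s : MonoidAlgebra ℚ (Perm (Fin (n + 1))) :=
        MonoidAlgebra.single (swap i.castSucc i.succ) 1 with hsdef
      have hss : s * s = 1 := by
        rw [hsdef, MonoidAlgebra.single_mul_single, swap_mul_self, one_mul, MonoidAlgebra.one_def]
      have hs' : s * starSum (Iio i.succ) i.succ = starSum (Iio i.castSucc) i.castSucc * s + 1 := by
        calc s * starSum (Iio i.succ) i.succ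
            = s * (starSum (Iio i.succ) i.succ * s) * s := by
              rw [mul_assoc, mul_assoc, hss, mul_one]
          _ = _ := by
              rw [← hs, mul_add, mul_one, ← mul_assoc, hss, one_mul, add_mul, hss]
      obtain ⟨h, h1, h2⟩ := exists_pow_relation hs hs' (commute_starSum_Iio hlt) m
      rw [← sum_erase_add _ _ (mem_univ i.castSucc),
        ← sum_erase_add _ _ (mem_erase.2 ⟨hlt.ne', mem_univ i.succ⟩), add_assoc]
      refine Commute.add_right (Commute.sum_right _ _ _ fun k hk => Commute.pow_right ?_ m) ?_
      · simp only [mem_erase, mem_univ, and_true] at hk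
        refine single_mul_starSum _ _ (swap_apply_of_ne_of_ne hk.2 hk.1) fun z => ?_
        have e1 : (i.castSucc : ℕ) = i := rfl
        have e2 : (i.succ : ℕ) = i + 1 := rfl
        have e3 : (k : ℕ) ≠ i := fun h => hk.2 (Fin.ext h)
        have e4 : (k : ℕ) ≠ i + 1 := fun h => hk.1 (Fin.ext h)
        rw [mem_Iio, mem_Iio, swap_apply_def]
        split_ifs with h1 h2
        · subst h1; rw [Fin.lt_def, Fin.lt_def]; omega
        · subst h2; rw [Fin.lt_def, Fin.lt_def]; omega
        · rfl
      · change s * _ = _ * s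
        rw [mul_add, add_mul, h1, h2]
        abel

end Central

section PowerSum

/-- The power sums of the contents of a diagram. -/
def contentSum (μ : YoungDiagram) (m : ℕ) : ℚ := ∑ x ∈ μ.cells, ((x.2 : ℚ) - x.1) ^ m

/-- A monotone numbering of the boxes. -/
theorem exists_labelling (μ : YoungDiagram) : ∃ e : Fin μ.card ≃ {c // c ∈ μ.cells},
    ∀ x y, (e y).1.1 ≤ (e x).1.1 → (e y).1.2 ≤ (e x).1.2 → y ≤ x := by
  let s : Finset (ℕ ×ₗ ℕ) := μ.cells.map (toLex : ℕ × ℕ ≃ ℕ ×ₗ ℕ).toEmbedding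
  let o := s.orderIsoOfFin (k := μ.card) (by simp [s, YoungDiagram.card])
  let e : s ≃ {c // c ∈ μ.cells} := (ofLex : ℕ ×ₗ ℕ ≃ ℕ × ℕ).subtypeEquiv fun a => by
    simp [s, mem_map_equiv]
  refine ⟨o.toEquiv.trans e, fun x y h1 h2 => o.le_iff_le.1 ?_⟩
  change toLex (ofLex (o y).1) ≤ toLex (ofLex (o x).1)
  exact Prod.Lex.toLex_mono (Prod.mk_le_mk.2 ⟨h1, h2⟩)

theorem sum_contentSum_eq (μ : YoungDiagram) (m : ℕ) {n : ℕ} (e : Fin n ≃ {c // c ∈ μ.cells})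
    (he : ∀ x y, (e y).1.1 ≤ (e x).1.1 → (e y).1.2 ≤ (e x).1.2 → y ≤ x) (g : Perm (Fin n)) :
    contentSum μ m = ∑ x : Fin n, ∑ f : Fin m → Fin n, if ∀ i, f i < x then
      youngCoeff (fun x => (e x).1.1) (fun x => (e x).1.2) (starProd (fun i => g (f i)) (g x))
      else 0 := by
  set r : Fin n → ℕ := fun x => (e x).1.1
  set c : Fin n → ℕ := fun x => (e x).1.2
  have h : IsShape r c :=
    { inj := fun x y h1 h2 => e.injective ((isShape_cells μ).inj _ _ h1 h2)
      lower := fun x i j h1 h2 => by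
        obtain ⟨y, h1, h2⟩ := (isShape_cells μ).lower (e x) i j h1 h2
        exact ⟨e.symm y, by simpa [r] using h1, by simpa [c] using h2⟩ }
  have h1 : contentSum μ m = youngFunctional r c (∑ k, starSum (Iio k) k ^ m) := by
    rw [map_sum, contentSum, ← sum_coe_sort, ← e.sum_comp]
    exact sum_congr rfl fun x _ => (h.youngFunctional_starSum_Iio_pow he x m).symm
  have h2 : (∑ k, starSum (Iio k) k ^ m : MonoidAlgebra ℚ (Perm (Fin n))) =
      MonoidAlgebra.single g 1 * (∑ k, starSum (Iio k) k ^ m) * MonoidAlgebra.single g⁻¹ 1 := by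
    rw [(commute_sum_starSum_Iio_pow m g).eq, mul_assoc, MonoidAlgebra.single_mul_single,
      mul_inv_cancel, one_mul, ← MonoidAlgebra.one_def, mul_one]
  rw [h1, h2, mul_sum, sum_mul, map_sum]
  refine sum_congr rfl fun x _ => ?_
  rw [starSum_pow, mul_sum, sum_mul, map_sum]
  refine sum_congr rfl fun f _ => ?_
  simp only [mem_Iio]
  split_ifs
  · rw [MonoidAlgebra.single_mul_single, MonoidAlgebra.single_mul_single, one_mul, one_mul,
      youngFunctional_single, conj_starProd]
  · simp

end PowerSum

section Expansion

theorem card_mul_card_max_embedding {Q α : Type*} [Fintype Q] [DecidableEq Q] [Fintype α]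
    [LinearOrder α] (q₀ : Q) :
    Fintype.card Q * #{ι : Q ↪ α | ∀ q ≠ q₀, ι q < ι q₀} = Fintype.card (Q ↪ α) := by
  have h1 : ∀ q₁ : Q, #{ι : Q ↪ α | ∀ q ≠ q₁, ι q < ι q₁} = #{ι : Q ↪ α | ∀ q ≠ q₀, ι q < ι q₀} := by
    intro q₁
    refine card_equiv (Equiv.embeddingCongr (swap q₀ q₁) (Equiv.refl α)) fun ι => ?_
    simp only [mem_filter, mem_univ, true_and]
    change _ ↔ ∀ q ≠ q₀, ι (swap q₀ q₁ q) < ι (swap q₀ q₁ q₀)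
    rw [swap_apply_left]
    refine ⟨fun h q hq => h _ fun h' => hq ?_, fun h q hq => ?_⟩
    · rw [swap_apply_eq_iff, swap_apply_right] at h'
      exact h'
    · have := h (swap q₀ q₁ q) fun h' => hq (by rwa [swap_apply_eq_iff, swap_apply_left] at h')
      rwa [swap_apply_self] at this
  calc _ = ∑ q₁ : Q, #{ι : Q ↪ α | ∀ q ≠ q₁, ι q < ι q₁} := by
        rw [sum_congr rfl fun q₁ _ => h1 q₁, sum_const, card_univ, smul_eq_mul]
    _ = ∑ ι : Q ↪ α, #{q₁ : Q | ∀ q ≠ q₁, ι q < ι q₁} := by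
        simp only [card_filter]
        exact sum_comm
    _ = ∑ ι : Q ↪ α, 1 := by
        refine sum_congr rfl fun ι _ => card_eq_one.2 ?_
        obtain ⟨q, -, hq⟩ := exists_max_image univ ι ⟨q₀, mem_univ _⟩
        refine ⟨q, ?_⟩
        ext q'
        simp only [mem_filter, mem_univ, true_and, mem_singleton]
        refine ⟨fun h => ?_, ?_⟩
        · by_contra hne
          exact (h q (Ne.symm hne)).not_ge (hq q' (mem_univ _))
        · rintro rfl q hne
          exact lt_of_le_of_ne (hq q (mem_univ _)) fun h => hne (ι.injective h)
    _ = _ := by simp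

/-- The product of the transpositions exchanging the class of `none` with the class of `some i`. -/
noncomputable def quotientStar {m : ℕ} (s : Setoid (Option (Fin m))) : Perm (Quotient s) :=
  starProd (fun i => Quotient.mk s (some i)) (Quotient.mk s none)

open scoped Classical in
theorem contentSum_eq_sum_diagChar (μ : YoungDiagram) (m : ℕ) :
    contentSum μ m = ∑ s : Setoid (Option (Fin m)),
      if ∀ i, Quotient.mk s (some i) ≠ Quotient.mk s none then
        (Fintype.card (Quotient s) : ℚ)⁻¹ * diagChar μ (quotientStar s) else 0 := by
  obtain ⟨n, e, he⟩ : ∃ (n : ℕ) (e : Fin n ≃ {c // c ∈ μ.cells}),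
      ∀ x y, (e y).1.1 ≤ (e x).1.1 → (e y).1.2 ≤ (e x).1.2 → y ≤ x := ⟨_, exists_labelling μ⟩
  set r : Fin n → ℕ := fun x => (e x).1.1
  set c : Fin n → ℕ := fun x => (e x).1.2
  let Y : (Option (Fin m) → Fin n) → ℚ := fun F => youngCoeff r c (starProd (fun i => F (some i)) (F none))
  have hch : ∀ s : Setoid (Option (Fin m)), diagChar μ (quotientStar s) =
      ∑ ι : Quotient s ↪ Fin n, Y fun a => ι (Quotient.mk s a) := by
    intro s
    rw [diagChar, ← embChar_comp_equiv _ _ e, embChar]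
    exact sum_congr rfl fun ι _ => by rw [quotientStar, viaEmbedding_starProd]; rfl
  have hg : ∀ g : Perm (Fin n), contentSum μ m = ∑ s : Setoid (Option (Fin m)),
      ∑ ι : Quotient s ↪ Fin n,
        if ∀ i, ι (Quotient.mk s (some i)) < ι (Quotient.mk s none) then
          Y (fun a => g (ι (Quotient.mk s a))) else 0 := by
    intro g
    rw [← sum_eq_sum_setoid fun F : Option (Fin m) → Fin n =>
      if ∀ i, F (some i) < F none then Y (fun a => g (F a)) else 0, sum_contentSum_eq μ m e he g,
      ← Fintype.sum_prod_type' fun (x : Fin n) (f : Fin m → Fin n) => if ∀ i, f i < x then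
      youngCoeff r c (starProd (fun i => g (f i)) (g x)) else 0]
    refine Fintype.sum_equiv ⟨fun p a => a.elim p.1 p.2, fun F => (F none, fun i => F (some i)),
      fun p => rfl, fun F => by ext (_ | a) <;> rfl⟩ _ _ fun p => ?_
    rfl
  have hfac : (n.factorial : ℚ) ≠ 0 := by exact_mod_cast n.factorial_ne_zero
  have hcard : Fintype.card (Perm (Fin n)) = n.factorial := by simp [Fintype.card_perm]
  have htot : (n.factorial : ℚ) * contentSum μ m = ∑ g : Perm (Fin n), contentSum μ m := by
    rw [sum_const, card_univ, hcard, nsmul_eq_mul]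
  refine mul_left_cancel₀ hfac ?_
  rw [htot, sum_congr rfl fun g _ => hg g, sum_comm, mul_sum]
  refine sum_congr rfl fun s _ => ?_
  have hvalid : ∀ ι : Quotient s ↪ Fin n,
      (∀ i, ι (Quotient.mk s (some i)) < ι (Quotient.mk s none)) ↔
      (∀ i, Quotient.mk s (some i) ≠ Quotient.mk s none) ∧
        ∀ q ≠ Quotient.mk s none, ι q < ι (Quotient.mk s none) := by
    intro ι
    refine ⟨fun h => ⟨fun i hi => (h i).ne (congrArg ι hi), fun q hq => ?_⟩, fun h i => h.2 _ (h.1 i)⟩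
    obtain ⟨(_ | i), rfl⟩ := Quotient.mk_surjective q
    · exact absurd rfl hq
    · exact h i
  rw [sum_comm]
  split_ifs with hs
  · have hQ : (Fintype.card (Quotient s) : ℚ) ≠ 0 := by
      exact_mod_cast (Fintype.card_pos_iff.2 ⟨Quotient.mk s none⟩).ne'
    have hcount := card_mul_card_max_embedding (α := Fin n) (Quotient.mk s none)
    have hι : ∀ ι : Quotient s ↪ Fin n, (Fintype.card (Quotient s ↪ Fin n) : ℚ) *
        ∑ g : Perm (Fin n), (if ∀ i, ι (Quotient.mk s (some i)) < ι (Quotient.mk s none) then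
          Y (fun a => g (ι (Quotient.mk s a))) else 0) =
        if ∀ q ≠ Quotient.mk s none, ι q < ι (Quotient.mk s none) then
          (n.factorial : ℚ) * diagChar μ (quotientStar s) else 0 := by
      intro ι
      simp only [(hvalid ι).trans (and_iff_right hs)]
      split_ifs with h
      · rw [hch, ← hcard, ← sum_embedding_trans (fun ι => Y fun a => ι (Quotient.mk s a)) ι]
        rfl
      · simp
    by_cases hE : Fintype.card (Quotient s ↪ Fin n) = 0
    · have : IsEmpty (Quotient s ↪ Fin n) := Fintype.card_eq_zero_iff.1 hE
      rw [hch, Fintype.sum_empty, Fintype.sum_empty]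
      simp
    · refine mul_left_cancel₀ (Nat.cast_ne_zero.2 hE) ?_
      rw [mul_sum, sum_congr rfl fun ι _ => hι ι, ← sum_filter, sum_const, nsmul_eq_mul, ← hcount]
      push_cast
      field_simp
  · rw [mul_zero]
    refine sum_eq_zero fun ι _ => sum_eq_zero fun g _ => if_neg fun h => hs ((hvalid ι).1 h).1

end Expansion

section Transitive
variable {A B : Type*} [Fintype A] [DecidableEq A] [Fintype B] [DecidableEq B]

theorem sameCycle_swap_mul {σ : Perm A} {x y : A} (hy : σ y = y) :
    (swap y x * σ).SameCycle x y ∧ ∀ z, σ.SameCycle x z → (swap y x * σ).SameCycle x z := by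
  have h1 : (swap y x * σ).SameCycle x y := by
    refine Perm.SameCycle.symm ⟨1, ?_⟩
    rw [zpow_one, Perm.mul_apply, hy, swap_apply_left]
  refine ⟨h1, fun z hz => ?_⟩
  obtain ⟨n, rfl⟩ := hz.exists_nat_pow_eq
  induction n with
  | zero => exact Perm.SameCycle.refl _ _
  | succ n ih =>
    have ih' := ih ⟨n, by simp⟩
    rw [pow_succ', Perm.mul_apply]
    set w := (σ ^ n) x
    by_cases hx : σ w = x
    · rw [hx]
    · by_cases hwy : σ w = y
      · rwa [hwy]
      · have : (swap y x * σ) w = σ w := by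
          rw [Perm.mul_apply, swap_apply_of_ne_of_ne hwy hx]
        rw [← this]
        exact Perm.sameCycle_apply_right.2 ih'

theorem starProd_apply_of_ne {m : ℕ} (f : Fin m → A) {x z : A} (hx : z ≠ x) (hf : ∀ i, f i ≠ z) :
    starProd f x z = z := by
  induction m with
  | zero => simp [starProd]
  | succ m ih =>
    rw [starProd, List.ofFn_succ, List.prod_cons, Perm.mul_apply]
    have := ih (fun i => f i.succ) fun i => hf _
    rw [starProd] at this
    rw [this, swap_apply_of_ne_of_ne (hf 0).symm hx]

theorem sameCycle_starProd {m : ℕ} (f : Fin m → A) (x : A) (hf : Function.Injective f)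
    (hx : ∀ i, f i ≠ x) (i : Fin m) : (starProd f x).SameCycle x (f i) := by
  induction m with
  | zero => exact i.elim0
  | succ m ih =>
    have hstep : starProd f x = swap (f 0) x * starProd (fun i => f i.succ) x := by
      rw [starProd, List.ofFn_succ, List.prod_cons]
      rfl
    have h0 : starProd (fun i => f i.succ) x (f 0) = f 0 :=
      starProd_apply_of_ne _ (hx 0) fun i h => Fin.succ_ne_zero i (hf h)
    obtain ⟨h1, h2⟩ := sameCycle_swap_mul (x := x) h0
    rw [hstep]
    cases i using Fin.cases with
    | zero => exact h1
    | succ i => exact h2 _ (ih _ (fun a b h => Fin.succ_injective _ (hf h)) (fun i => hx _) i)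

theorem exists_permCongr_eq {π : Perm A} {π' : Perm B} (h : ∀ a b, π.SameCycle a b)
    (h' : ∀ a b, π'.SameCycle a b) (hcard : Fintype.card A = Fintype.card B) :
    ∃ e : A ≃ B, e.permCongr π = π' := by
  obtain ⟨e⟩ := Fintype.card_eq.1 hcard
  rcases subsingleton_or_nontrivial B with hB | hB
  · exact ⟨e, Subsingleton.elim _ _⟩
  have hA : Nontrivial A := e.nontrivial
  have moved : ∀ {C : Type _} [Nontrivial C] (σ : Perm C), (∀ a b, σ.SameCycle a b) → ∀ a, σ a ≠ a := by
    intro C _ σ hσ a ha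
    obtain ⟨b, hb⟩ := exists_ne a
    obtain ⟨n, hn⟩ := hσ a b
    exact hb (hn.symm.trans (Perm.zpow_apply_eq_self_of_apply_eq_self ha n))
  have htr : ∀ a b, (e.permCongr π).SameCycle a b := by
    intro a b
    obtain ⟨n, hn⟩ := h (e.symm a) (e.symm b)
    refine ⟨n, ?_⟩
    have : (e.permCongr π) ^ n = e.permCongr (π ^ n) := (map_zpow e.permCongrHom π n).symm
    rw [this, Equiv.permCongr_apply, hn, apply_symm_apply]
  have cyc : ∀ {C : Type _} [Nontrivial C] (σ : Perm C), (∀ a b, σ.SameCycle a b) → σ.IsCycle := by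
    intro C _ σ hσ
    obtain ⟨a⟩ := (inferInstance : Nonempty C)
    exact ⟨a, moved σ hσ a, fun b _ => hσ a b⟩
  have supp : ∀ σ : Perm B, (∀ a b, σ.SameCycle a b) → σ.support = univ := by
    intro σ hσ
    ext a
    simpa using moved σ hσ a
  obtain ⟨c, hc⟩ := isConj_iff.1 ((cyc _ htr).isConj (cyc _ h') (by rw [supp _ htr, supp _ h']))
  refine ⟨e.trans c, ?_⟩
  rw [← hc]
  ext x
  simp

theorem permCongr_sumCompl_subtypePerm (π : Perm A) (p : A → Prop) [DecidablePred p]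
    (hp : ∀ x, p (π x) ↔ p x) :
    (sumCompl p).permCongr (Equiv.sumCongr (π.subtypePerm hp)
      (π.subtypePerm (p := fun x => ¬ p x) fun x => not_congr (hp x))) = π := by
  ext x
  obtain ⟨(b | b), rfl⟩ := (sumCompl p).surjective x <;> simp

end Transitive

section CharAlgebra

/-- The normalized character as a function on Young diagrams. -/
noncomputable def charFun {A : Type*} [Fintype A] [DecidableEq A] (π : Perm A) : YoungDiagram → ℚ :=
  fun μ => diagChar μ π

/-- The algebra generated by the content sums of degree less than `N`. -/
def contentAlgebra (N : ℕ) : Subalgebra ℚ (YoungDiagram → ℚ) :=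
  Algebra.adjoin ℚ {f | ∃ j < N, f = fun μ => contentSum μ j}

theorem contentAlgebra_mono {M N : ℕ} (h : M ≤ N) : contentAlgebra M ≤ contentAlgebra N :=
  Algebra.adjoin_mono fun _ ⟨j, hj, hf⟩ => ⟨j, hj.trans_le h, hf⟩

theorem contentSum_mem {j N : ℕ} (h : j < N) : (fun μ => contentSum μ j) ∈ contentAlgebra N :=
  Algebra.subset_adjoin ⟨j, h, rfl⟩

theorem charFun_permCongr {A B : Type*} [Fintype A] [DecidableEq A] [Fintype B] [DecidableEq B]
    (e : A ≃ B) (π : Perm A) : charFun (e.permCongr π) = charFun π :=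
  funext fun _ => embChar_permCongr _ _ e π

/-- Cyclic permutations of `m + 1` points, up to lower order terms, are content sums. -/
theorem charFun_sub_mem_of_transitive {m : ℕ}
    (ih : ∀ (A : Type) [Fintype A] [DecidableEq A], Fintype.card A < m + 1 → ∀ π : Perm A,
      charFun π ∈ contentAlgebra (Fintype.card A))
    {A : Type} [Fintype A] [DecidableEq A] (hA : Fintype.card A = m + 1) (π : Perm A)
    (hπ : ∀ a b, π.SameCycle a b) :
    charFun π - ((m + 1 : ℕ) : ℚ) • (fun μ => contentSum μ m) ∈ contentAlgebra m := by
  classical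
  have hT : (fun μ => contentSum μ m) = ∑ s : Setoid (Option (Fin m)),
      if ∀ i, Quotient.mk s (some i) ≠ Quotient.mk s none then
        (Fintype.card (Quotient s) : ℚ)⁻¹ • charFun (quotientStar s) else 0 := by
    ext μ
    rw [contentSum_eq_sum_diagChar, Finset.sum_apply]
    refine sum_congr rfl fun s _ => ?_
    split_ifs <;> rfl
  have hinj : Function.Injective fun a : Option (Fin m) => Quotient.mk (⊥ : Setoid _) a :=
    (quotientBotEquiv _).injective
  have hbot : Fintype.card (Quotient (⊥ : Setoid (Option (Fin m)))) = m + 1 := by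
    rw [← Fintype.card_congr (quotientBotEquiv (Option (Fin m)))]; simp
  have hbotπ : charFun (quotientStar (⊥ : Setoid (Option (Fin m)))) = charFun π := by
    have h1 : ∀ a, (quotientStar (⊥ : Setoid (Option (Fin m)))).SameCycle (Quotient.mk _ none) a := by
      intro a
      obtain ⟨(_ | i), rfl⟩ := Quotient.mk_surjective a
      · exact Perm.SameCycle.refl _ _
      · exact sameCycle_starProd _ _ (fun i j h => Option.some_injective _ (hinj h))
          (fun i h => Option.some_ne_none _ (hinj h)) i
    obtain ⟨e, he⟩ := exists_permCongr_eq hπ (fun a b => (h1 a).symm.trans (h1 b)) (hA.trans hbot.symm)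
    rw [← he, charFun_permCongr]
  rw [← add_sum_erase _ _ (mem_univ (⊥ : Setoid (Option (Fin m)))), if_pos fun i h =>
    Option.some_ne_none _ (hinj h), hbot, hbotπ] at hT
  rw [hT, smul_add, smul_smul, mul_inv_cancel₀ (by positivity), one_smul, sub_add_cancel_left]
  refine neg_mem (Subalgebra.smul_mem _ (sum_mem fun s hs => ?_) _)
  split_ifs
  · refine Subalgebra.smul_mem _ ?_ _
    have hlt := card_quotient_lt (ne_of_mem_erase hs)
    rw [Fintype.card_option, Fintype.card_fin] at hlt
    exact contentAlgebra_mono (Nat.lt_succ_iff.1 hlt) (ih _ hlt _)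
  · exact zero_mem _

theorem charFun_mem (N : ℕ) : ∀ (A : Type) [Fintype A] [DecidableEq A], Fintype.card A = N →
    ∀ π : Perm A, charFun π ∈ contentAlgebra N := by
  classical
  induction N using Nat.strong_induction_on with
  | _ N ih =>
  intro A _ _ hA π
  by_cases htr : ∀ a b, π.SameCycle a b
  · cases N with
    | zero =>
      have : IsEmpty A := Fintype.card_eq_zero_iff.1 hA
      convert one_mem (contentAlgebra 0)
      ext μ
      change embChar _ _ π = 1
      rw [(isShape_cells μ).embChar_eq_sum, Fintype.sum_unique]
      rw [youngCoeff_eq_sum, Fintype.sum_unique]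
      simp
    | succ m =>
      have h1 := charFun_sub_mem_of_transitive (fun B _ _ hB π => ih _ hB B rfl π) hA π htr
      have h2 := add_mem (contentAlgebra_mono m.le_succ h1)
        (Subalgebra.smul_mem _ (contentSum_mem m.lt_succ_self) ((m + 1 : ℕ) : ℚ))
      rwa [sub_add_cancel] at h2
  · push Not at htr
    obtain ⟨a, b, hab⟩ := htr
    have hp : ∀ x, π.SameCycle a (π x) ↔ π.SameCycle a x := fun x => Perm.sameCycle_apply_right
    set π₁ := π.subtypePerm hp
    set π₂ := π.subtypePerm (p := fun x => ¬ π.SameCycle a x) fun x => not_congr (hp x)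
    have hcard : Fintype.card ({x // π.SameCycle a x} ⊕ {x // ¬ π.SameCycle a x}) = N := by
      rw [Fintype.card_congr (sumCompl _), hA]
    have hsum : Fintype.card {x // π.SameCycle a x} + Fintype.card {x // ¬ π.SameCycle a x} = N := by
      rw [← hcard, Fintype.card_sum]
    have hb : 0 < Fintype.card {x // ¬ π.SameCycle a x} := Fintype.card_pos_iff.2 ⟨⟨b, hab⟩⟩
    have ha : 0 < Fintype.card {x // π.SameCycle a x} :=
      Fintype.card_pos_iff.2 ⟨⟨a, Perm.SameCycle.refl _ _⟩⟩
    have hprod : charFun π₁ * charFun π₂ =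
        ∑ s : Setoid ({x // π.SameCycle a x} ⊕ {x // ¬ π.SameCycle a x}),
        if (Function.Injective fun b => Quotient.mk s (Sum.inl b)) ∧
          (Function.Injective fun b => Quotient.mk s (Sum.inr b)) then
        charFun (gluedPerm π₁ π₂ s) else 0 := by
      ext μ
      rw [Finset.sum_apply, Pi.mul_apply]
      refine ((isShape_cells μ).embChar_mul_embChar π₁ π₂).trans (sum_congr rfl fun s _ => ?_)
      split_ifs <;> rfl
    rw [← add_sum_erase _ _ (mem_univ ⊥), gluedPerm_bot, charFun_permCongr, if_pos
      ⟨(quotientBotEquiv _).injective.comp Sum.inl_injective,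
        (quotientBotEquiv _).injective.comp Sum.inr_injective⟩, ← charFun_permCongr (sumCompl _),
      permCongr_sumCompl_subtypePerm, ← sub_eq_iff_eq_add] at hprod
    rw [← hprod]
    refine sub_mem (mul_mem (contentAlgebra_mono (by omega) (ih _ (by omega) _ rfl π₁))
      (contentAlgebra_mono (by omega) (ih _ (by omega) _ rfl π₂))) (sum_mem fun s hs => ?_)
    split_ifs
    · have hlt := (card_quotient_lt (ne_of_mem_erase hs)).trans_eq hcard
      exact contentAlgebra_mono hlt.le (ih _ hlt _ rfl _)
    · exact zero_mem _

theorem charFun_sub_mem {m : ℕ} {A : Type} [Fintype A] [DecidableEq A]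
    (hA : Fintype.card A = m + 1) (π : Perm A) (hπ : ∀ a b, π.SameCycle a b) :
    charFun π - ((m + 1 : ℕ) : ℚ) • (fun μ => contentSum μ m) ∈ contentAlgebra m :=
  charFun_sub_mem_of_transitive (fun B _ _ _ π => charFun_mem _ B rfl π) hA π hπ

end CharAlgebra

section Dilation

theorem exists_powerSum_polynomial (p : ℕ) :
    ∃ f : Polynomial ℚ, ∀ n : ℕ, f.eval (n : ℚ) = ∑ k ∈ range n, (k : ℚ) ^ p :=
  ⟨∑ i ∈ range (p + 1), Polynomial.C (bernoulli i * ((p + 1).choose i) / (p + 1)) *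
      Polynomial.X ^ (p + 1 - i), fun n => by
    rw [sum_range_pow, Polynomial.eval_finsetSum]
    refine sum_congr rfl fun i _ => ?_
    rw [Polynomial.eval_mul, Polynomial.eval_C, Polynomial.eval_pow, Polynomial.eval_X]
    ring⟩

theorem exists_sum_sub_pow_polynomial (k : ℕ) : ∃ f : Polynomial ℚ, ∀ n : ℕ,
    f.eval (n : ℚ) = ∑ a ∈ range n, ∑ b ∈ range n, ((b : ℚ) - a) ^ k := by
  choose f hf using exists_powerSum_polynomial
  refine ⟨∑ i ∈ range (k + 1), Polynomial.C ((k.choose i : ℚ) * (-1) ^ (k - i)) * (f i * f (k - i)),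
    fun n => ?_⟩
  have h1 : ∀ a b : ℕ, ((b : ℚ) - a) ^ k = ∑ i ∈ range (k + 1),
      ((k.choose i : ℚ) * (-1) ^ (k - i)) * ((b : ℚ) ^ i * (a : ℚ) ^ (k - i)) := by
    intro a b
    rw [sub_eq_add_neg, add_pow]
    refine sum_congr rfl fun i _ => ?_
    rw [neg_pow]
    ring
  calc _ = ∑ i ∈ range (k + 1), ∑ a ∈ range n, ∑ b ∈ range n,
        ((k.choose i : ℚ) * (-1) ^ (k - i)) * ((b : ℚ) ^ i * (a : ℚ) ^ (k - i)) := by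
        rw [Polynomial.eval_finsetSum]
        refine sum_congr rfl fun i _ => ?_
        rw [Polynomial.eval_mul, Polynomial.eval_C, Polynomial.eval_mul, hf, hf, mul_comm (∑ k ∈ _, _),
          sum_mul_sum, mul_sum]
        refine sum_congr rfl fun a _ => ?_
        rw [mul_sum]
        exact sum_congr rfl fun b _ => by rw [mul_comm ((a : ℚ) ^ _)]
    _ = _ := by
        rw [sum_comm]
        refine sum_congr rfl fun a _ => ?_
        rw [sum_comm]
        exact sum_congr rfl fun b _ => (h1 a b).symm

theorem sum_dilate (μ : YoungDiagram) {s : ℕ} (hs : 0 < s) (f : ℕ × ℕ → ℚ) :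
    ∑ x ∈ (dilate μ s).cells, f x =
      ∑ y ∈ μ.cells, ∑ a ∈ range s, ∑ b ∈ range s, f (s * y.1 + a, s * y.2 + b) := by
  simp only [← sum_product']
  refine sum_bij' (fun x _ => ((x.1 / s, x.2 / s), (x.1 % s, x.2 % s)))
    (fun z _ => (s * z.1.1 + z.2.1, s * z.1.2 + z.2.2)) ?_ ?_ ?_ ?_ ?_
  · rintro ⟨r, c⟩ h
    rw [YoungDiagram.mem_cells, mem_dilate hs] at h
    simp [h, Nat.mod_lt _ hs]
  · rintro ⟨⟨r, c⟩, a, b⟩ h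
    simp only [mem_product, mem_range, YoungDiagram.mem_cells] at h
    rw [YoungDiagram.mem_cells, mem_dilate hs, Nat.mul_add_div hs, Nat.mul_add_div hs,
      Nat.div_eq_of_lt h.2.1, Nat.div_eq_of_lt h.2.2]
    exact h.1
  · rintro ⟨r, c⟩ _
    simp [Nat.div_add_mod]
  · rintro ⟨⟨r, c⟩, a, b⟩ h
    simp only [mem_product, mem_range, YoungDiagram.mem_cells] at h
    simp [Nat.mul_add_div hs, Nat.div_eq_of_lt h.2.1, Nat.div_eq_of_lt h.2.2,
      Nat.mod_eq_of_lt h.2.1, Nat.mod_eq_of_lt h.2.2]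
  · rintro ⟨r, c⟩ _
    simp [Nat.div_add_mod]

theorem contentSum_dilate (μ : YoungDiagram) {s : ℕ} (hs : 0 < s) (m : ℕ) :
    contentSum (dilate μ s) m = ∑ j ∈ range (m + 1), (m.choose j : ℚ) * ((s : ℚ) ^ j *
      (contentSum μ j * ∑ a ∈ range s, ∑ b ∈ range s, ((b : ℚ) - a) ^ (m - j))) := by
  have h : ∀ y : ℕ × ℕ, ∀ a b : ℕ, (((s * y.2 + b : ℕ) : ℚ) - (s * y.1 + a : ℕ)) ^ m =
      ∑ j ∈ range (m + 1), (m.choose j : ℚ) * ((s : ℚ) ^ j *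
        (((y.2 : ℚ) - y.1) ^ j * ((b : ℚ) - a) ^ (m - j))) := by
    intro y a b
    rw [show ((s * y.2 + b : ℕ) : ℚ) - (s * y.1 + a : ℕ) = s * ((y.2 : ℚ) - y.1) + (b - a) by
      push_cast; ring, add_pow]
    refine sum_congr rfl fun j _ => ?_
    rw [mul_pow]
    ring
  calc _ = ∑ y ∈ μ.cells, ∑ a ∈ range s, ∑ b ∈ range s, ∑ j ∈ range (m + 1),
        (m.choose j : ℚ) * ((s : ℚ) ^ j * (((y.2 : ℚ) - y.1) ^ j * ((b : ℚ) - a) ^ (m - j))) := by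
        rw [contentSum, sum_dilate μ hs]
        simp only [h]
    _ = ∑ y ∈ μ.cells, ∑ j ∈ range (m + 1), ∑ a ∈ range s, ∑ b ∈ range s,
        (m.choose j : ℚ) * ((s : ℚ) ^ j * (((y.2 : ℚ) - y.1) ^ j * ((b : ℚ) - a) ^ (m - j))) := by
        exact sum_congr rfl fun y _ => (sum_congr rfl fun a _ => sum_comm).trans sum_comm
    _ = _ := by
        rw [sum_comm]
        refine sum_congr rfl fun j _ => ?_
        simp only [← mul_sum, ← sum_mul]
        rfl

/-- `F (dilate μ s)` is polynomial in `s` with coefficients in `contentAlgebra N`, given by `P`. -/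
structure IsDilation (N : ℕ) (F : YoungDiagram → ℚ) (P : Polynomial (YoungDiagram → ℚ)) : Prop where
  eval : ∀ s : ℕ, 0 < s → ∀ μ, F (dilate μ s) = P.eval (s : YoungDiagram → ℚ) μ
  coeff_mem : ∀ d, P.coeff d ∈ contentAlgebra N

theorem IsDilation.mono {M N : ℕ} (h : M ≤ N) {F : YoungDiagram → ℚ}
    {P : Polynomial (YoungDiagram → ℚ)} (hP : IsDilation M F P) : IsDilation N F P :=
  ⟨hP.eval, fun d => contentAlgebra_mono h (hP.coeff_mem d)⟩

theorem map_algebraMap_coeff_mem (N : ℕ) (f : Polynomial ℚ) (d : ℕ) :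
    (f.map (algebraMap ℚ (YoungDiagram → ℚ))).coeff d ∈ contentAlgebra N := by
  rw [Polynomial.coeff_map]
  exact Subalgebra.algebraMap_mem _ _

theorem coeff_mul_mem {R A : Type*} [CommSemiring R] [CommSemiring A] [Algebra R A]
    (S : Subalgebra R A) {P Q : Polynomial A} (hP : ∀ d, P.coeff d ∈ S) (hQ : ∀ d, Q.coeff d ∈ S)
    (d : ℕ) : (P * Q).coeff d ∈ S := by
  rw [Polynomial.coeff_mul]
  exact sum_mem fun _ _ => mul_mem (hP _) (hQ _)

theorem contentSum_isDilation (m : ℕ) : ∃ Q : Polynomial (YoungDiagram → ℚ),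
    (∀ d, Q.coeff d ∈ contentAlgebra m) ∧ ∀ s : ℕ, 0 < s → ∀ μ, contentSum (dilate μ s) m =
      (Polynomial.monomial (m + 2) (fun μ => contentSum μ m) + Q).eval (s : YoungDiagram → ℚ) μ := by
  choose e he using exists_sum_sub_pow_polynomial
  refine ⟨∑ j ∈ range m, Polynomial.monomial j ((m.choose j : ℚ) • fun μ => contentSum μ j) *
    (e (m - j)).map (algebraMap ℚ (YoungDiagram → ℚ)), fun d => ?_, fun s hs μ => ?_⟩
  · rw [Polynomial.finsetSum_coeff]
    refine sum_mem fun j hj => coeff_mul_mem _ (fun d => ?_) (map_algebraMap_coeff_mem _ _) d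
    rw [Polynomial.coeff_monomial]
    split_ifs
    · exact Subalgebra.smul_mem _ (contentSum_mem (mem_range.1 hj)) _
    · exact zero_mem _
  · have hev : ∀ f : Polynomial ℚ, (f.map (algebraMap ℚ (YoungDiagram → ℚ))).eval
        (s : YoungDiagram → ℚ) μ = f.eval (s : ℚ) := by
      intro f
      have h1 := Polynomial.eval_natCast_map (algebraMap ℚ (YoungDiagram → ℚ)) f s
      rw [h1]
      rfl
    rw [contentSum_dilate μ hs, sum_range_succ, Polynomial.eval_add, add_comm, Pi.add_apply,
      Polynomial.eval_finsetSum, Finset.sum_apply]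
    congr 1
    · simp [Polynomial.eval_monomial]
      ring
    · refine sum_congr rfl fun j _ => ?_
      rw [Polynomial.eval_mul, Pi.mul_apply, hev, he, Polynomial.eval_monomial]
      simp only [Pi.mul_apply, Pi.smul_apply, Pi.pow_apply, Pi.natCast_apply, smul_eq_mul]
      ring

theorem exists_isDilation {N : ℕ} {F : YoungDiagram → ℚ} (hF : F ∈ contentAlgebra N) :
    ∃ P, IsDilation N F P := by
  induction hF using Algebra.adjoin_induction with
  | mem F hF =>
    obtain ⟨j, hj, rfl⟩ := hF
    obtain ⟨Q, hQ, h⟩ := contentSum_isDilation j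
    refine ⟨_, h, fun d => ?_⟩
    rw [Polynomial.coeff_add, Polynomial.coeff_monomial]
    refine add_mem ?_ (contentAlgebra_mono hj.le (hQ d))
    split_ifs
    · exact contentSum_mem hj
    · exact zero_mem _
  | algebraMap x =>
    refine ⟨Polynomial.C (algebraMap ℚ _ x), fun s _ μ => by rw [Polynomial.eval_C]; rfl, fun d => ?_⟩
    rw [Polynomial.coeff_C]
    split_ifs
    · exact Subalgebra.algebraMap_mem _ _
    · exact zero_mem _
  | add F G _ _ ihF ihG =>
    obtain ⟨P, hP⟩ := ihF
    obtain ⟨Q, hQ⟩ := ihG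
    refine ⟨P + Q, fun s hs μ => ?_, fun d => ?_⟩
    · rw [Polynomial.eval_add, Pi.add_apply, Pi.add_apply, hP.eval s hs, hQ.eval s hs]
    · rw [Polynomial.coeff_add]
      exact add_mem (hP.coeff_mem d) (hQ.coeff_mem d)
  | mul F G _ _ ihF ihG =>
    obtain ⟨P, hP⟩ := ihF
    obtain ⟨Q, hQ⟩ := ihG
    refine ⟨P * Q, fun s hs μ => ?_, coeff_mul_mem _ hP.coeff_mem hQ.coeff_mem⟩
    rw [Polynomial.eval_mul, Pi.mul_apply, Pi.mul_apply, hP.eval s hs, hQ.eval s hs]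

theorem sameCycle_finRotate {k : ℕ} (a b : Fin k) : (finRotate k).SameCycle a b := by
  rcases k with _ | _ | k
  · exact a.elim0
  · obtain rfl : a = b := Fin.ext (by omega)
    exact Perm.SameCycle.refl _ _
  · have hm : ∀ x, finRotate (k + 2) x ≠ x := fun x => by
      have := Finset.mem_univ x
      rwa [← support_finRotate, Perm.mem_support] at this
    exact isCycle_finRotate.sameCycle (hm a) (hm b)

theorem freeCumulant_sub_mem (m : ℕ) :
    (fun μ => freeCumulant μ (m + 2)) - ((m + 1 : ℕ) : ℚ) • (fun μ => contentSum μ m) ∈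
      contentAlgebra m := by
  set G := charFun (finRotate (m + 1)) - ((m + 1 : ℕ) : ℚ) • (fun μ => contentSum μ m) with hG
  have hGm : G ∈ contentAlgebra m := charFun_sub_mem (by simp) _ sameCycle_finRotate
  obtain ⟨P, hP⟩ := exists_isDilation hGm
  obtain ⟨Q, hQ, hT⟩ := contentSum_isDilation m
  set R : Polynomial (YoungDiagram → ℚ) := ((m + 1 : ℕ) : ℚ) •
    (Polynomial.monomial (m + 2) (fun μ => contentSum μ m) + Q) + P with hR
  have hev : ∀ s : ℕ, 0 < s → ∀ μ, charFun (finRotate (m + 1)) (dilate μ s) =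
      R.eval (s : YoungDiagram → ℚ) μ := by
    intro s hs μ
    rw [hR, Polynomial.eval_add, Polynomial.eval_smul, Pi.add_apply, Pi.smul_apply, ← hT s hs,
      ← hP.eval s hs, hG]
    simp
  have hfc : (fun μ => freeCumulant μ (m + 2)) = R.coeff (m + 2) := by
    ext μ
    rw [freeCumulant_eq_coeff μ (m + 2) (R.map (Pi.evalRingHom _ μ)) fun s hs => ?_,
      Polynomial.coeff_map]
    · rfl
    · rw [Polynomial.eval_natCast_map, SigmaCycle, normChar_eq_diagChar]
      exact hev s hs μ
  rw [hfc, hR, Polynomial.coeff_add, Polynomial.coeff_smul, Polynomial.coeff_add,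
    Polynomial.coeff_monomial_same, smul_add, add_assoc, add_sub_cancel_left]
  exact add_mem (Subalgebra.smul_mem _ (hQ _) _) (hP.coeff_mem _)

theorem contentAlgebra_le_adjoin_freeCumulant (N : ℕ) : contentAlgebra N ≤
    Algebra.adjoin ℚ (Set.range fun (i : ℕ) (μ : YoungDiagram) => freeCumulant μ (i + 2)) := by
  induction N using Nat.strong_induction_on with
  | _ N ih =>
  refine Algebra.adjoin_le ?_
  rintro _ ⟨j, hj, rfl⟩
  have h1 := ih j hj (freeCumulant_sub_mem j)
  have h2 := sub_mem (Algebra.subset_adjoin (R := ℚ) (Set.mem_range_self j)) h1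
  rw [sub_sub_cancel] at h2
  have h3 := Subalgebra.smul_mem _ h2 ((j + 1 : ℕ) : ℚ)⁻¹
  rwa [smul_smul, inv_mul_cancel₀ (by positivity), one_smul] at h3

/-- Normalized characters are polynomials in the free cumulants. -/
theorem exists_rational_kerov_polynomial (k : ℕ) : ∃ K : MvPolynomial ℕ ℚ,
    ∀ μ, SigmaCycle μ k = MvPolynomial.aeval (fun i => freeCumulant μ (i + 2)) K := by
  have h1 := contentAlgebra_le_adjoin_freeCumulant k
    (charFun_mem k (Fin k) (Fintype.card_fin k) (finRotate k))
  rw [Algebra.adjoin_range_eq_range_aeval] at h1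
  obtain ⟨K, hK⟩ := h1
  refine ⟨K, fun μ => ?_⟩
  rw [SigmaCycle, normChar_eq_diagChar]
  have h2 := congrFun hK μ
  change charFun _ μ = _
  rw [← h2]
  change Pi.evalAlgHom ℚ (fun _ : YoungDiagram => ℚ) μ (MvPolynomial.aeval _ K) = _
  rw [MvPolynomial.comp_aeval_apply]
  rfl

end Dilation

section Chains
variable {V : Type*} [Fintype V] [DecidableEq V]

/-- The number of chains `A = B₀ ⊂ B₁ ⊂ ⋯ ⊂ Bₛ = univ` such that `f` is nonnegative at
`B₀, …, Bₛ₋₁`. -/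
def chainCount (f : Finset V → ℤ) : ℕ → Finset V → ℤ
  | 0, A => if A = univ then 1 else 0
  | s + 1, A => if 0 ≤ f A then ∑ B with A ⊂ B, chainCount f s B else 0

/-- The number of chains from `A` to `univ`, counted with sign according to their length. -/
def chainSum (f : Finset V → ℤ) (A : Finset V) : ℤ :=
  ∑ s ∈ range (Fintype.card V + 1), (-1) ^ s * chainCount f s A

theorem chainCount_eq_zero (f : Finset V → ℤ) {s : ℕ} {A : Finset V}
    (h : Fintype.card V < #A + s) : chainCount f s A = 0 := by
  induction s generalizing A with
  | zero => exact absurd (card_le_univ A) (by omega)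
  | succ s ih =>
    rw [chainCount]
    split_ifs
    · refine sum_eq_zero fun B hB => ih ?_
      have := card_lt_card (mem_filter.1 hB).2
      omega
    · rfl

theorem chainSum_univ (f : Finset V → ℤ) : chainSum f univ = 1 := by
  rw [chainSum, sum_range_succ', sum_eq_zero]
  · simp [chainCount]
  · intro s _
    rw [chainCount_eq_zero, mul_zero]
    rw [card_univ]
    omega

theorem chainSum_of_ne (f : Finset V → ℤ) {A : Finset V} (hA : A ≠ univ) :
    chainSum f A = if 0 ≤ f A then -∑ B with A ⊂ B, chainSum f B else 0 := by
  rw [chainSum, sum_range_succ']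
  simp only [chainCount, if_neg hA, mul_zero, add_zero]
  split_ifs
  · have h : ∀ B ∈ (univ.filter (A ⊂ ·) : Finset (Finset V)),
        chainSum f B = ∑ s ∈ range (Fintype.card V), (-1) ^ s * chainCount f s B := by
      intro B hB
      rw [chainSum, sum_range_succ, chainCount_eq_zero, mul_zero, add_zero]
      have := card_lt_card (mem_filter.1 hB).2
      omega
    rw [sum_congr rfl h, sum_comm, ← sum_neg_distrib]
    refine sum_congr rfl fun s _ => ?_
    rw [← mul_sum, pow_succ]
    ring
  · simp

theorem chainSum_eq_zero_of_neg (f : Finset V → ℤ) {A : Finset V} (hA : A ≠ univ) (h : f A < 0) :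
    chainSum f A = 0 := by
  rw [chainSum_of_ne f hA, if_neg (by omega)]

theorem sum_chainSum_superset (f : Finset V → ℤ) {A : Finset V} (hA : A ≠ univ) (h : 0 ≤ f A) :
    ∑ B with A ⊆ B, chainSum f B = 0 := by
  have h1 : ({B | A ⊆ B} : Finset (Finset V)) = insert A ({B | A ⊂ B} : Finset (Finset V)) := by
    ext B
    simp only [mem_filter, mem_univ, true_and, mem_insert]
    rw [subset_iff_ssubset_or_eq, or_comm, eq_comm]
  rw [h1, sum_insert (by simp), chainSum_of_ne f hA, if_pos h, neg_add_cancel]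

theorem chainSum_eq_neg_one [Nonempty V] (f : Finset V → ℤ) (h0 : f ∅ = 0)
    (h : ∀ A, A.Nonempty → A ≠ univ → f A < 0) : chainSum f ∅ = -1 := by
  rw [chainSum_of_ne f univ_nonempty.ne_empty.symm, if_pos h0.ge, sum_eq_single univ]
  · rw [chainSum_univ]
  · intro B hB hB'
    exact chainSum_eq_zero_of_neg f hB' (h B (empty_ssubset.1 (mem_filter.1 hB).2) hB')
  · intro h
    exact absurd (mem_filter.2 ⟨mem_univ _, empty_ssubset.2 univ_nonempty⟩) h

/-- The sum of the values of `chainSum f` at the sets obtained from `A` by adding elements outside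
of `A₀`. -/
def chainSumAway (f : Finset V → ℤ) (A₀ A : Finset V) : ℤ :=
  ∑ B with A ⊆ B ∧ B ⊆ A ∪ A₀ᶜ, chainSum f B

theorem sum_chainSumAway (f : Finset V → ℤ) (A₀ A : Finset V) :
    ∑ C with A ⊆ C ∧ C ⊆ A ∪ A₀, chainSumAway f A₀ C = ∑ B with A ⊆ B, chainSum f B := by
  unfold chainSumAway
  rw [sum_comm' (t' := {B | A ⊆ B}) (s' := fun B => {A ∪ (B ∩ A₀)})]
  · simp
  · intro C B
    simp only [mem_filter, mem_univ, true_and, mem_singleton]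
    constructor
    · rintro ⟨⟨h1, h2⟩, h3, h4⟩
      refine ⟨?_, h1.trans h3⟩
      ext x
      have := @h1 x; have := @h2 x; have := @h3 x; have := @h4 x
      simp only [mem_union, mem_inter, mem_compl] at *
      tauto
    · rintro ⟨rfl, h⟩
      refine ⟨⟨subset_union_left, union_subset_union_right inter_subset_right⟩,
        union_subset h inter_subset_left, fun x hx => ?_⟩
      simp only [mem_union, mem_inter, mem_compl]
      tauto

theorem sum_neg_one_pow_card_sdiff {A B : Finset V} (h : A ⊆ B) :
    ∑ C with A ⊆ C ∧ C ⊆ B, (-1 : ℤ) ^ #(C \ A) = if A = B then 1 else 0 := by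
  have h1 : ∑ C with A ⊆ C ∧ C ⊆ B, (-1 : ℤ) ^ #(C \ A) =
      ∑ T ∈ (B \ A).powerset, (-1 : ℤ) ^ #T := by
    refine sum_nbij' (fun C => C \ A) (fun T => A ∪ T) ?_ ?_ ?_ ?_ ?_
    · intro C hC
      simp only [mem_filter, mem_univ, true_and] at hC
      exact mem_powerset.2 (sdiff_subset_sdiff hC.2 le_rfl)
    · intro T hT
      rw [mem_powerset] at hT
      simp only [mem_filter, mem_univ, true_and]
      exact ⟨subset_union_left, union_subset h (hT.trans sdiff_subset)⟩
    · intro C hC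
      simp only [mem_filter, mem_univ, true_and] at hC
      exact union_sdiff_of_subset hC.1
    · intro T hT
      rw [mem_powerset] at hT
      exact union_sdiff_cancel_left (disjoint_sdiff.mono_right hT)
    · intro C _
      rfl
  rw [h1, sum_powerset_neg_one_pow_card]
  refine if_congr ?_ rfl rfl
  rw [sdiff_eq_empty_iff_subset]
  exact ⟨fun h' => h.antisymm h', fun h' => h'.ge⟩

theorem sum_neg_one_pow_mul_chainSumAway (f : Finset V → ℤ) (A₀ A : Finset V) :
    ∑ C with A ⊆ C ∧ C ⊆ A ∪ A₀ᶜ, (-1) ^ #(C \ A) * chainSumAway f A₀ C = chainSum f A := by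
  simp only [chainSumAway, mul_sum]
  rw [sum_comm' (t' := {B | A ⊆ B ∧ B ⊆ A ∪ A₀ᶜ}) (s' := fun B => {C | A ⊆ C ∧ C ⊆ B})]
  · rw [sum_eq_single A]
    · rw [← sum_mul, sum_neg_one_pow_card_sdiff le_rfl, if_pos rfl, one_mul]
    · intro B hB hne
      rw [← sum_mul, sum_neg_one_pow_card_sdiff (mem_filter.1 hB).2.1, if_neg hne.symm, zero_mul]
    · intro h
      exact absurd (mem_filter.2 ⟨mem_univ _, le_rfl, subset_union_left⟩) h
  · intro C B
    simp only [mem_filter, mem_univ, true_and]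
    constructor
    · rintro ⟨⟨h1, h2⟩, h3, h4⟩
      exact ⟨⟨h1, h3⟩, h1.trans h3, h4.trans (union_subset h2 subset_union_right)⟩
    · rintro ⟨⟨h1, h3⟩, h2, h4⟩
      exact ⟨⟨h1, h3.trans h4⟩, h3, h4.trans (union_subset_union_left h1)⟩

/-- The condition on `B` that is forced by the nonvanishing of `chainSumAway f A₀ B`. -/
theorem chainSumAway_ne_zero {f : Finset V → ℤ}
    (hsup : ∀ A B, f A + f B ≤ f (A ∪ B) + f (A ∩ B)) (h1 : f univ = 0)
    (A₀ B : Finset V) (hB : chainSumAway f A₀ B ≠ 0) :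
    (0 ≤ f B → f A₀ - f (B ∩ A₀) + f B < 0 ∨ f A₀ - f (B ∩ A₀) + f B ≤ 0 ∧ A₀ᶜ ⊆ B) ∧
    (f B < 0 → f A₀ - f (B ∩ A₀) < 0 ∨ f A₀ - f (B ∩ A₀) ≤ 0 ∧ 0 ≤ f (B ∪ A₀ᶜ)) := by
  induction hn : #Bᶜ using Nat.strong_induction_on generalizing B with
  | _ n ih =>
  subst hn
  by_cases hBu : B = univ
  · subst hBu
    simp [h1]
  have hlt : ∀ C, B ⊆ C → C ≠ B → #Cᶜ < #Bᶜ := fun C h h' =>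
    card_lt_card (compl_ssubset_compl.2 (ssubset_of_subset_of_ne h h'.symm))
  rcases le_or_gt 0 (f B) with hf | hf
  · refine ⟨fun _ => ?_, fun h => absurd h (by omega)⟩
    have h2 : ∃ C, B ⊆ C ∧ C ⊆ B ∪ A₀ ∧ C ≠ B ∧ chainSumAway f A₀ C ≠ 0 := by
      by_contra! hcon
      have h3 := sum_chainSumAway f A₀ B
      rw [sum_chainSum_superset f hBu hf, sum_eq_single B] at h3
      · exact hB h3
      · intro C hC hne
        simp only [mem_filter, mem_univ, true_and] at hC
        exact hcon C hC.1 hC.2 hne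
      · intro h
        exact absurd (mem_filter.2 ⟨mem_univ _, le_rfl, subset_union_left⟩) h
    obtain ⟨C, hBC, hCB, hne, hC⟩ := h2
    have h4 := ih _ (hlt C hBC hne) C hC rfl
    have h5 := hsup B (C ∩ A₀)
    have h6 : B ∪ C ∩ A₀ = C := by
      ext x
      have := @hBC x; have := @hCB x
      simp only [mem_union, mem_inter] at *
      tauto
    have h7 : B ∩ (C ∩ A₀) = B ∩ A₀ := by
      rw [← inter_assoc, inter_eq_left.2 hBC]
    rw [h6, h7] at h5
    rcases le_or_gt 0 (f C) with hfC | hfC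
    · rcases h4.1 hfC with h | ⟨h, h'⟩
      · left; omega
      · right
        refine ⟨by omega, fun x hx => ?_⟩
        have := hCB (h' hx)
        rw [mem_union] at this
        exact this.resolve_right (mem_compl.1 hx)
    · rcases h4.2 hfC with h | ⟨h, h'⟩ <;> (left; omega)
  · refine ⟨fun h => absurd h (by omega), fun _ => ?_⟩
    have h2 : ∃ C, B ⊆ C ∧ C ⊆ B ∪ A₀ᶜ ∧ C ≠ B ∧ chainSumAway f A₀ C ≠ 0 := by
      by_contra! hcon
      have h3 := sum_neg_one_pow_mul_chainSumAway f A₀ B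
      rw [chainSum_eq_zero_of_neg f hBu hf, sum_eq_single B] at h3
      · exact hB (by simpa using h3)
      · intro C hC hne
        simp only [mem_filter, mem_univ, true_and] at hC
        rw [hcon C hC.1 hC.2 hne, mul_zero]
      · intro h
        exact absurd (mem_filter.2 ⟨mem_univ _, le_rfl, subset_union_left⟩) h
    obtain ⟨C, hBC, hCB, hne, hC⟩ := h2
    have h4 := ih _ (hlt C hBC hne) C hC rfl
    have h6 : C ∩ A₀ = B ∩ A₀ := by
      ext x
      have := @hBC x; have := @hCB x
      simp only [mem_union, mem_inter, mem_compl] at *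
      tauto
    have h7 : C ∪ A₀ᶜ = B ∪ A₀ᶜ :=
      (union_subset hCB subset_union_right).antisymm (union_subset_union_left hBC)
    rw [h6, h7] at h4
    rcases le_or_gt 0 (f C) with hfC | hfC
    · rcases h4.1 hfC with h | ⟨h, h'⟩
      · left; omega
      · right
        rw [← h7, union_eq_left.2 h']
        exact ⟨by omega, hfC⟩
    · exact h4.2 hfC

theorem chainSum_empty_eq_zero {f : Finset V → ℤ}
    (hsup : ∀ A B, f A + f B ≤ f (A ∪ B) + f (A ∩ B)) (h0 : f ∅ = 0) (h1 : f univ = 0)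
    {A₀ : Finset V} (hA : 0 < f A₀ ∨ f A₀ = 0 ∧ f A₀ᶜ < 0) : chainSum f ∅ = 0 := by
  rw [← sum_neg_one_pow_mul_chainSumAway f A₀]
  refine sum_eq_zero fun B hB => ?_
  simp only [mem_filter, mem_univ, true_and, empty_union] at hB
  rw [mul_eq_zero]
  right
  by_contra hne
  have h2 := chainSumAway_ne_zero hsup h1 A₀ B hne
  have h3 : B ∩ A₀ = ∅ := disjoint_iff_inter_eq_empty.1 (subset_compl_iff_disjoint_right.1 hB.2)
  have h4 : B ∪ A₀ᶜ = A₀ᶜ := union_eq_right.2 hB.2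
  rw [h3, h4, h0] at h2
  rcases le_or_gt 0 (f B) with hf | hf
  · rcases h2.1 hf with h | ⟨h, h'⟩
    · omega
    · rw [hB.2.antisymm h'] at h hf
      omega
  · rcases h2.2 hf with h | ⟨h, h'⟩ <;> omega

end Chains

section ChainFunctions
variable {V : Type*} [Fintype V] [DecidableEq V]

/-- `τ` is the rank function of a chain counted by `chainCount f s A`. -/
def IsChainRank (f : Finset V → ℤ) (s : ℕ) (A : Finset V) (τ : V → ℕ) : Prop :=
  ({v | τ v = 0} : Finset V) = A ∧ (∀ t, 1 ≤ t → t ≤ s → ∃ v, τ v = t) ∧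
    ∀ t < s, 0 ≤ f {v | τ v ≤ t}

open scoped Classical in
theorem chainCount_eq_card (f : Finset V → ℤ) (s : ℕ) (A : Finset V) :
    chainCount f s A =
      #{τ ∈ Fintype.piFinset fun _ : V => range (s + 1) | IsChainRank f s A τ} := by
  induction s generalizing A with
  | zero =>
    have h0 : (Fintype.piFinset fun _ : V => range (0 + 1)) = {fun _ => 0} := by
      ext τ
      simp [funext_iff]
    rw [h0, filter_singleton, chainCount]
    have : IsChainRank f 0 A (fun _ => 0) ↔ A = univ := by
      simp only [IsChainRank, filter_true, Nat.not_lt_zero, false_imp_iff, implies_true, and_true]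
      constructor
      · rintro ⟨h, -⟩; exact h.symm
      · rintro rfl; exact ⟨rfl, fun t h1 h2 => by omega⟩
    rw [if_congr this.symm rfl rfl]
    split_ifs <;> simp
  | succ s ih =>
    rw [chainCount]
    split_ifs with hA
    · rw [sum_congr rfl fun B _ => ih B, ← Nat.cast_sum]
      congr 1
      symm
      rw [card_eq_sum_card_fiberwise (f := fun τ : V → ℕ => ({v | τ v ≤ 1} : Finset V))
        (t := {B | A ⊂ B})]
      · refine sum_congr rfl fun B hB => ?_
        rw [mem_filter] at hB
        refine card_bij' (fun τ _ v => τ v - 1) (fun τ _ v => if v ∈ A then 0 else τ v + 1)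
          ?_ ?_ ?_ ?_
        · intro τ hτ
          simp only [mem_filter, Fintype.mem_piFinset, mem_range] at hτ ⊢
          obtain ⟨⟨h1, h2, h3, h4⟩, h5⟩ := hτ
          refine ⟨fun v => by have := h1 v; omega, ?_, fun t ht hts => ?_, fun t ht => ?_⟩
          · rw [← h5]
            exact filter_congr fun v _ => by beta_reduce; omega
          · obtain ⟨v, hv⟩ := h3 (t + 1) (by omega) (by omega)
            exact ⟨v, by beta_reduce; omega⟩
          · have := h4 (t + 1) (by omega)
            convert this using 2
            exact filter_congr fun v _ => by beta_reduce; omega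
        · intro τ hτ
          simp only [mem_filter, Fintype.mem_piFinset, mem_range] at hτ ⊢
          obtain ⟨h1, h2, h3, h4⟩ := hτ
          have hAB : ∀ v ∈ A, τ v = 0 := fun v hv => by
            have := hB.2.1 hv
            rw [← h2] at this
            exact (mem_filter.1 this).2
          refine ⟨⟨fun v => ?_, ?_, fun t ht hts => ?_, fun t ht => ?_⟩, ?_⟩
          · have := h1 v
            split_ifs <;> omega
          · ext v
            simp
          · obtain rfl | ht' := ht.eq_or_lt
            · obtain ⟨v, hv, hv'⟩ := exists_of_ssubset hB.2
              rw [← h2] at hv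
              exact ⟨v, by beta_reduce; rw [if_neg hv', (mem_filter.1 hv).2]⟩
            · obtain ⟨v, hv⟩ := h3 (t - 1) (by omega) (by omega)
              refine ⟨v, ?_⟩
              beta_reduce
              rw [if_neg (fun h => by have := hAB v h; omega)]
              omega
          · cases t with
            | zero =>
              convert hA using 2
              ext v
              simp
            | succ t =>
              convert h4 t (by omega) using 2
              refine filter_congr fun v _ => ?_
              beta_reduce
              split_ifs with hv
              · have := hAB v hv; omega
              · omega
          · rw [← h2]
            refine filter_congr fun v _ => ?_
            split_ifs with hv
            · have := hAB v hv; omega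
            · omega
        · intro τ hτ
          simp only [mem_filter] at hτ
          obtain ⟨⟨-, h2, -, -⟩, -⟩ := hτ
          funext v
          have : v ∈ A ↔ τ v = 0 := by rw [← h2]; simp
          simp only [this]
          split_ifs <;> omega
        · intro τ hτ
          simp only [mem_filter] at hτ
          obtain ⟨-, h2, -, -⟩ := hτ
          funext v
          show (if v ∈ A then 0 else τ v + 1) - 1 = τ v
          split_ifs with hv
          · have := hB.2.1 hv
            rw [← h2] at this
            rw [(mem_filter.1 this).2]
          · omega
      · intro τ hτ
        rw [mem_coe, mem_filter] at hτ ⊢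
        obtain ⟨-, h2, h3, -⟩ := hτ
        refine ⟨mem_univ _, ?_⟩
        rw [← h2]
        obtain ⟨v, hv⟩ := h3 1 le_rfl (by omega)
        refine (ssubset_iff_of_subset fun x hx => ?_).2 ⟨v, by simp [hv], by simp [hv]⟩
        simp only [mem_filter, mem_univ, true_and] at hx ⊢
        omega
    · symm
      rw [Nat.cast_eq_zero, card_eq_zero, filter_eq_empty_iff]
      rintro τ - ⟨h2, -, h4⟩
      apply hA
      have := h4 0 (by omega)
      convert this using 2
      rw [← h2]
      exact filter_congr fun v _ => by omega

end ChainFunctions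

section Weight
variable {E V W : Type*} [Fintype E] [DecidableEq E] [Fintype V] [DecidableEq V] [Fintype W]
  [DecidableEq W]

/-- The excess of a set `A` of white vertices, marked by `d`: the number of black vertices whose
neighbours are all in `A`, minus the sum of `d + 1` over `A`. -/
def excess (u : E → V) (w : E → W) (d : V → ℕ) (A : Finset V) : ℤ :=
  #{b | ∀ e, w e = b → u e ∈ A} - ∑ v ∈ A, ((d v : ℤ) + 1)

/-- A strict upper bound for the support. -/
def width (D : ℕ →₀ ℕ) : ℕ := D.support.sup id + 1

theorem width_pos (D : ℕ →₀ ℕ) : 0 < width D := Nat.succ_pos _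

theorem apply_eq_zero_of_width_le {D : ℕ →₀ ℕ} {e : ℕ} (h : width D ≤ e) : D e = 0 := by
  by_contra hne
  have := le_sup (f := id) (Finsupp.mem_support_iff.2 hne)
  simp only [width, id] at *
  omega

/-- The number of levels needed to encode markings of type `D` and rank functions. -/
noncomputable def numLevels (D : ℕ →₀ ℕ) : ℕ := (D.degree + 1) * width D

/-- The markings of type `D` of a finite set. -/
def markings (V : Type*) [Fintype V] [DecidableEq V] (D : ℕ →₀ ℕ) : Finset (V → ℕ) :=
  {d ∈ Fintype.piFinset fun _ : V => range (width D) | ∀ e < width D, #{v | d v = e} = D e}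

/-- The signed count of the chains of sets of white vertices of nonnegative excess, over all
markings of type `D`. -/
def markedSum (D : ℕ →₀ ℕ) (u : E → V) (w : E → W) : ℤ :=
  ∑ d ∈ markings V D, if excess u w d univ = 0 then chainSum (excess u w d) ∅ else 0

/-- The sum of `g` over the levels recorded by an exponent. -/
noncomputable def levelSum (D : ℕ →₀ ℕ) (x : ℕ → ℕ) (g : ℕ → ℕ) : ℕ := ∑ j ∈ range (numLevels D), g j * x j

/-- The exponents of the monomials that are counted with weight `(-1) ^ s`. -/
def IsCounted (D : ℕ →₀ ℕ) (s : ℕ) (x y : ℕ → ℕ) : Prop :=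
  (∀ e < width D, levelSum D x (fun j => if j % width D = e then 1 else 0) = D e) ∧
  levelSum D x (fun j => if j / width D = 0 ∨ s < j / width D then 1 else 0) = 0 ∧
  (∀ t, 1 ≤ t → t ≤ s → levelSum D x (fun j => if j / width D = t then 1 else 0) ≠ 0) ∧
  (∀ t < s, levelSum D x (fun j => if j / width D ≤ t then j % width D + 1 else 0) ≤
    levelSum D y (fun j => if j / width D ≤ t then 1 else 0)) ∧
  levelSum D x (fun j => j % width D + 1) = levelSum D y (fun _ => 1)

open scoped Classical in
/-- The weight of a monomial. -/
noncomputable def weight (D : ℕ →₀ ℕ) (x : ℕ ⊕ ℕ →₀ ℕ) : ℤ :=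
  ∑ s ∈ range (D.degree + 1), if IsCounted D s (x ∘ Sum.inl) (x ∘ Sum.inr) then (-1) ^ s else 0

/-- The exponent of the monomial attached to a choice of levels. -/
noncomputable def levelExponent (u : E → V) (w : E → W) (h : V → ℕ) : ℕ ⊕ ℕ →₀ ℕ :=
  ∑ v, Finsupp.single (Sum.inl (h v)) 1 + ∑ b, Finsupp.single (Sum.inr (levelMax u w h b)) 1

theorem levelSum_card {B : Type*} [Fintype B] (D : ℕ →₀ ℕ) {h : B → ℕ}
    (hh : ∀ v, h v < numLevels D) (g : ℕ → ℕ) :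
    levelSum D (fun j => #{v | h v = j}) g = ∑ v, g (h v) := by
  unfold levelSum
  rw [← sum_fiberwise_of_maps_to (g := h) (t := range (numLevels D))
    fun v _ => mem_range.2 (hh v)]
  refine sum_congr rfl fun j _ => ?_
  rw [sum_congr rfl fun v hv => by rw [(mem_filter.1 hv).2], sum_const, smul_eq_mul, mul_comm]

theorem levelExponent_inl (u : E → V) (w : E → W) (h : V → ℕ) :
    levelExponent u w h ∘ Sum.inl = fun j => #{v | h v = j} := by
  funext j
  rw [card_filter]
  simp [levelExponent, Finsupp.single_apply, -sum_boole]

theorem levelExponent_inr (u : E → V) (w : E → W) (h : V → ℕ) :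
    levelExponent u w h ∘ Sum.inr = fun j => #{b | levelMax u w h b = j} := by
  funext j
  rw [card_filter]
  simp [levelExponent, Finsupp.single_apply, -sum_boole]

theorem levelMax_lt {u : E → V} {w : E → W} (hw : Function.Surjective w) {h : V → ℕ} {L : ℕ}
    (hh : ∀ v, h v < L) (b : W) : levelMax u w h b < L := by
  obtain ⟨e, -, he⟩ := exists_levelMax_eq u hw h b
  rw [he]
  exact hh _

theorem isCounted_levelExponent_iff {D : ℕ →₀ ℕ} {u : E → V} {w : E → W}
    (hw : Function.Surjective w) {h : V → ℕ} (hh : ∀ v, h v < numLevels D) (s : ℕ) :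
    IsCounted D s (levelExponent u w h ∘ Sum.inl) (levelExponent u w h ∘ Sum.inr) ↔
      ((fun v => h v % width D) ∈ markings V D ∧ excess u w (fun v => h v % width D) univ = 0) ∧
      (∀ v, h v / width D ∈ range (s + 1)) ∧
        IsChainRank (excess u w fun v => h v % width D) s ∅ fun v => h v / width D := by
  have hw0 := width_pos D
  have hmax : ∀ t, (∑ b, if levelMax u w h b / width D ≤ t then 1 else 0) =
      #{b | ∀ e, w e = b → h (u e) / width D ≤ t} := by
    intro t
    rw [card_filter]
    refine sum_congr rfl fun b _ => if_congr ?_ rfl rfl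
    obtain ⟨e, he, he'⟩ := exists_levelMax_eq u hw h b
    refine ⟨fun h1 e' he2 => ?_, fun h1 => by rw [he']; exact h1 e he⟩
    exact (Nat.div_le_div_right ((levelMax_le_iff u w h b _).1 le_rfl e' he2)).trans h1
  have hex : ∀ t, (0 : ℤ) ≤ excess u w (fun v => h v % width D) {v | h v / width D ≤ t} ↔
      (∑ v, if h v / width D ≤ t then h v % width D + 1 else 0) ≤
        #{b | ∀ e, w e = b → h (u e) / width D ≤ t} := by
    intro t
    rw [excess, sub_nonneg, ← sum_filter]
    simp only [mem_filter, mem_univ, true_and]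
    norm_cast
  have hexu : excess u w (fun v => h v % width D) univ = 0 ↔
      ∑ v, (h v % width D + 1) = ∑ _b : W, 1 := by
    rw [excess, sub_eq_zero, eq_comm]
    simp only [mem_univ, implies_true, filter_true, sum_const, smul_eq_mul, mul_one]
    norm_cast
  have hmark : (fun v => h v % width D) ∈ markings V D ↔
      ∀ e < width D, (∑ v, if h v % width D = e then 1 else 0) = D e := by
    rw [markings, mem_filter, and_iff_right]
    · simp only [card_filter]
    · rw [Fintype.mem_piFinset]
      exact fun v => mem_range.2 (Nat.mod_lt _ hw0)
  rw [IsCounted, levelExponent_inl, levelExponent_inr]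
  simp only [levelSum_card D hh, levelSum_card D (levelMax_lt hw hh), hmax]
  rw [hmark, hexu, IsChainRank]
  simp only [hex]
  have h1 : (∑ v, if h v / width D = 0 ∨ s < h v / width D then 1 else 0) = 0 ↔
      (∀ v, h v / width D ∈ range (s + 1)) ∧ ({v | h v / width D = 0} : Finset V) = ∅ := by
    rw [← card_filter, card_eq_zero, filter_eq_empty_iff, filter_eq_empty_iff]
    simp only [mem_univ, true_imp_iff, not_or, mem_range, not_lt, forall_and, Nat.lt_succ_iff]
    tauto
  have h2 : ∀ t, (∑ v, if h v / width D = t then 1 else 0) ≠ 0 ↔ ∃ v, h v / width D = t := by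
    intro t
    rw [← card_filter, Ne, card_eq_zero, filter_eq_empty_iff]
    simp
  rw [h1]
  simp only [h2]
  tauto

theorem card_eq_degree_of_mem_markings {D : ℕ →₀ ℕ} {d : V → ℕ} (hd : d ∈ markings V D) :
    Fintype.card V = D.degree := by
  rw [markings, mem_filter, Fintype.mem_piFinset] at hd
  rw [← card_univ, card_eq_sum_card_fiberwise (f := d) (t := range (width D)) fun v _ => by
    simpa using hd.1 v, sum_congr rfl fun e he => hd.2 e (mem_range.1 he), Finsupp.degree_apply]
  symm
  refine sum_subset (fun e he => ?_) fun e _ he => Finsupp.notMem_support_iff.1 he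
  rw [mem_range]
  by_contra! h
  exact Finsupp.mem_support_iff.1 he (apply_eq_zero_of_width_le h)

open scoped Classical in
theorem sum_weight_levelExponent (D : ℕ →₀ ℕ) (u : E → V) {w : E → W}
    (hw : Function.Surjective w) :
    ∑ h ∈ Fintype.piFinset fun _ : V => range (numLevels D), weight D (levelExponent u w h) =
      markedSum D u w := by
  have hw0 := width_pos D
  have h1 : ∑ h ∈ Fintype.piFinset fun _ : V => range (numLevels D),
        weight D (levelExponent u w h) =
      ∑ z ∈ (Fintype.piFinset fun _ : V => range (width D)) ×ˢ
        (Fintype.piFinset fun _ : V => range (D.degree + 1)),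
        ∑ s ∈ range (D.degree + 1),
        if (z.1 ∈ markings V D ∧ excess u w z.1 univ = 0) ∧ (∀ v, z.2 v ∈ range (s + 1)) ∧
          IsChainRank (excess u w z.1) s ∅ z.2 then (-1) ^ s else 0 := by
    refine sum_nbij' (fun h => (fun v => h v % width D, fun v => h v / width D))
      (fun z v => width D * z.2 v + z.1 v) ?_ ?_ ?_ ?_ ?_
    · intro h hh
      simp only [Fintype.mem_piFinset, mem_range, mem_product, numLevels] at hh ⊢
      exact ⟨fun v => Nat.mod_lt _ hw0, fun v => (Nat.div_lt_iff_lt_mul hw0).2 (hh v)⟩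
    · intro z hz
      simp only [Fintype.mem_piFinset, mem_range, mem_product, numLevels] at hz ⊢
      intro v
      have := hz.1 v
      have := hz.2 v
      nlinarith
    · intro h _
      funext v
      exact Nat.div_add_mod _ _
    · intro z hz
      simp only [Fintype.mem_piFinset, mem_range, mem_product] at hz
      refine Prod.ext ?_ ?_ <;> funext v
      · simp [Nat.mod_eq_of_lt (hz.1 v)]
      · simp [Nat.mul_add_div hw0, Nat.div_eq_of_lt (hz.1 v)]
    · intro h hh
      simp only [Fintype.mem_piFinset, mem_range] at hh
      unfold weight
      exact sum_congr rfl fun s _ => if_congr (isCounted_levelExponent_iff hw hh s) rfl rfl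
  rw [h1, sum_product, markedSum]
  conv_rhs => rw [markings, sum_filter]
  refine sum_congr rfl fun d hd => ?_
  have hmem : d ∈ markings V D ↔ ∀ e < width D, #{v | d v = e} = D e := by
    rw [markings, mem_filter, and_iff_right hd]
  simp only [← hmem]
  by_cases hdm : d ∈ markings V D
  swap
  · simp [hdm]
  by_cases hd0 : excess u w d univ = 0
  swap
  · simp [hd0]
  simp only [hdm, hd0, true_and, if_true, and_self]
  rw [sum_comm, chainSum, card_eq_degree_of_mem_markings hdm]
  refine sum_congr rfl fun s hs => ?_
  rw [chainCount_eq_card, ← sum_filter, sum_const, nsmul_eq_mul, mul_comm]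
  congr 3
  ext τ
  simp only [mem_filter, Fintype.mem_piFinset, mem_range] at hs ⊢
  exact ⟨fun h => h.2, fun h => ⟨fun v => by have := h.1 v; omega, h⟩⟩

end Weight

section Stanley
variable {E V W : Type*} [Fintype E] [DecidableEq E] [Fintype V] [DecidableEq V] [Fintype W]
  [DecidableEq W]

theorem exists_eq_zero_of_eval_eq_zero {σ : Type*} (P : MvPolynomial σ ℚ) :
    ∃ M : ℕ, ∀ S : σ → Finset ℕ, (∀ i, M < #(S i)) →
      (∀ x : σ → ℕ, (∀ i, x i ∈ S i) → MvPolynomial.eval (fun i => (x i : ℚ)) P = 0) → P = 0 := by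
  classical
  obtain ⟨n, f, hf, P, rfl⟩ := MvPolynomial.exists_fin_rename P
  refine ⟨P.totalDegree, fun S hS h => ?_⟩
  suffices hP : P = 0 by rw [hP, map_zero]
  refine MvPolynomial.eq_zero_of_eval_zero_at_prod_finset P
    (fun i => (S (f i)).map Nat.castEmbedding) (fun i => ?_) fun x hx => ?_
  · rw [card_map]
    exact (MvPolynomial.degreeOf_le_totalDegree _ _).trans_lt (hS _)
  · have hne : ∀ i, ∃ m, m ∈ S i := fun i => card_pos.1 ((Nat.zero_le _).trans_lt (hS i))
    choose g hg using hne
    have hx' : ∀ i, ∃ m ∈ S (f i), (m : ℚ) = x i := fun i => by simpa using hx i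
    choose y hy hyx using hx'
    have h1 := h (Function.extend f y g) fun i => ?_
    · rw [MvPolynomial.eval_rename] at h1
      rw [← h1]
      congr 1
      congr 1
      funext i
      rw [Function.comp_apply, hf.extend_apply, hyx]
    · by_cases hi : ∃ j, f j = i
      · obtain ⟨j, rfl⟩ := hi
        rw [hf.extend_apply]
        exact hy j
      · rw [Function.extend_apply' _ _ _ hi]
        exact hg i

/-- Evaluation of a polynomial at the heights `p i` and the widths `q i` of blocks of rows. -/
noncomputable def evalBlocks (p q : ℕ → ℕ) : MvPolynomial (ℕ ⊕ ℕ) ℚ →ₐ[ℚ] ℚ :=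
  MvPolynomial.aeval fun i => ((Sum.elim p q i : ℕ) : ℚ)

theorem evalBlocks_X (p q : ℕ → ℕ) (i : ℕ ⊕ ℕ) :
    evalBlocks p q (MvPolynomial.X i) = ((Sum.elim p q i : ℕ) : ℚ) := MvPolynomial.aeval_X _ _

/-- The polynomial `P` computes the values of `F` at all diagrams made of `L` blocks of rows. -/
def IsStanley (L : ℕ) (F : YoungDiagram → ℚ) (P : MvPolynomial (ℕ ⊕ ℕ) ℚ) : Prop :=
  ∀ p q : ℕ → ℕ, (∀ i j, i ≤ j → j < L → q j ≤ q i) →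
    F (blockDiagram p q L) = evalBlocks p q P

theorem IsStanley.sub {L : ℕ} {F G : YoungDiagram → ℚ} {P Q : MvPolynomial (ℕ ⊕ ℕ) ℚ}
    (hP : IsStanley L F P) (hQ : IsStanley L G Q) : IsStanley L (F - G) (P - Q) := by
  intro p q hq
  rw [Pi.sub_apply, hP p q hq, hQ p q hq, map_sub]

theorem IsStanley.eq_zero {L : ℕ} {P : MvPolynomial (ℕ ⊕ ℕ) ℚ} (hP : IsStanley L 0 P) : P = 0 := by
  obtain ⟨M, hM⟩ := exists_eq_zero_of_eval_eq_zero P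
  refine hM (Sum.elim (fun _ => range (M + 1))
    fun i => Ico ((L - i) * (M + 1)) ((L - i + 1) * (M + 1))) ?_ fun x hx => ?_
  · rintro (i | i)
    · simp
    · simp only [Sum.elim_inr, Nat.card_Ico]
      rw [← Nat.sub_mul, Nat.add_sub_cancel_left]
      omega
  · have h := hP (x ∘ Sum.inl) (x ∘ Sum.inr) fun i j hij hj => ?_
    · rw [Pi.zero_apply, evalBlocks, Sum.elim_comp_inl_inr] at h
      exact h.symm
    · obtain rfl | hlt := hij.eq_or_lt
      · exact le_rfl
      · have h1 := hx (Sum.inr i)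
        have h2 := hx (Sum.inr j)
        simp only [Sum.elim_inr, mem_Ico] at h1 h2
        refine (h2.2.le.trans ?_).trans h1.1
        exact Nat.mul_le_mul_right _ (by omega)

theorem IsStanley.unique {L : ℕ} {F : YoungDiagram → ℚ} {P Q : MvPolynomial (ℕ ⊕ ℕ) ℚ}
    (hP : IsStanley L F P) (hQ : IsStanley L F Q) : P = Q := by
  have h := hP.sub hQ
  rw [sub_self] at h
  exact sub_eq_zero.1 h.eq_zero

theorem IsStanley.aeval {L : ℕ} {ι : Type*} {F : ι → YoungDiagram → ℚ}
    {P : ι → MvPolynomial (ℕ ⊕ ℕ) ℚ} (hP : ∀ i, IsStanley L (F i) (P i)) (K : MvPolynomial ι ℚ) :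
    IsStanley L (fun μ => MvPolynomial.aeval (fun i => F i μ) K) (MvPolynomial.aeval P K) := by
  intro p q hq
  rw [MvPolynomial.comp_aeval_apply]
  exact congrArg (fun f => MvPolynomial.aeval f K) (funext fun i => hP i p q hq)

theorem IsStanley.sum {L : ℕ} {ι : Type*} {s : Finset ι} {a : ι → ℚ} {F : ι → YoungDiagram → ℚ}
    {P : ι → MvPolynomial (ℕ ⊕ ℕ) ℚ} (hP : ∀ i ∈ s, IsStanley L (F i) (P i)) :
    IsStanley L (fun μ => ∑ i ∈ s, a i * F i μ) (∑ i ∈ s, MvPolynomial.C (a i) * P i) := by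
  intro p q hq
  rw [map_sum]
  refine sum_congr rfl fun i hi => ?_
  rw [map_mul, hP i hi p q hq]
  congr 1
  exact (MvPolynomial.algHom_C (evalBlocks p q) (a i)).symm

/-- The polynomial counting the colorings of a bipartite graph. -/
noncomputable def graphPoly (u : E → V) (w : E → W) (L : ℕ) : MvPolynomial (ℕ ⊕ ℕ) ℚ :=
  blockSum u w L (fun i => MvPolynomial.X (Sum.inl i)) fun i => MvPolynomial.X (Sum.inr i)

theorem isStanley_graphPoly {u : E → V} {w : E → W} (hu : Function.Surjective u)
    (hw : Function.Surjective w) (L : ℕ) :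
    IsStanley L (fun μ => (colorings μ u w : ℚ)) (graphPoly u w L) := by
  intro p q hq
  beta_reduce
  rw [colorings_blockDiagram hu hw p q L hq, graphPoly]
  have h1 := map_blockSum (evalBlocks p q : MvPolynomial (ℕ ⊕ ℕ) ℚ →+* ℚ) u w L
    (fun i => MvPolynomial.X (Sum.inl i)) fun i => MvPolynomial.X (Sum.inr i)
  have h2 := map_blockSum (Nat.castRingHom ℚ) u w L p q
  simp only [Function.comp_def, RingHom.coe_coe, evalBlocks_X, Sum.elim_inl, Sum.elim_inr] at h1
  exact h2.trans h1.symm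

/-- The linear functional on polynomials given by the weights of the monomials. -/
noncomputable def weightSum (D : ℕ →₀ ℕ) : MvPolynomial (ℕ ⊕ ℕ) ℚ →ₗ[ℚ] ℚ :=
  (MvPolynomial.basisMonomials (ℕ ⊕ ℕ) ℚ).constr ℚ fun x => (weight D x : ℚ)

theorem weightSum_monomial (D : ℕ →₀ ℕ) (x : ℕ ⊕ ℕ →₀ ℕ) :
    weightSum D (MvPolynomial.monomial x 1) = weight D x := by
  have h := congrFun (MvPolynomial.coe_basisMonomials (ℕ ⊕ ℕ) ℚ) x
  rw [weightSum, ← h, Module.Basis.constr_basis]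

theorem weightSum_graphPoly (D : ℕ →₀ ℕ) (u : E → V) {w : E → W} (hw : Function.Surjective w) :
    weightSum D (graphPoly u w (numLevels D)) = markedSum D u w := by
  rw [← sum_weight_levelExponent D u hw, graphPoly, blockSum, map_sum, Int.cast_sum]
  refine sum_congr rfl fun h _ => ?_
  rw [← weightSum_monomial, levelExponent]
  congr 1
  rw [← one_mul (1 : ℚ), ← MvPolynomial.monomial_mul, MvPolynomial.monomial_sum_one,
    MvPolynomial.monomial_sum_one]
  rfl

end Stanley

section Excess
variable {E V W : Type*} [Fintype E] [DecidableEq E] [Fintype V] [DecidableEq V] [Fintype W]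
  [DecidableEq W]

theorem chainSum_eq_neg_one_pow {f : Finset V → ℤ} (h : ∀ A, f A = 0) (A : Finset V) :
    chainSum f A = (-1) ^ #Aᶜ := by
  induction hn : #Aᶜ using Nat.strong_induction_on generalizing A with
  | _ n ih =>
  subst hn
  by_cases hA : A = univ
  · subst hA
    simp [chainSum_univ]
  have h1 : ∀ B, A ⊆ B → (-1 : ℤ) ^ #Bᶜ = (-1) ^ #Aᶜ * (-1) ^ #(B \ A) := by
    intro B hB
    have h2 : #Aᶜ = #Bᶜ + #(B \ A) := by
      rw [card_compl, card_compl, card_sdiff_of_subset hB]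
      have := card_le_card hB
      have := card_le_univ B
      omega
    rw [h2, pow_add, mul_assoc, ← mul_pow]
    simp
  have h3 : ∑ B with A ⊆ B, (-1 : ℤ) ^ #Bᶜ = 0 := by
    rw [sum_congr rfl fun B hB => h1 B (mem_filter.1 hB).2, ← mul_sum]
    have := sum_neg_one_pow_card_sdiff (subset_univ A)
    simp only [subset_univ, and_true, if_neg hA] at this
    rw [this, mul_zero]
  have h4 := sum_chainSum_superset f hA (h A).ge
  have h5 : ({B | A ⊆ B} : Finset (Finset V)) = insert A ({B | A ⊂ B} : Finset (Finset V)) := by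
    ext B
    simp only [mem_filter, mem_univ, true_and, mem_insert]
    rw [subset_iff_ssubset_or_eq, or_comm, eq_comm]
  rw [h5, sum_insert (by simp)] at h3 h4
  have h6 : ∑ B with A ⊂ B, chainSum f B = ∑ B with A ⊂ B, (-1 : ℤ) ^ #Bᶜ :=
    sum_congr rfl fun B hB =>
      ih _ (card_lt_card (compl_ssubset_compl.2 (mem_filter.1 hB).2)) B rfl
  rw [h6] at h4
  linarith

theorem excess_add_le (u : E → V) (w : E → W) (d : V → ℕ) (A B : Finset V) :
    excess u w d A + excess u w d B ≤ excess u w d (A ∪ B) + excess u w d (A ∩ B) := by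
  have h1 := sum_union_inter (s₁ := A) (s₂ := B) (f := fun v => (d v : ℤ) + 1)
  have h2 := card_union_add_card_inter ({b | ∀ e, w e = b → u e ∈ A} : Finset W)
    ({b | ∀ e, w e = b → u e ∈ B} : Finset W)
  have h3 : #(({b | ∀ e, w e = b → u e ∈ A} : Finset W) ∪
      ({b | ∀ e, w e = b → u e ∈ B} : Finset W)) ≤
      #({b | ∀ e, w e = b → u e ∈ A ∪ B} : Finset W) := by
    refine card_le_card fun b hb => ?_
    simp only [mem_union, mem_filter, mem_univ, true_and] at hb ⊢
    rcases hb with hb | hb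
    · exact fun e he => Or.inl (hb e he)
    · exact fun e he => Or.inr (hb e he)
  have h4 : #(({b | ∀ e, w e = b → u e ∈ A} : Finset W) ∩
      ({b | ∀ e, w e = b → u e ∈ B} : Finset W)) ≤
      #({b | ∀ e, w e = b → u e ∈ A ∩ B} : Finset W) := by
    refine card_le_card fun b hb => ?_
    simp only [mem_inter, mem_filter, mem_univ, true_and] at hb ⊢
    exact fun e he => ⟨hb.1 e he, hb.2 e he⟩
  unfold excess
  zify at h2 h3 h4
  linarith

theorem excess_empty (u : E → V) {w : E → W} (hw : Function.Surjective w) (d : V → ℕ) :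
    excess u w d ∅ = 0 := by
  rw [excess, sum_empty, sub_zero, Nat.cast_eq_zero, card_eq_zero, filter_eq_empty_iff]
  intro b _ h
  obtain ⟨e, he⟩ := hw b
  exact notMem_empty _ (h e he)

theorem excess_univ (u : E → V) (w : E → W) (d : V → ℕ) :
    excess u w d univ = Fintype.card W - ∑ v, ((d v : ℤ) + 1) := by
  simp [excess]

theorem excess_add_excess_compl (u : E → V) {w : E → W} (hw : Function.Surjective w) (d : V → ℕ)
    (A : Finset V) : excess u w d A + excess u w d Aᶜ = excess u w d univ -
      #{b | ∃ e e', w e = b ∧ w e' = b ∧ u e ∈ A ∧ u e' ∉ A} := by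
  have h1 := sum_add_sum_compl A fun v => (d v : ℤ) + 1
  have h2 : Fintype.card W = #({b | ∀ e, w e = b → u e ∈ A} : Finset W) +
      #({b | ∀ e, w e = b → u e ∈ Aᶜ} : Finset W) +
      #({b | ∃ e e', w e = b ∧ w e' = b ∧ u e ∈ A ∧ u e' ∉ A} : Finset W) := by
    rw [← card_union_of_disjoint, ← card_union_of_disjoint, ← card_univ]
    · congr 1
      ext b
      simp only [mem_univ, mem_union, mem_filter, true_and, mem_compl, true_iff]
      by_contra! h
      obtain ⟨⟨⟨e, he, h1⟩, e', he', h2⟩, h3⟩ := h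
      exact h1 (h3 e' e he' he h2)
    · rw [disjoint_union_left, disjoint_filter, disjoint_filter]
      refine ⟨fun b _ h => ?_, fun b _ h => ?_⟩
      · rintro ⟨e, e', -, he', -, h'⟩
        exact h' (h e' he')
      · rintro ⟨e, e', he, -, h', -⟩
        exact mem_compl.1 (h e he) h'
    · rw [disjoint_filter]
      intro b _ h h'
      obtain ⟨e, he⟩ := hw b
      exact mem_compl.1 (h' e he) (h e he)
  rw [excess_univ, h2]
  unfold excess
  push_cast
  linarith

theorem excess_add_excess_compl_lt {u : E → V} {w : E → W} (hw : Function.Surjective w)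
    (d : V → ℕ) {A : Finset V} {e e' : E} (hww : w e = w e') (he : u e ∈ A) (he' : u e' ∉ A) :
    excess u w d A + excess u w d Aᶜ < excess u w d univ := by
  rw [excess_add_excess_compl u hw, sub_lt_self_iff, Nat.cast_pos, card_pos]
  exact ⟨w e, mem_filter.2 ⟨mem_univ _, e, e', rfl, hww.symm, he, he'⟩⟩

theorem excess_add_excess_compl_eq {u : E → V} {w : E → W} (hw : Function.Surjective w)
    (d : V → ℕ) {A : Finset V} (h : ∀ e e', w e = w e' → u e ∈ A → u e' ∈ A) :
    excess u w d A + excess u w d Aᶜ = excess u w d univ := by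
  rw [excess_add_excess_compl u hw, sub_eq_self, Nat.cast_eq_zero, card_eq_zero,
    filter_eq_empty_iff]
  rintro b - ⟨e, e', rfl, he', h1, h2⟩
  exact h2 (h e e' he'.symm h1)

/-- The bipartite graph with endpoint maps `u` and `w` is connected: each proper nonempty set of
white vertices has a common neighbour with its complement. -/
def IsConnectedGraph (u : E → V) (w : E → W) : Prop :=
  ∀ A : Finset V, A.Nonempty → A ≠ univ → ∃ e e', w e = w e' ∧ u e ∈ A ∧ u e' ∉ A

theorem chainSum_excess_of_connected [Nonempty V] {u : E → V} {w : E → W}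
    (hw : Function.Surjective w) (hc : IsConnectedGraph u w) {d : V → ℕ}
    (hd : excess u w d univ = 0) :
    chainSum (excess u w d) ∅ = -1 ∨ chainSum (excess u w d) ∅ = 0 := by
  by_cases h : ∀ A, A.Nonempty → A ≠ univ → excess u w d A < 0
  · exact Or.inl (chainSum_eq_neg_one _ (excess_empty u hw d) h)
  · push Not at h
    obtain ⟨A, hA, hAu, h⟩ := h
    obtain ⟨e, e', hww, he, he'⟩ := hc A hA hAu
    have h2 := excess_add_excess_compl_lt hw d hww he he'
    refine Or.inr (chainSum_empty_eq_zero (excess_add_le u w d) (excess_empty u hw d) hd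
      (A₀ := A) ?_)
    omega

theorem markedSum_of_connected [Nonempty V] {u : E → V} {w : E → W} (hw : Function.Surjective w)
    (hc : IsConnectedGraph u w) (D : ℕ →₀ ℕ) :
    ∃ c : ℕ, (-1) ^ Fintype.card V * markedSum D u w = (-1) ^ D.degree * -(c : ℤ) := by
  by_cases h : (markings V D).Nonempty
  · obtain ⟨d, hd⟩ := h
    rw [card_eq_degree_of_mem_markings hd]
    suffices ∃ c : ℕ, -markedSum D u w = c by
      obtain ⟨c, hc⟩ := this
      exact ⟨c, by rw [← hc, neg_neg]⟩
    refine Int.eq_ofNat_of_zero_le ?_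
    rw [markedSum, ← sum_neg_distrib]
    refine sum_nonneg fun d _ => ?_
    split_ifs with hd
    · rcases chainSum_excess_of_connected hw hc hd with h | h <;> rw [h] <;> norm_num
    · simp
  · rw [not_nonempty_iff_eq_empty] at h
    exact ⟨0, by simp [markedSum, h]⟩

/-- Graphs with a component `S` that has fewer edges than vertices and is not a star around a single
white vertex are not counted. -/
theorem chainSum_excess_of_component {u : E → V} {w : E → W} (hw : Function.Surjective w)
    {d : V → ℕ} (hd : excess u w d univ = 0) {S : Finset V}
    (hS : ∀ e e', w e = w e' → u e ∈ S → u e' ∈ S)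
    (hcard : #{e | u e ∈ S} < #S + #{b | ∀ e, w e = b → u e ∈ S})
    (hconn : ∀ v ∈ S, ∃ e e', w e = w e' ∧ u e ∈ S.erase v ∧ u e' = v) :
    chainSum (excess u w d) ∅ = 0 := by
  by_cases hpos : ∃ A, 0 < excess u w d A
  · obtain ⟨A, hA⟩ := hpos
    exact chainSum_empty_eq_zero (excess_add_le u w d) (excess_empty u hw d) hd (Or.inl hA)
  push Not at hpos
  have hS0 : excess u w d S = 0 := by
    have h1 := excess_add_excess_compl_eq hw d hS
    have := hpos S
    have := hpos Sᶜ
    omega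
  have herase : ∀ v ∈ S, excess u w d (S.erase v) =
      (d v : ℤ) + 1 - #{b | ∃ e, w e = b ∧ u e = v} := by
    intro v hv
    have h1 : #({b | ∀ e, w e = b → u e ∈ S} : Finset W) =
        #({b | ∀ e, w e = b → u e ∈ S.erase v} : Finset W) +
        #({b | ∃ e, w e = b ∧ u e = v} : Finset W) := by
      rw [← card_union_of_disjoint]
      · congr 1
        ext b
        simp only [mem_union, mem_filter, mem_univ, true_and, mem_erase]
        constructor
        · intro h
          by_cases hb : ∃ e, w e = b ∧ u e = v
          · exact Or.inr hb
          · push Not at hb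
            exact Or.inl fun e he => ⟨hb e he, h e he⟩
        · rintro (h | ⟨e, he, rfl⟩)
          · exact fun e he => (h e he).2
          · exact fun e' he' => hS e e' (he.trans he'.symm) hv
      · rw [disjoint_filter]
        rintro b - h ⟨e, he, rfl⟩
        exact notMem_erase _ _ (h e he)
    have h2 := add_sum_erase S (fun v => (d v : ℤ) + 1) hv
    rw [excess] at hS0 ⊢
    rw [h1] at hS0
    push_cast at hS0
    linarith
  have hdeg : ∑ v ∈ S, #({b | ∃ e, w e = b ∧ u e = v} : Finset W) ≤ #{e | u e ∈ S} := by
    rw [card_eq_sum_card_fiberwise (f := u) (t := S) (s := {e | u e ∈ S}) fun e he =>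
      (mem_filter.1 (mem_coe.1 he)).2]
    refine sum_le_sum fun v hv => ?_
    refine (card_le_card fun b hb => ?_).trans
      (card_image_le (s := ({e ∈ ({e | u e ∈ S} : Finset E) | u e = v})) (f := w))
    obtain ⟨-, e, he, hev⟩ := mem_filter.1 hb
    exact mem_image.2 ⟨e, mem_filter.2 ⟨mem_filter.2 ⟨mem_univ _, hev ▸ hv⟩, hev⟩, he⟩
  have hex : ∃ v ∈ S, 0 ≤ excess u w d (S.erase v) := by
    by_contra! hcon
    have h1 : ∑ v ∈ S, (((d v : ℤ) + 1) + 1) ≤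
        ∑ v ∈ S, (#({b | ∃ e, w e = b ∧ u e = v} : Finset W) : ℤ) := by
      refine sum_le_sum fun v hv => ?_
      have := hcon v hv
      rw [herase v hv] at this
      omega
    rw [sum_add_distrib (g := fun _ => (1 : ℤ)), sum_const, nsmul_eq_mul, mul_one] at h1
    rw [excess] at hS0
    zify at hdeg hcard
    linarith
  obtain ⟨v, hv, h0⟩ := hex
  obtain ⟨e, e', hww, he, he'⟩ := hconn v hv
  have h2 := excess_add_excess_compl_lt hw d hww he (by rw [he']; exact notMem_erase _ _)
  have h3 := hpos (S.erase v)
  refine chainSum_empty_eq_zero (excess_add_le u w d) (excess_empty u hw d) hd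
    (A₀ := S.erase v) (Or.inr ⟨by omega, by omega⟩)

end Excess

section Sign
variable {A : Type*} [Fintype A] [DecidableEq A]

theorem card_cyc_add_card_support (σ : Perm A) :
    Fintype.card (Cyc σ) + #σ.support = Fintype.card A + Multiset.card σ.cycleType := by
  have h1 : (univ : Finset (Cyc σ)) =
      σ.support.image (cyc σ) ∪ σ.supportᶜ.image (cyc σ) := by
    rw [← image_union, union_compl, image_univ_of_surjective (cyc_surjective σ)]
  have h2 : Disjoint (σ.support.image (cyc σ)) (σ.supportᶜ.image (cyc σ)) := by
    rw [disjoint_left]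
    intro c h h'
    obtain ⟨a, ha, rfl⟩ := mem_image.1 h
    obtain ⟨b, hb, hba⟩ := mem_image.1 h'
    have := (cyc_eq_iff.1 hba).mem_support_iff
    exact mem_compl.1 hb (this.2 ha)
  have h3 : #(σ.supportᶜ.image (cyc σ)) = #σ.supportᶜ := by
    refine card_image_of_injOn fun a ha b _ hab => ?_
    have ha' : Function.IsFixedPt σ a := Perm.notMem_support.1 (mem_compl.1 (mem_coe.1 ha))
    exact ((cyc_eq_iff.1 hab).eq_of_left ha')
  have h4 : #(σ.support.image (cyc σ)) = #σ.cycleFactorsFinset := by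
    have hF : ∀ a, σ.cycleOf (σ a) = σ.cycleOf a := fun a =>
      (Perm.sameCycle_apply_left.2 (Perm.SameCycle.refl _ _)).cycleOf_eq
    have : (σ.support.image (cyc σ)).image (cycLift σ (fun a => σ.cycleOf a) hF) =
        σ.cycleFactorsFinset := by
      rw [image_image]
      ext c
      rw [mem_image]
      constructor
      · rintro ⟨a, ha, rfl⟩
        exact Perm.cycleOf_mem_cycleFactorsFinset_iff.2 ha
      · intro hc
        obtain ⟨a, ha⟩ := (Perm.mem_cycleFactorsFinset_iff.1 hc).1.nonempty_support
        exact ⟨a, Perm.mem_cycleFactorsFinset_support_le hc ha,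
          (Perm.cycle_is_cycleOf ha hc).symm⟩
    rw [← this]
    refine (card_image_of_injOn fun x hx y hy hxy => ?_).symm
    obtain ⟨a, ha, rfl⟩ := mem_image.1 (mem_coe.1 hx)
    obtain ⟨b, hb, rfl⟩ := mem_image.1 (mem_coe.1 hy)
    exact cyc_eq_iff.2 ((Perm.sameCycle_iff_cycleOf_eq_of_mem_support ha hb).2 hxy)
  have h5 : Multiset.card σ.cycleType = #σ.cycleFactorsFinset := by
    rw [Perm.cycleType_def, Multiset.card_map]
    rfl
  rw [← card_univ, h1, card_union_of_disjoint h2, h3, h4, h5, card_compl]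
  have := card_le_univ σ.support
  omega

theorem sign_eq_neg_one_pow (σ : Perm A) :
    Perm.sign σ = (-1) ^ (Fintype.card A + Fintype.card (Cyc σ)) := by
  rw [Perm.sign_of_cycleType, Perm.sum_cycleType]
  have h1 : Fintype.card A + Fintype.card (Cyc σ) + 2 * #σ.support =
      #σ.support + Multiset.card σ.cycleType + 2 * Fintype.card A := by
    have := card_cyc_add_card_support σ
    omega
  have h2 := congrArg (fun n => (-1 : ℤˣ) ^ n) h1
  beta_reduce at h2
  rw [pow_add _ _ (2 * _), pow_add _ _ (2 * _), pow_mul, pow_mul] at h2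
  simpa using h2.symm

theorem eq_one_of_card_cyc {σ : Perm A} (h : Fintype.card (Cyc σ) = Fintype.card A) : σ = 1 := by
  have h1 : Function.Injective (cyc σ) :=
    ((Fintype.bijective_iff_surjective_and_card _).2 ⟨cyc_surjective σ, h.symm⟩).1
  ext a
  exact h1 (cyc_apply σ a)

theorem card_cyc_one : Fintype.card (Cyc (1 : Perm A)) = Fintype.card A := by
  refine (Fintype.card_of_bijective (f := cyc (1 : Perm A)) ⟨fun a b h => ?_, cyc_surjective _⟩).symm
  exact Perm.sameCycle_one.1 (cyc_eq_iff.1 h)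

theorem subsingleton_cyc_finRotate (k : ℕ) : Subsingleton (Cyc (finRotate k)) :=
  ⟨fun a b => by
    obtain ⟨a, rfl⟩ := cyc_surjective _ a
    obtain ⟨b, rfl⟩ := cyc_surjective _ b
    exact cyc_eq_iff.2 (sameCycle_finRotate a b)⟩

theorem card_cyc_finRotate (k : ℕ) : Fintype.card (Cyc (finRotate (k + 1))) = 1 := by
  have := subsingleton_cyc_finRotate (k + 1)
  exact Fintype.card_eq_one_iff.2 ⟨cyc _ 0, fun a => Subsingleton.elim _ _⟩

theorem sign_eq_of_finRotate {k : ℕ} (q : Perm (Fin (k + 1))) :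
    Perm.sign q = -(-1) ^ Fintype.card (Cyc (q⁻¹ * finRotate (k + 1))) := by
  have h1 := sign_eq_neg_one_pow (q⁻¹ * finRotate (k + 1))
  have h2 := sign_eq_neg_one_pow (finRotate (k + 1))
  rw [Perm.sign_mul, Perm.sign_inv, h2, card_cyc_finRotate, pow_add, pow_add, pow_one] at h1
  have h3 : ((-1 : ℤˣ) ^ Fintype.card (Fin (k + 1))) * (-1) ^ Fintype.card (Fin (k + 1)) = 1 := by
    rw [← mul_pow]
    simp
  calc Perm.sign q = (Perm.sign q * ((-1) ^ Fintype.card (Fin (k + 1)) * -1)) *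
        (-1) ^ Fintype.card (Fin (k + 1)) * -1 := by
        rw [mul_assoc, mul_assoc, mul_assoc]
        simp
    _ = _ := by
        rw [h1, mul_comm ((-1) ^ Fintype.card (Fin (k + 1))), mul_assoc _ (_ ^ _) (_ ^ _), h3]
        simp

theorem exists_common_neighbour {π q : Perm A} (hπ : ∀ a b, π.SameCycle a b) {P : A → Prop}
    (hP : ∀ a, P ((q⁻¹ * π) a) ↔ P a) {a b : A} (ha : P a) (hb : ¬P b) :
    ∃ e e', cyc q e = cyc q e' ∧ P e ∧ ¬P e' := by
  by_contra! h
  have h1 : ∀ x, P (π x) ↔ P x := by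
    intro x
    have h2 : cyc q ((q⁻¹ * π) x) = cyc q (π x) := by
      conv_rhs => rw [show π x = q ((q⁻¹ * π) x) by simp]
      exact (cyc_apply q _).symm
    rw [← hP x]
    exact ⟨h _ _ h2.symm, h _ _ h2⟩
  have h3 := apply_eq_of_sameCycle (f := P) (fun x => propext (h1 x)) (hπ a b)
  exact hb (h3 ▸ ha)

theorem isConnectedGraph_cyc {π : Perm A} (hπ : ∀ a b, π.SameCycle a b) (q : Perm A) :
    IsConnectedGraph (cyc (q⁻¹ * π)) (cyc q) := by
  intro S hS hS'
  obtain ⟨c, hc⟩ := hS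
  obtain ⟨c', hc'⟩ : ∃ c', c' ∉ S := by
    by_contra! h
    exact hS' (eq_univ_of_forall h)
  obtain ⟨a, rfl⟩ := cyc_surjective _ c
  obtain ⟨b, rfl⟩ := cyc_surjective _ c'
  exact exists_common_neighbour (P := fun x => cyc (q⁻¹ * π) x ∈ S) hπ
    (fun x => by rw [cyc_apply]) hc hc'

end Sign

section Character

/-- The polynomial computing the normalized character of a long cycle on block diagrams. -/
noncomputable def sigmaPoly (k L : ℕ) : MvPolynomial (ℕ ⊕ ℕ) ℚ :=
  ∑ q : Perm (Fin k), MvPolynomial.C ((Perm.sign q : ℤ) : ℚ) *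
    graphPoly (cyc (q⁻¹ * finRotate k)) (cyc q) L

theorem isStanley_sigmaPoly (k L : ℕ) :
    IsStanley L (fun μ => SigmaCycle μ k) (sigmaPoly k L) := by
  have h : (fun μ => SigmaCycle μ k) = fun μ => ∑ q : Perm (Fin k), ((Perm.sign q : ℤ) : ℚ) *
      (colorings μ (cyc (q⁻¹ * finRotate k)) (cyc q) : ℚ) := by
    funext μ
    rw [SigmaCycle, normChar_eq_diagChar, diagChar_eq_sum_colorings]
  rw [h]
  exact IsStanley.sum fun q _ => isStanley_graphPoly (cyc_surjective _) (cyc_surjective _) L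

theorem weightSum_sigmaPoly {k : ℕ} (hk : 1 ≤ k) (D : ℕ →₀ ℕ) :
    ∃ c : ℕ, weightSum D (sigmaPoly k (numLevels D)) = (-1) ^ D.degree * c := by
  obtain ⟨k, rfl⟩ := Nat.exists_eq_add_of_le' hk
  have h : ∀ q : Perm (Fin (k + 1)), ∃ c : ℕ, ((Perm.sign q : ℤ) : ℚ) *
      weightSum D (graphPoly (cyc (q⁻¹ * finRotate (k + 1))) (cyc q) (numLevels D)) =
        (-1) ^ D.degree * c := by
    intro q
    have : Nonempty (Cyc (q⁻¹ * finRotate (k + 1))) := ⟨cyc _ 0⟩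
    obtain ⟨c, hc⟩ := markedSum_of_connected (cyc_surjective q)
      (isConnectedGraph_cyc sameCycle_finRotate q) D
    refine ⟨c, ?_⟩
    rw [weightSum_graphPoly D _ (cyc_surjective q), sign_eq_of_finRotate]
    push_cast
    have h1 := congrArg (Int.cast : ℤ → ℚ) hc
    push_cast at h1
    rw [neg_mul, h1]
    ring
  choose c hc using h
  refine ⟨∑ q, c q, ?_⟩
  rw [sigmaPoly, map_sum, Nat.cast_sum, mul_sum]
  refine sum_congr rfl fun q _ => ?_
  rw [← hc, ← smul_eq_mul (a := ((Perm.sign q : ℤ) : ℚ)), ← map_smul, MvPolynomial.smul_eq_C_mul]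

/-- The coefficient of a factorisation of the long cycle in the free cumulant `R_{k+1}`. -/
noncomputable def cumulantCoeff (k : ℕ) (q : Perm (Fin k)) : ℚ :=
  if Fintype.card (Cyc (q⁻¹ * finRotate k)) + Fintype.card (Cyc q) = k + 1 then
    ((Perm.sign q : ℤ) : ℚ) else 0

/-- The polynomial computing the free cumulant `R_{k+1}` on block diagrams. -/
noncomputable def cumulantPoly (k L : ℕ) : MvPolynomial (ℕ ⊕ ℕ) ℚ :=
  ∑ q : Perm (Fin k), MvPolynomial.C (cumulantCoeff k q) *
    graphPoly (cyc (q⁻¹ * finRotate k)) (cyc q) L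

theorem isStanley_cumulantPoly (k L : ℕ) :
    IsStanley L (fun μ => freeCumulant μ (k + 1)) (cumulantPoly k L) := by
  simp only [freeCumulant_eq_sum_colorings, ← ite_zero_mul]
  exact IsStanley.sum fun q _ => isStanley_graphPoly (cyc_surjective _) (cyc_surjective _) L

end Character

section DisjointUnions
variable {ι : Type*} [Fintype ι] [DecidableEq ι] {E V W : ι → Type*}
  [∀ i, Fintype (E i)] [∀ i, DecidableEq (E i)] [∀ i, Fintype (V i)] [∀ i, DecidableEq (V i)]
  [∀ i, Fintype (W i)] [∀ i, DecidableEq (W i)]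

theorem sigmaMap_surjective {w : ∀ i, E i → W i} (hw : ∀ i, Function.Surjective (w i)) :
    Function.Surjective (Sigma.map id w) :=
  Function.surjective_id.sigma_map hw

theorem levelMax_sigmaMap (u : ∀ i, E i → V i) (w : ∀ i, E i → W i) (h : (Σ i, V i) → ℕ)
    (b : Σ i, W i) : levelMax (Sigma.map id u) (Sigma.map id w) h b =
      levelMax (u b.1) (w b.1) (fun v => h ⟨b.1, v⟩) b.2 := by
  obtain ⟨i, b⟩ := b
  refine eq_of_forall_ge_iff fun t => ?_
  rw [levelMax_le_iff, levelMax_le_iff]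
  constructor
  · exact fun H e he => H ⟨i, e⟩ (congrArg (Sigma.mk i) he)
  · rintro H ⟨i', e⟩ he
    obtain ⟨rfl, he⟩ := Sigma.mk.inj_iff.1 he
    exact H e (eq_of_heq he)

theorem prod_graphPoly (u : ∀ i, E i → V i) (w : ∀ i, E i → W i) (L : ℕ) :
    ∏ i, graphPoly (u i) (w i) L = graphPoly (Sigma.map id u) (Sigma.map id w) L := by
  unfold graphPoly blockSum
  rw [prod_univ_sum]
  refine sum_nbij' (fun h x => h x.1 x.2) (fun h i v => h ⟨i, v⟩) ?_ ?_ ?_ ?_ ?_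
  · intro h hh
    simp only [Fintype.mem_piFinset] at hh ⊢
    exact fun x => hh x.1 x.2
  · intro h hh
    simp only [Fintype.mem_piFinset] at hh ⊢
    exact fun i v => hh ⟨i, v⟩
  · exact fun _ _ => rfl
  · exact fun _ _ => rfl
  · intro h _
    rw [prod_mul_distrib, Fintype.prod_sigma, Fintype.prod_sigma]
    simp only [levelMax_sigmaMap]

theorem card_filter_fst_eq (i : ι) : #{x : Σ i, E i | x.1 = i} = Fintype.card (E i) := by
  rw [← card_univ, ← card_map (Function.Embedding.sigmaMk i)]
  congr 1
  ext ⟨i', e⟩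
  simp only [mem_filter, mem_univ, true_and, mem_map, Function.Embedding.sigmaMk_apply]
  constructor
  · rintro rfl
    exact ⟨e, rfl⟩
  · rintro ⟨e', h⟩
    exact (Sigma.mk.inj_iff.1 h).1.symm

theorem markedSum_sigmaMap_eq_zero {u : ∀ i, E i → V i} {w : ∀ i, E i → W i}
    (hw : ∀ i, Function.Surjective (w i)) {i : ι} [Nontrivial (V i)]
    (hcard : Fintype.card (E i) < Fintype.card (V i) + Fintype.card (W i))
    (hconn : IsConnectedGraph (u i) (w i)) (D : ℕ →₀ ℕ) :
    markedSum D (Sigma.map id u) (Sigma.map id w) = 0 := by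
  refine sum_eq_zero fun d _ => ?_
  split_ifs with hd
  swap
  · rfl
  have hmem : ∀ e : Σ i, E i,
      Sigma.map id u e ∈ ({x | x.1 = i} : Finset (Σ i, V i)) ↔ e.1 = i := fun e => by
    rw [mem_filter, and_iff_right (mem_univ _)]
    rfl
  have hmem' : ∀ b : Σ i, W i, (∀ e, Sigma.map id w e = b →
      Sigma.map id u e ∈ ({x | x.1 = i} : Finset (Σ i, V i))) ↔ b.1 = i := by
    intro b
    obtain ⟨e₀, rfl⟩ := sigmaMap_surjective hw b
    constructor
    · exact fun h => (hmem _).1 (h e₀ rfl)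
    · intro h e he
      rw [hmem, ← h]
      exact congrArg (Sigma.fst (β := W)) he
  refine chainSum_excess_of_component (sigmaMap_surjective hw) hd (S := {x | x.1 = i}) ?_ ?_ ?_
  · intro e e' h he
    rw [hmem] at he ⊢
    rw [← he]
    exact (congrArg (Sigma.fst (β := W)) h).symm
  · rw [filter_congr fun e _ => hmem e, filter_congr fun b _ => hmem' b]
    simpa only [card_filter_fst_eq] using hcard
  · rintro ⟨i', v⟩ hv
    obtain rfl : i' = i := (mem_filter.1 hv).2
    obtain ⟨v', hv'⟩ := exists_ne v
    obtain ⟨e, e', hww, he, he'⟩ := hconn (univ.erase v) ⟨v', mem_erase.2 ⟨hv', mem_univ _⟩⟩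
      (fun h => notMem_erase v univ (by rw [h]; exact mem_univ v))
    refine ⟨⟨i', e⟩, ⟨i', e'⟩, ?_, ?_, ?_⟩
    · exact congrArg (Sigma.mk i') hww
    · refine mem_erase.2 ⟨fun h => ?_, (hmem _).2 rfl⟩
      exact (mem_erase.1 he).1 (eq_of_heq (Sigma.mk.inj_iff.1 h).2)
    · have : u i' e' = v := by
        by_contra h
        exact he' (mem_erase.2 ⟨h, mem_univ _⟩)
      exact congrArg (Sigma.mk i') this

theorem excess_sigmaMap_of_unique [∀ i, Unique (V i)] (u : ∀ i, E i → V i) {w : ∀ i, E i → W i}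
    (hw : ∀ i, Function.Surjective (w i)) (d : (Σ i, V i) → ℕ) (A : Finset (Σ i, V i)) :
    excess (Sigma.map id u) (Sigma.map id w) d A =
      ∑ x ∈ A, ((Fintype.card (W x.1) : ℤ) - (d x + 1)) := by
  have hmem : ∀ b : Σ i, W i, (∀ e, Sigma.map id w e = b → Sigma.map id u e ∈ A) ↔
      (⟨b.1, default⟩ : Σ i, V i) ∈ A := by
    intro b
    have h1 : ∀ e : Σ i, E i, Sigma.map id u e = ⟨e.1, default⟩ := fun e =>
      congrArg (Sigma.mk e.1) (Unique.eq_default _)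
    obtain ⟨e₀, rfl⟩ := sigmaMap_surjective hw b
    constructor
    · exact fun h => h1 e₀ ▸ h e₀ rfl
    · intro h e he
      rw [h1, show e.1 = e₀.1 from congrArg (Sigma.fst (β := W)) he]
      exact h
  rw [excess, sum_sub_distrib]
  simp only [hmem]
  congr 1
  rw [card_eq_sum_card_fiberwise (s := ({b | (⟨b.1, default⟩ : Σ i, V i) ∈ A} : Finset (Σ i, W i)))
    (f := fun b => (⟨b.1, default⟩ : Σ i, V i)) (t := A)
    fun b hb => (mem_filter.1 (mem_coe.1 hb)).2]
  push_cast
  refine sum_congr rfl fun x hx => ?_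
  rw [← card_filter_fst_eq (E := W), filter_filter]
  congr 2
  ext b
  simp only [mem_filter, mem_univ, true_and]
  constructor
  · rintro ⟨-, rfl⟩
    rfl
  · intro h
    have h2 : (⟨b.1, default⟩ : Σ i, V i) = x := by
      rw [h]
      exact congrArg (Sigma.mk x.1) (Unique.default_eq _)
    exact ⟨h2 ▸ hx, h2⟩

theorem chainSum_excess_of_unique [∀ i, Unique (V i)] (u : ∀ i, E i → V i) {w : ∀ i, E i → W i}
    (hw : ∀ i, Function.Surjective (w i)) (d : (Σ i, V i) → ℕ) :
    (if excess (Sigma.map id u) (Sigma.map id w) d univ = 0 then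
      chainSum (excess (Sigma.map id u) (Sigma.map id w) d) ∅ else 0) =
      if ∀ x, Fintype.card (W x.1) = d x + 1 then (-1) ^ Fintype.card ι else 0 := by
  have hex := excess_sigmaMap_of_unique u hw d
  split_ifs with h1 h2 h2
  · rw [chainSum_eq_neg_one_pow fun A => ?_]
    · simp
    · rw [hex]
      exact sum_eq_zero fun x _ => by rw [h2 x]; push_cast; ring
  · push Not at h2
    obtain ⟨x, hx⟩ := h2
    obtain ⟨y, -, hy⟩ : ∃ y ∈ univ, 0 < (Fintype.card (W y.1) : ℤ) - (d y + 1) := by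
      rw [hex] at h1
      refine exists_pos_of_sum_zero_of_exists_nonzero _ h1 ⟨x, mem_univ _, fun h => hx ?_⟩
      omega
    refine chainSum_empty_eq_zero (excess_add_le _ _ d) (excess_empty _ (sigmaMap_surjective hw) d)
      h1 (A₀ := {y}) (Or.inl ?_)
    rw [hex, sum_singleton]
    exact hy
  · refine absurd ?_ h1
    rw [hex]
    exact sum_eq_zero fun x _ => by rw [h2 x]; push_cast; ring
  · rfl

theorem comp_fst_mem_markings_iff [∀ i, Unique (V i)] (j : ι → ℕ) (D : ℕ →₀ ℕ) :
    (fun x : Σ i, V i => j x.1) ∈ markings (Σ i, V i) D ↔ ∀ e, #{i | j i = e} = D e := by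
  have h1 : ∀ e, #{x : Σ i, V i | j x.1 = e} = #{i | j i = e} := by
    intro e
    refine card_bij' (fun x _ => x.1) (fun i _ => ⟨i, default⟩) ?_ ?_ ?_ ?_
    · exact fun x hx => by simpa using hx
    · exact fun x hx => by simpa using hx
    · exact fun x _ => congrArg (Sigma.mk x.1) (Unique.default_eq _)
    · exact fun _ _ => rfl
  rw [markings, mem_filter, Fintype.mem_piFinset]
  simp only [h1, mem_range]
  constructor
  · rintro ⟨h2, h3⟩ e
    by_cases he : e < width D
    · exact h3 e he
    · rw [apply_eq_zero_of_width_le (not_lt.1 he), card_eq_zero, filter_eq_empty_iff]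
      rintro i - rfl
      exact he (h2 ⟨i, default⟩)
  · refine fun h => ⟨fun x => ?_, fun e _ => h e⟩
    by_contra! h2
    have h3 := h (j x.1)
    rw [apply_eq_zero_of_width_le h2, card_eq_zero, filter_eq_empty_iff] at h3
    exact h3 (mem_univ x.1) rfl

theorem markedSum_sigmaMap_of_unique [∀ i, Unique (V i)] (u : ∀ i, E i → V i)
    {w : ∀ i, E i → W i} (hw : ∀ i, Function.Surjective (w i)) {j : ι → ℕ}
    (hj : ∀ i, Fintype.card (W i) = j i + 1) (D : ℕ →₀ ℕ) [Decidable (∀ e, #{i | j i = e} = D e)] :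
    markedSum D (Sigma.map id u) (Sigma.map id w) =
      if ∀ e, #{i | j i = e} = D e then (-1) ^ Fintype.card ι else 0 := by
  have h1 : ∀ d : (Σ i, V i) → ℕ,
      (∀ x, Fintype.card (W x.1) = d x + 1) ↔ d = fun x => j x.1 := by
    intro d
    rw [funext_iff]
    refine forall_congr' fun x => ?_
    rw [hj]
    omega
  rw [markedSum, sum_congr rfl fun d _ => (chainSum_excess_of_unique u hw d).trans
    (if_congr (h1 d) rfl rfl), sum_ite_eq']
  exact if_congr (comp_fst_mem_markings_iff j D) rfl rfl

end DisjointUnions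

section Products
variable {ι : Type*} [Fintype ι] [DecidableEq ι]

theorem weightSum_C_mul (D : ℕ →₀ ℕ) (a : ℚ) (P : MvPolynomial (ℕ ⊕ ℕ) ℚ) :
    weightSum D (MvPolynomial.C a * P) = a * weightSum D P := by
  rw [← MvPolynomial.smul_eq_C_mul, map_smul, smul_eq_mul]

theorem weightSum_prod_C_mul_graphPoly {E V W : ι → Type*}
    [∀ i, Fintype (E i)] [∀ i, DecidableEq (E i)] [∀ i, Fintype (V i)] [∀ i, DecidableEq (V i)]
    [∀ i, Fintype (W i)] [∀ i, DecidableEq (W i)] (a : ι → ℚ) (u : ∀ i, E i → V i)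
    {w : ∀ i, E i → W i} (hw : ∀ i, Function.Surjective (w i)) (D : ℕ →₀ ℕ) :
    weightSum D (∏ i, MvPolynomial.C (a i) * graphPoly (u i) (w i) (numLevels D)) =
      (∏ i, a i) * markedSum D (Sigma.map id u) (Sigma.map id w) := by
  rw [prod_mul_distrib, ← map_prod, prod_graphPoly, weightSum_C_mul,
    weightSum_graphPoly D _ (sigmaMap_surjective hw)]

theorem prod_cumulantCoeff_mul_markedSum_eq_zero {j : ι → ℕ} {q : ∀ i, Perm (Fin (j i + 1))}
    {i : ι} (hi : q i ≠ 1) (D : ℕ →₀ ℕ) :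
    (∏ i, cumulantCoeff (j i + 1) (q i)) *
      markedSum D
        (Sigma.map (β₂ := fun i => Cyc ((q i)⁻¹ * finRotate (j i + 1))) id fun _ => cyc _)
        (Sigma.map (β₂ := fun i => Cyc (q i)) id fun i => cyc (q i)) = 0 := by
  by_cases hg : Fintype.card (Cyc ((q i)⁻¹ * finRotate (j i + 1))) + Fintype.card (Cyc (q i)) =
      j i + 1 + 1
  swap
  · rw [prod_eq_zero (mem_univ i) (if_neg hg), zero_mul]
  have hne : 0 < Fintype.card (Cyc ((q i)⁻¹ * finRotate (j i + 1))) :=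
    Fintype.card_pos_iff.2 ⟨cyc _ 0⟩
  have h1 : Fintype.card (Cyc ((q i)⁻¹ * finRotate (j i + 1))) ≠ 1 := fun h =>
    hi (eq_one_of_card_cyc (by rw [Fintype.card_fin]; omega))
  have : Nontrivial (Cyc ((q i)⁻¹ * finRotate (j i + 1))) :=
    Fintype.one_lt_card_iff_nontrivial.1 (by omega)
  rw [markedSum_sigmaMap_eq_zero (fun i => cyc_surjective (q i)) (i := i) ?_
    (isConnectedGraph_cyc sameCycle_finRotate (q i)), Int.cast_zero, mul_zero]
  rw [hg, Fintype.card_fin]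
  exact Nat.lt_succ_self _

theorem cumulantCoeff_one (k : ℕ) : cumulantCoeff (k + 1) 1 = 1 := by
  rw [cumulantCoeff, inv_one, one_mul, card_cyc_finRotate, card_cyc_one, Fintype.card_fin,
    if_pos (add_comm _ _)]
  simp

theorem weightSum_prod_cumulantPoly (j : ι → ℕ) (D : ℕ →₀ ℕ)
    [Decidable (∀ e, #{i | j i = e} = D e)] :
    weightSum D (∏ i, cumulantPoly (j i + 1) (numLevels D)) =
      if ∀ e, #{i | j i = e} = D e then (-1) ^ Fintype.card ι else 0 := by
  unfold cumulantPoly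
  rw [prod_univ_sum, map_sum, sum_eq_single fun _ => 1]
  · have hu : ∀ k, Unique (Cyc ((1 : Perm (Fin (k + 1)))⁻¹ * finRotate (k + 1))) := fun k => by
      rw [inv_one, one_mul]
      have := subsingleton_cyc_finRotate (k + 1)
      exact Unique.mk' _
    have := fun i => hu (j i)
    refine (weightSum_prod_C_mul_graphPoly (fun i => cumulantCoeff (j i + 1) 1) _
      (fun i => cyc_surjective _) D).trans ?_
    rw [prod_congr rfl fun i _ => cumulantCoeff_one (j i), prod_const_one, one_mul,
      markedSum_sigmaMap_of_unique (j := j) _ (fun i => cyc_surjective _)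
        (fun i => card_cyc_one.trans (Fintype.card_fin _)) D]
    split_ifs <;> simp
  · intro q _ hq
    obtain ⟨i, hi⟩ := Function.ne_iff.1 hq
    exact (weightSum_prod_C_mul_graphPoly (fun i => cumulantCoeff (j i + 1) (q i)) _
      (fun i => cyc_surjective _) D).trans (prod_cumulantCoeff_mul_markedSum_eq_zero hi D)
  · exact fun h => absurd (Fintype.mem_piFinset.2 fun _ => mem_univ _) h

theorem weightSum_monomial_cumulantPoly (D m : ℕ →₀ ℕ) :
    weightSum D (m.prod fun e n => cumulantPoly (e + 1) (numLevels D) ^ n) =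
      if m = D then (-1) ^ D.degree else 0 := by
  classical
  have h1 : (m.prod fun e n => cumulantPoly (e + 1) (numLevels D) ^ n) =
      ∏ i : Σ e : m.support, Fin (m e), cumulantPoly (i.1 + 1) (numLevels D) := by
    rw [Fintype.prod_sigma, Finsupp.prod, ← prod_coe_sort]
    refine prod_congr rfl fun e _ => ?_
    exact (Fin.prod_const _ _).symm
  have h2 : ∀ e, #{i : Σ e : m.support, Fin (m e) | (i.1 : ℕ) = e} = m e := by
    intro e
    by_cases he : e ∈ m.support
    · have h3 := card_filter_fst_eq (E := fun e : m.support => Fin (m e)) ⟨e, he⟩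
      rw [Fintype.card_fin] at h3
      rw [← h3]
      exact congrArg card (filter_congr fun i _ => by rw [Subtype.ext_iff])
    · rw [Finsupp.notMem_support_iff.1 he, card_eq_zero, filter_eq_empty_iff]
      rintro i - rfl
      exact he i.1.2
  rw [h1, weightSum_prod_cumulantPoly (fun i : Σ e : m.support, Fin (m e) => (i.1 : ℕ)) D]
  simp only [h2]
  rw [← DFunLike.ext_iff]
  split_ifs with h
  · subst h
    congr 1
    rw [Fintype.card_sigma, Finsupp.degree_apply, ← sum_coe_sort m.support]
    exact sum_congr rfl fun e _ => Fintype.card_fin _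
  · rfl

end Products

section Conclusion

/-- The coefficients of a rational Kerov polynomial are determined by the normalized
characters. -/
theorem neg_one_pow_mul_coeff {k : ℕ} {K : MvPolynomial ℕ ℚ}
    (hK : ∀ μ, SigmaCycle μ k = MvPolynomial.aeval (fun i => freeCumulant μ (i + 2)) K)
    (D : ℕ →₀ ℕ) :
    (-1) ^ D.degree * MvPolynomial.coeff D K = weightSum D (sigmaPoly k (numLevels D)) := by
  have h1 := IsStanley.aeval (fun i => isStanley_cumulantPoly (i + 1) (numLevels D)) K
  have h2 := isStanley_sigmaPoly k (numLevels D)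
  rw [show (fun μ => SigmaCycle μ k) =
    fun μ => MvPolynomial.aeval (fun i => freeCumulant μ (i + 1 + 1)) K from funext hK] at h2
  rw [h2.unique h1, MvPolynomial.aeval_def, MvPolynomial.eval₂_eq, map_sum]
  refine Eq.trans ?_ (sum_congr rfl fun m _ => (weightSum_C_mul D (MvPolynomial.coeff m K) _).trans
      (congrArg _ (weightSum_monomial_cumulantPoly D m))).symm
  simp only [mul_ite, mul_zero]
  rw [sum_ite_eq', mul_comm]
  split_ifs with h
  · rfl
  · rw [MvPolynomial.notMem_support_iff.1 h, zero_mul]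

theorem exists_nat_eq_coeff {k : ℕ} (hk : 1 ≤ k) {K : MvPolynomial ℕ ℚ}
    (hK : ∀ μ, SigmaCycle μ k = MvPolynomial.aeval (fun i => freeCumulant μ (i + 2)) K)
    (D : ℕ →₀ ℕ) : ∃ c : ℕ, MvPolynomial.coeff D K = c := by
  obtain ⟨c, hc⟩ := weightSum_sigmaPoly hk D
  refine ⟨c, mul_left_cancel₀ (pow_ne_zero D.degree (neg_ne_zero.2 one_ne_zero)) ?_⟩
  rw [neg_one_pow_mul_coeff hK, hc]

theorem aeval_map_intCast (x : ℕ → ℚ) (K : MvPolynomial ℕ ℤ) :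
    MvPolynomial.aeval x (MvPolynomial.map (Int.castRingHom ℚ) K) = MvPolynomial.aeval x K :=
  MvPolynomial.aeval_map_algebraMap ℚ x K

end Conclusion

end KerovPositivity

/-- **Kerov's conjecture (proved by Féray).** For every integer `k ≥ 1`, all
coefficients of the Kerov polynomial `K_k` — the unique integer polynomial in the
variables `R_2, R_3, …` (the variable `X i` standing for `R_{i+2}`) with
`Σ_k^μ = K_k(R_2^μ, R_3^μ, …)` for every Young diagram `μ` — are nonnegative. -/
theorem kerov_positivity (k : ℕ) (hk : 1 ≤ k) :
    ∃ K : MvPolynomial ℕ ℤ,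
      (∀ μ : YoungDiagram,
        SigmaCycle μ k = MvPolynomial.aeval (fun i => freeCumulant μ (i + 2)) K) ∧
      (∀ K' : MvPolynomial ℕ ℤ,
        (∀ μ : YoungDiagram,
          SigmaCycle μ k = MvPolynomial.aeval (fun i => freeCumulant μ (i + 2)) K') →
        K' = K) ∧
      ∀ m : ℕ →₀ ℕ, 0 ≤ MvPolynomial.coeff m K := by
  obtain ⟨Q, hQ⟩ := exists_rational_kerov_polynomial k
  obtain ⟨K, rfl⟩ : Q ∈ Set.range (MvPolynomial.map (σ := ℕ) (Int.castRingHom ℚ)) := by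
    rw [MvPolynomial.mem_range_map_iff_coeffs_subset]
    intro a ha
    obtain ⟨m, -, rfl⟩ := MvPolynomial.mem_coeffs_iff.1 ha
    obtain ⟨c, hc⟩ := exists_nat_eq_coeff hk hQ m
    exact ⟨c, by rw [hc]; simp⟩
  refine ⟨K, fun μ => (hQ μ).trans (aeval_map_intCast _ K), fun K' hK' => ?_, fun m => ?_⟩
  · refine MvPolynomial.map_injective (Int.castRingHom ℚ) Int.cast_injective (MvPolynomial.ext _ _ fun m => ?_)
    refine mul_left_cancel₀ (pow_ne_zero m.degree (neg_ne_zero.2 (one_ne_zero (α := ℚ)))) ?_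
    rw [neg_one_pow_mul_coeff hQ, neg_one_pow_mul_coeff fun μ =>
      (hK' μ).trans (aeval_map_intCast _ K').symm]
  · obtain ⟨c, hc⟩ := exists_nat_eq_coeff hk hQ m
    rw [MvPolynomial.coeff_map, eq_intCast] at hc
    have : MvPolynomial.coeff m K = c := by exact_mod_cast hc
    rw [this]
    exact Int.natCast_nonneg c

end AsympRep
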